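/- arXiv:1311.5083 — 3 statements merged into one kernel-verified Lean document; each statement's English description precedes it below -/
import Mathlib

section
/- Let F: Λ → ℝ^d be continuous, let I ⊂ {x_1,…,x_m} be the set of parabolic fixed points (those with T'(x_j) = 1), and let A be the convex hull of {F(x) : x ∈ I}. Assume that for every ε > 0 there exists ν ∈ M(Λ,T) with λ(ν,T) > 0 and h(ν,T)/λ(ν,T) > dim_H Λ − ε. Then for every α ∈ A, the Hausdorff dimension of the level set Λ_α equals dim_H Λ. -/
open MeasureTheory Set Filter Topology

noncomputable section

/-- A finite measurable partition of the space. -/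
def IsMeasPartition {X : Type*} [MeasurableSpace X] (P : Finset (Set X)) : Prop :=
  (∀ s ∈ P, MeasurableSet s) ∧ ((P : Set (Set X)).PairwiseDisjoint id) ∧ (⋃ s ∈ P, s) = univ

/-- Shannon entropy of the refinement `⋁_{i<n} T^{-i} P` of a finite partition `P`
under the first `n` iterates of `T`, with respect to the measure `μ`. -/
def partEntropy {X : Type*} [MeasurableSpace X] (T : X → X) (μ : Measure X)
    (P : Finset (Set X)) (n : ℕ) : ℝ :=
  ∑ c : Fin n → {s // s ∈ P},
    Real.negMulLog (μ (⋂ i : Fin n, T^[(i : ℕ)] ⁻¹' ((c i : Set X)))).toReal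

/-- The Kolmogorov–Sinai (metric) entropy of the measure `μ` for the map `T`:
the supremum over finite measurable partitions `P` of
`lim_n (1/n) H(⋁_{i<n} T^{-i}P)`, the limit being computed as an infimum (by
subadditivity of the entropy sequence). -/
def metricEntropy {X : Type*} [MeasurableSpace X] (T : X → X) (μ : Measure X) : ℝ :=
  ⨆ P : {P : Finset (Set X) // IsMeasPartition P},
    ⨅ n : ℕ, partEntropy T μ (P : Finset (Set X)) (n + 1) / (n + 1)

/-- Birkhoff (ergodic) average `A_n f(x) = (1/n) ∑_{j<n} f(T^j x)`. -/
def birkhoff {X E : Type*} [AddCommMonoid E] [Module ℝ E]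
    (T : X → X) (f : X → E) (n : ℕ) (x : X) : E :=
  (n : ℝ)⁻¹ • ∑ j ∈ Finset.range n, f (T^[j] x)

/-- The full shift space `Σ = {1,…,m}^ℕ`. -/
abbrev SymbSp (m : ℕ) := ℕ → Fin m

/-- The shift map `σ` on `Σ`. -/
def shift {m : ℕ} (ω : SymbSp m) : SymbSp m := fun n => ω (n + 1)

/-- The set `M(Σ,σ)` of shift-invariant Borel probability measures on `Σ`. -/
def shiftInvMeasures (m : ℕ) : Set (Measure (SymbSp m)) :=
  {μ | IsProbabilityMeasure μ ∧ μ.map shift = μ}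

/-- The level set `X_α = {ω ∈ Σ : lim_n A_n f(ω) = α}` of a potential `f` on `Σ`. -/
def symbLevelSet {m : ℕ} {E : Type*} [AddCommMonoid E] [Module ℝ E] [TopologicalSpace E]
    (f : SymbSp m → E) (α : E) : Set (SymbSp m) :=
  {ω | Tendsto (fun n => birkhoff shift f n ω) atTop (𝓝 α)}

/-- A piecewise `C¹` expanding (possibly non-uniformly hyperbolic) interval map:
`m` pairwise non-overlapping subintervals `I 1, …, I m` of `[0,1]`, a map `T` which
restricted to each `I i` is a `C¹` surjection onto `[0,1]` (with derivative `T'`),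
a unique fixed point `fixPt i` of `T` in each `I i`, and `T' > 1` away from the
fixed points. -/
structure PCSystem (m : ℕ) where
  hm : 0 < m
  I : Fin m → Set ℝ
  T : ℝ → ℝ
  T' : ℝ → ℝ
  fixPt : Fin m → ℝ
  hI : ∀ i, ∃ a b : ℝ, a < b ∧ I i = Icc a b
  hIsub : ∀ i, I i ⊆ Icc 0 1
  hdisj : ∀ i j, i ≠ j → Disjoint (interior (I i)) (interior (I j))
  hTmeas : Measurable T
  hT'meas : Measurable T'
  hmapsto : ∀ i, MapsTo T (I i) (Icc 0 1)
  hsurj : ∀ i, SurjOn T (I i) (Icc 0 1)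
  hderiv : ∀ i, ∀ x ∈ I i, HasDerivWithinAt T (T' x) (I i) x
  hT'cont : ∀ i, ContinuousOn T' (I i)
  hfixmem : ∀ i, fixPt i ∈ I i
  hfix : ∀ i, T (fixPt i) = fixPt i
  hfixuniq : ∀ i, ∀ y ∈ I i, T y = y → y = fixPt i
  hexp : ∀ y ∈ ⋃ i, I i, y ∉ range fixPt → 1 < T' y

namespace PCSystem

variable {m : ℕ} (S : PCSystem m)

/-- The attractor `Λ = {x ∈ ⋃ I_i : T^n x ∈ [0,1] for all n}`. -/
def attractor : Set ℝ :=
  {x | (x ∈ ⋃ i, S.I i) ∧ ∀ n : ℕ, S.T^[n] x ∈ Icc (0:ℝ) 1}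

/-- The basic interval `I_w = T_{w₁}∘⋯∘T_{wₙ}([0,1])` coded by the word `w`,
described via the forward map: `I_{i·w} = I_i ∩ T⁻¹(I_w)`. -/
def cyl (S : PCSystem m) : List (Fin m) → Set ℝ
  | [] => Icc 0 1
  | i :: w => S.I i ∩ S.T ⁻¹' (cyl S w)

end PCSystem

/-- The word `ω₁…ωₙ` of the first `n` symbols of `ω`. -/
def word {m : ℕ} (ω : SymbSp m) (n : ℕ) : List (Fin m) := List.ofFn fun j : Fin n => ω j

namespace PCSystem

variable {m : ℕ} (S : PCSystem m)

/-- The coding map `Π : Σ → Λ`, `Π(ω) = lim_n T_{ω₁}∘⋯∘T_{ωₙ}([0,1])`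
(realized as the supremum of the nested intersection `⋂_n I_{ω|_n}`, which is
a single point). -/
def code (ω : SymbSp m) : ℝ := sSup (⋂ n : ℕ, S.cyl (word ω n))

/-- The geometric potential `g(ω) = −log T'_{ω₁}(Π(σω)) = log T'(Π(ω))`. -/
def g (ω : SymbSp m) : ℝ := Real.log (S.T' (S.code ω))

/-- `Σ̃ = {ω : liminf_n A_n g(ω) > 0}`. -/
def SigmaTilde : Set (SymbSp m) :=
  {ω | 0 < atTop.liminf fun n => birkhoff shift S.g n ω}

/-- The set `M(Λ,T)` of `T`-invariant Borel probability measures on the attractor `Λ`. -/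
def invMeasures : Set (Measure ℝ) :=
  {μ | IsProbabilityMeasure μ ∧ μ.map S.T = μ ∧ μ S.attractorᶜ = 0}

/-- Lyapunov exponent `λ(μ,T) = ∫ log|T'| dμ` of a measure on the attractor. -/
def lyap (μ : Measure ℝ) : ℝ := ∫ x, Real.log |S.T' x| ∂μ

/-- Lyapunov exponent `λ(μ,σ) = ∫ g dμ` of a measure on the shift space. -/
def lyapSymb (μ : Measure (SymbSp m)) : ℝ := ∫ ω, S.g ω ∂μ

/-- The set of parabolic fixed points, i.e. those fixed points `x_j` with `T'(x_j) = 1`. -/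
def parabolicSet : Set ℝ := {y | ∃ i, y = S.fixPt i ∧ S.T' y = 1}

/-- The level set `Λ_α = {x ∈ Λ : lim_n (1/n)∑_{j<n} F(T^j x) = α}`. -/
def levelSet {E : Type*} [AddCommMonoid E] [Module ℝ E] [TopologicalSpace E]
    (F : ℝ → E) (α : E) : Set ℝ :=
  {x | x ∈ S.attractor ∧ Tendsto (fun n => birkhoff S.T F n x) atTop (𝓝 α)}

/-- `Λ̃`: the set of points of the attractor having exactly two codings. -/
def doubleCoded : Set ℝ := {x | x ∈ S.attractor ∧ (S.code ⁻¹' {x}).ncard = 2}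

end PCSystem

namespace PCSystem
variable {m : ℕ} (S : PCSystem m)

lemma one_le_T' {i : Fin m} {x : ℝ} (hx : x ∈ S.I i) : 1 ≤ S.T' x := by
  obtain ⟨a, b, hab, hI⟩ := S.hI i
  have hd : Dense ((range S.fixPt)ᶜ : Set ℝ) := (finite_range S.fixPt).countable.dense_compl ℝ
  have h1 : Ioo a b ⊆ closure (Ioo a b ∩ (range S.fixPt)ᶜ) :=
    hd.open_subset_closure_inter isOpen_Ioo
  have h2 : x ∈ closure (Ioo a b ∩ (range S.fixPt)ᶜ) := by
    have : closure (Ioo a b) ⊆ closure (Ioo a b ∩ (range S.fixPt)ᶜ) :=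
      closure_minimal h1 isClosed_closure
    rw [closure_Ioo hab.ne] at this
    exact this (hI ▸ hx)
  have hc : ContinuousWithinAt S.T' (Ioo a b ∩ (range S.fixPt)ᶜ) x := by
    refine (S.hT'cont i x hx).mono ?_
    rw [hI]
    exact fun y hy => Ioo_subset_Icc_self hy.1
  have : (𝓝[Ioo a b ∩ (range S.fixPt)ᶜ] x).NeBot := mem_closure_iff_nhdsWithin_neBot.1 h2
  refine ge_of_tendsto hc ?_
  filter_upwards [self_mem_nhdsWithin] with y hy
  exact (S.hexp y (mem_iUnion.2 ⟨i, hI ▸ Ioo_subset_Icc_self hy.1⟩) hy.2).le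

lemma contT (i : Fin m) : ContinuousOn S.T (S.I i) := fun x hx =>
  (S.hderiv i x hx).continuousWithinAt

lemma convI (i : Fin m) : Convex ℝ (S.I i) := by
  obtain ⟨a, b, hab, hI⟩ := S.hI i
  rw [hI]; exact convex_Icc a b

lemma closedI (i : Fin m) : IsClosed (S.I i) := by
  obtain ⟨a, b, hab, hI⟩ := S.hI i
  rw [hI]; exact isClosed_Icc

lemma compactI (i : Fin m) : IsCompact (S.I i) := by
  obtain ⟨a, b, hab, hI⟩ := S.hI i
  rw [hI]; exact isCompact_Icc

lemma monoSub (i : Fin m) : MonotoneOn (fun x => S.T x - x) (S.I i) := by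
  obtain ⟨a, b, hab, hI⟩ := S.hI i
  refine monotoneOn_of_hasDerivWithinAt_nonneg (f' := fun x => S.T' x - 1) (S.convI i)
    ((S.contT i).sub continuousOn_id) ?_ ?_
  · intro x hx
    exact ((S.hderiv i x (interior_subset hx)).mono interior_subset).sub
      (hasDerivWithinAt_id x _)
  · intro x hx
    have := S.one_le_T' (interior_subset hx)
    linarith

lemma expand {i : Fin m} {u v : ℝ} (hu : u ∈ S.I i) (hv : v ∈ S.I i) (h : u ≤ v) :
    v - u ≤ S.T v - S.T u := by
  have := S.monoSub i hu hv h
  simp only at this; linarith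

lemma disjI {i j : Fin m} (hij : i ≠ j) : Disjoint (S.I i) (S.I j) := by
  have key : ∀ i j : Fin m, ∀ a b c d : ℝ, S.I i = Icc a b → S.I j = Icc c d → a < b → c < d →
      b = c → False := by
    intro i j a b c d hi hj hab hcd hbc
    obtain ⟨y, hy, hy1⟩ := S.hsurj i (show (1:ℝ) ∈ Icc (0:ℝ) 1 by simp)
    obtain ⟨z, hz, hz1⟩ := S.hsurj j (show (0:ℝ) ∈ Icc (0:ℝ) 1 by simp)
    have hb : b ∈ S.I i := by rw [hi]; exact ⟨hab.le, le_rfl⟩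
    have hc : c ∈ S.I j := by rw [hj]; exact ⟨le_rfl, hcd.le⟩
    have hyb : y ≤ b := by rw [hi] at hy; exact hy.2
    have hcz : c ≤ z := by rw [hj] at hz; exact hz.1
    have h1 := S.expand hy hb hyb
    have h2 := S.expand hc hz hcz
    rw [hbc] at h1 hyb
    linarith
  obtain ⟨a, b, hab, hi⟩ := S.hI i
  obtain ⟨c, d, hcd, hj⟩ := S.hI j
  have hd := S.hdisj i j hij
  rw [hi, hj, interior_Icc, interior_Icc] at hd
  rw [Set.disjoint_left]
  intro x hx hy
  have hx' := hx
  have hy' := hy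
  rw [hi] at hx'
  rw [hj] at hy'
  by_cases h1 : b = c
  · exact key i j a b c d hi hj hab hcd h1
  by_cases h2 : d = a
  · exact key j i c d a b hj hi hcd hab h2
  have hbc : c < b := lt_of_le_of_ne (hy'.1.trans hx'.2) (Ne.symm h1)
  have had : a < d := lt_of_le_of_ne (hx'.1.trans hy'.2) (Ne.symm h2)
  have hlt : max a c < min b d := by
    simp only [max_lt_iff, lt_min_iff]; exact ⟨⟨hab, hbc⟩, had, hcd⟩
  obtain ⟨z, hz1, hz2⟩ := exists_between hlt
  rw [Set.disjoint_left] at hd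
  simp only [max_lt_iff, lt_min_iff] at hz1 hz2
  exact hd (show z ∈ Ioo a b from ⟨hz1.1, hz2.1⟩) ⟨hz1.2, hz2.2⟩

lemma expand_strict {i : Fin m} {u v : ℝ} (hu : u ∈ S.I i) (hv : v ∈ S.I i) (h : u < v) :
    v - u < S.T v - S.T u := by
  refine lt_of_le_of_ne (S.expand hu hv h.le) fun heq => ?_
  have hsub : Icc u v ⊆ S.I i := (S.convI i).ordConnected.out hu hv
  have hd : Dense ((range S.fixPt)ᶜ : Set ℝ) := (finite_range S.fixPt).countable.dense_compl ℝ
  obtain ⟨z, hz, hzf⟩ := hd.inter_open_nonempty (Ioo u v) isOpen_Ioo (nonempty_Ioo.2 h)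
  have hzI : z ∈ S.I i := hsub (Ioo_subset_Icc_self hz)
  have h1 := S.hexp z (mem_iUnion.2 ⟨i, hzI⟩) hzf
  have hnh : Icc u v ∈ 𝓝 z := Icc_mem_nhds hz.1 hz.2
  have hder : HasDerivAt S.T (S.T' z) z :=
    (S.hderiv i z hzI).hasDerivAt (Filter.mem_of_superset hnh hsub)
  have hder2 : HasDerivAt (fun x => x + (S.T u - u)) 1 z := (hasDerivAt_id z).add_const _
  have : S.T =ᶠ[𝓝 z] fun x => x + (S.T u - u) := by
    filter_upwards [hnh] with y hy
    have e1 := S.expand hu (hsub hy) hy.1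
    have e2 := S.expand (hsub hy) hv hy.2
    linarith
  have := (hder2.congr_of_eventuallyEq this).unique hder
  linarith

lemma expand_unif {ε : ℝ} (hε : 0 < ε) : ∃ η > 0, ∀ i, ∀ u ∈ S.I i, ∀ v ∈ S.I i, ε ≤ v - u →
    v - u + η ≤ S.T v - S.T u := by
  have h : ∀ i, ∃ η > 0, ∀ u ∈ S.I i, ∀ v ∈ S.I i, ε ≤ v - u →
    v - u + η ≤ S.T v - S.T u := by
    intro i
    set D : Set (ℝ × ℝ) := (S.I i ×ˢ S.I i) ∩ {p | ε ≤ p.2 - p.1}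
    have hDc : IsCompact D := ((S.compactI i).prod (S.compactI i)).inter_right
      (isClosed_le continuous_const (by fun_prop))
    have hcont : ContinuousOn (fun p : ℝ × ℝ => (S.T p.2 - S.T p.1) - (p.2 - p.1)) D := by
      have c1 : ContinuousOn (fun p : ℝ × ℝ => S.T p.2) D :=
        (S.contT i).comp continuousOn_snd (fun p hp => hp.1.2)
      have c2 : ContinuousOn (fun p : ℝ × ℝ => S.T p.1) D :=
        (S.contT i).comp continuousOn_fst (fun p hp => hp.1.1)
      exact (c1.sub c2).sub (by fun_prop)
    rcases D.eq_empty_or_nonempty with he | hne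
    · refine ⟨1, one_pos, fun u hu v hv h => ?_⟩
      have : (u, v) ∈ D := ⟨⟨hu, hv⟩, h⟩
      rw [he] at this; exact this.elim
    · obtain ⟨p, hp, hmin⟩ := hDc.exists_isMinOn hne hcont
      refine ⟨_, sub_pos.2 (S.expand_strict hp.1.1 hp.1.2 ?_), fun u hu v hv h => ?_⟩
      · have := hp.2; change ε ≤ p.2 - p.1 at this; linarith
      · have := isMinOn_iff.1 hmin (u, v) (show (u, v) ∈ D from ⟨⟨hu, hv⟩, h⟩)
        simp only at this
        linarith
  choose η hη h using h
  have : Nonempty (Fin m) := ⟨⟨0, S.hm⟩⟩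
  obtain ⟨i0, hi0⟩ := Finite.exists_min η
  refine ⟨η i0, hη i0, fun i u hu v hv hh => ?_⟩
  have := h i u hu v hv hh
  have := hi0 i
  linarith

/-- points whose first `n` symbols are given by `ω` -/
def Cy (ω : ℕ → Fin m) (n : ℕ) : Set ℝ := {x | ∀ j < n, S.T^[j] x ∈ S.I (ω j)}

lemma Cy_mono (ω : ℕ → Fin m) {n k : ℕ} (h : n ≤ k) : S.Cy ω k ⊆ S.Cy ω n :=
  fun _ hx j hj => hx j (hj.trans_le h)

lemma Cy_iter {ω : ℕ → Fin m} {n k : ℕ} {x : ℝ} (hx : x ∈ S.Cy ω (n + k)) :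
    S.T^[n] x ∈ S.Cy (fun j => ω (n + j)) k := by
  intro j hj
  rw [← Function.iterate_add_apply, add_comm j n]
  exact hx _ (by omega)

lemma iter_mono (ω : ℕ → Fin m) (n : ℕ) : ∀ x ∈ S.Cy ω n, ∀ y ∈ S.Cy ω n, x ≤ y →
    y - x ≤ S.T^[n] y - S.T^[n] x := by
  induction n with
  | zero => intro x _ y _ _; simp
  | succ n ih =>
    intro x hx y hy hxy
    have h1 := ih x (S.Cy_mono ω n.le_succ hx) y (S.Cy_mono ω n.le_succ hy) hxy
    have h2 := S.expand (hx n n.lt_succ_self) (hy n n.lt_succ_self) (by linarith)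
    rw [Function.iterate_succ_apply', Function.iterate_succ_apply']
    linarith

lemma Cy_ordConnected (ω : ℕ → Fin m) (n : ℕ) : (S.Cy ω n).OrdConnected := by
  induction n with
  | zero => 
    have : S.Cy ω 0 = univ := by ext; simp [Cy]
    rw [this]; exact ordConnected_univ
  | succ n ih =>
    refine ⟨fun x hx y hy z hz => ?_⟩
    have hx' := S.Cy_mono ω n.le_succ hx
    have hy' := S.Cy_mono ω n.le_succ hy
    have hz' := ih.out hx' hy' hz
    intro j hj
    rcases Nat.lt_succ_iff_lt_or_eq.1 hj with h | rfl
    · exact hz' j h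
    · have h1 := S.iter_mono ω j x hx' z hz' hz.1
      have h2 := S.iter_mono ω j z hz' y hy' hz.2
      have a1 := hz.1
      have a2 := hz.2
      exact (S.convI _).ordConnected.out (hx j hj) (hy j hj) ⟨by linarith, by linarith⟩

lemma diam_small {ε : ℝ} (hε : 0 < ε) : ∃ M : ℕ, ∀ ω n, M ≤ n → ∀ x ∈ S.Cy ω n, ∀ y ∈ S.Cy ω n,
    |x - y| < ε := by
  obtain ⟨η, hη, h⟩ := S.expand_unif hε
  obtain ⟨M, hM⟩ := exists_nat_gt (1 / η)
  have key : ∀ ω : ℕ → Fin m, ∀ x ∈ S.Cy ω (M+1), ∀ y ∈ S.Cy ω (M+1), ε ≤ y - x → False := by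
    intro ω x hx y hy hxy
    have : ∀ j ≤ M+1, ε + j * η ≤ S.T^[j] y - S.T^[j] x := by
      intro j
      induction j with
      | zero => intro _; simpa using hxy
      | succ j ih =>
        intro hj
        have h1 := ih (by omega)
        have h2 := h _ _ (hx j (by omega)) _ (hy j (by omega)) (by
          have : 0 ≤ j * η := by positivity
          linarith)
        rw [Function.iterate_succ_apply', Function.iterate_succ_apply']
        push_cast
        linarith
    have h3 := this M (by omega)
    have h4 := S.hIsub _ (hx M (by omega))
    have h5 := S.hIsub _ (hy M (by omega))
    have h6 : 1 < M * η := by rwa [div_lt_iff₀ hη] at hM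
    linarith [h4.1, h5.2]
  refine ⟨M + 1, fun ω n hn x hx y hy => ?_⟩
  have hx' := S.Cy_mono ω hn hx
  have hy' := S.Cy_mono ω hn hy
  by_contra hcon
  push Not at hcon
  rcases le_abs.1 hcon with h1 | h1
  · exact key ω y hy' x hx' h1
  · exact key ω x hx' y hy' (by linarith)

lemma Cy_closed (n : ℕ) : ∀ ω : ℕ → Fin m, IsClosed (S.Cy ω n) := by
  induction n with
  | zero => 
    intro ω
    have : S.Cy ω 0 = univ := by ext; simp [Cy]
    rw [this]; exact isClosed_univ
  | succ n ih =>
    intro ω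
    have : S.Cy ω (n+1) = S.I (ω 0) ∩ S.T ⁻¹' (S.Cy (fun j => ω (j+1)) n) := by
      ext x
      constructor
      · intro hx
        exact ⟨hx 0 (by omega), fun j hj => hx (j+1) (by omega)⟩
      · rintro ⟨h0, h1⟩ j hj
        cases j with
        | zero => exact h0
        | succ j => exact h1 j (by omega)
    rw [this]
    exact (S.contT _).preimage_isClosed_of_isClosed (S.closedI _) (ih _)

lemma Cy_nonempty (n : ℕ) : ∀ ω : ℕ → Fin m, (S.Cy ω n ∩ Icc 0 1).Nonempty := by
  induction n with
  | zero => intro ω; exact ⟨0, by simp [Cy]⟩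
  | succ n ih =>
    intro ω
    obtain ⟨y, hy, hy1⟩ := ih (fun j => ω (j+1))
    obtain ⟨x, hx, hxy⟩ := S.hsurj (ω 0) hy1
    refine ⟨x, fun j hj => ?_, S.hIsub _ hx⟩
    cases j with
    | zero => exact hx
    | succ j => 
      rw [Function.iterate_succ_apply, hxy]
      exact hy j (by omega)

lemma exists_point (ω : ℕ → Fin m) : ∃ x, ∀ j, S.T^[j] x ∈ S.I (ω j) := by
  have := IsCompact.nonempty_iInter_of_sequence_nonempty_isCompact_isClosed
    (fun n => S.Cy ω n ∩ Icc (0:ℝ) 1)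
    (fun n => inter_subset_inter_left _ (S.Cy_mono ω n.le_succ))
    (fun n => S.Cy_nonempty n ω) (isCompact_Icc.inter_left (S.Cy_closed _ ω))
    (fun n => (S.Cy_closed n ω).inter isClosed_Icc)
  obtain ⟨x, hx⟩ := this
  simp only [mem_iInter] at hx
  exact ⟨x, fun j => (hx (j+1)).1 j (by omega)⟩

/-- Birkhoff sum of the geometric potential -/
def BS (n : ℕ) (x : ℝ) : ℝ := ∑ j ∈ Finset.range n, Real.log (S.T' (S.T^[j] x))

lemma BS_succ (n : ℕ) (x : ℝ) : S.BS (n+1) x = S.BS n x + Real.log (S.T' (S.T^[n] x)) :=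
  Finset.sum_range_succ _ _

lemma hasDeriv_iter (ω : ℕ → Fin m) (n : ℕ) : ∀ x ∈ S.Cy ω n,
    HasDerivWithinAt S.T^[n] (Real.exp (S.BS n x)) (S.Cy ω n) x := by
  induction n with
  | zero => 
    intro x _
    simp only [BS, Finset.range_zero, Finset.sum_empty, Real.exp_zero, Function.iterate_zero]
    exact hasDerivWithinAt_id x _
  | succ n ih =>
    intro x hx
    have h1 := (ih x (S.Cy_mono ω n.le_succ hx)).mono (S.Cy_mono ω n.le_succ)
    have h2 := S.hderiv (ω n) (S.T^[n] x) (hx n n.lt_succ_self)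
    have h3 := h2.comp x h1 (fun y hy => hy n n.lt_succ_self)
    rw [Function.iterate_succ']
    have := S.one_le_T' (hx n n.lt_succ_self)
    rw [BS_succ, Real.exp_add, Real.exp_log (by linarith), mul_comm]
    exact h3

lemma lip_iter (ω : ℕ → Fin m) (n : ℕ) {D : ℝ} (hD : ∀ z ∈ S.Cy ω n, S.BS n z ≤ D) {x y : ℝ}
    (hx : x ∈ S.Cy ω n) (hy : y ∈ S.Cy ω n) :
    |S.T^[n] x - S.T^[n] y| ≤ Real.exp D * |x - y| := by
  have := Convex.norm_image_sub_le_of_norm_hasDerivWithin_le (C := Real.exp D)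
    (S.hasDeriv_iter ω n) (fun z hz => by
      rw [Real.norm_eq_abs, Real.abs_exp]; exact Real.exp_le_exp.2 (hD z hz))
    (S.Cy_ordConnected ω n).convex hy hx
  simpa [Real.norm_eq_abs] using this

lemma gap_aux {ι : Type*} [Finite ι] (K : ι → Set ℝ) (hK : ∀ i, IsCompact (K i))
    (hd : ∀ i j, i ≠ j → Disjoint (K i) (K j)) :
    ∃ δ > 0, ∀ i j, i ≠ j → ∀ x ∈ K i, ∀ y ∈ K j, δ ≤ |x - y| := by
  have h : ∀ p : ι × ι, ∃ δ > 0, p.1 ≠ p.2 → ∀ x ∈ K p.1, ∀ y ∈ K p.2, δ ≤ |x - y| := by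
    intro p
    by_cases hp : p.1 = p.2
    · exact ⟨1, one_pos, fun h => absurd hp h⟩
    · obtain ⟨r, hr, h⟩ := Metric.exists_pos_forall_lt_edist (hK p.1) (hK p.2).isClosed (hd _ _ hp)
      refine ⟨r, by exact_mod_cast hr, fun _ x hx y hy => ?_⟩
      have := h x hx y hy
      rw [edist_dist, ENNReal.coe_nnreal_eq] at this
      have := (ENNReal.ofReal_lt_ofReal_iff_of_nonneg r.2).1 this
      rw [Real.dist_eq] at this
      exact this.le
  choose δ hδ h using h
  rcases isEmpty_or_nonempty ι with he | hne
  · exact ⟨1, one_pos, fun i => he.elim i⟩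
  · obtain ⟨p0, hp0⟩ := Finite.exists_min δ
    exact ⟨δ p0, hδ p0, fun i j hij x hx y hy => (hp0 (i, j)).trans (h (i, j) hij x hx y hy)⟩

lemma gap : ∃ δ > 0, ∀ i j, i ≠ j → ∀ x ∈ S.I i, ∀ y ∈ S.I j, δ ≤ |x - y| :=
  gap_aux S.I S.compactI fun _ _ h => S.disjI h

lemma log_cont (i : Fin m) : ContinuousOn (fun x => Real.log (S.T' x)) (S.I i) :=
  (S.hT'cont i).log fun x hx => by have := S.one_le_T' hx; positivity

lemma log_nonneg {i : Fin m} {x : ℝ} (hx : x ∈ S.I i) : 0 ≤ Real.log (S.T' x) :=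
  Real.log_nonneg (S.one_le_T' hx)

lemma log_bdd : ∃ G > 0, ∀ i, ∀ x ∈ S.I i, Real.log (S.T' x) ≤ G := by
  have h : ∀ i, ∃ G, ∀ x ∈ S.I i, Real.log (S.T' x) ≤ G := by
    intro i
    obtain ⟨G, hG⟩ := (S.compactI i).bddAbove_image (S.log_cont i)
    exact ⟨G, fun x hx => hG (mem_image_of_mem _ hx)⟩
  choose G hG using h
  have : Nonempty (Fin m) := ⟨⟨0, S.hm⟩⟩
  obtain ⟨i0, hi0⟩ := Finite.exists_max G
  exact ⟨max 1 (G i0), by positivity, fun i x hx =>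
    (hG i x hx).trans ((hi0 i).trans (le_max_right _ _))⟩

lemma log_unif {η : ℝ} (hη : 0 < η) : ∃ M : ℕ, ∀ ω n, M ≤ n → ∀ x ∈ S.Cy ω n, ∀ y ∈ S.Cy ω n,
    |Real.log (S.T' x) - Real.log (S.T' y)| ≤ η := by
  have h : ∀ i, ∃ δ > 0, ∀ x ∈ S.I i, ∀ y ∈ S.I i, |x - y| < δ →
      |Real.log (S.T' x) - Real.log (S.T' y)| ≤ η := by
    intro i
    have := (S.compactI i).uniformContinuousOn_of_continuous (S.log_cont i)
    rw [Metric.uniformContinuousOn_iff] at this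
    obtain ⟨δ, hδ, h⟩ := this η hη
    exact ⟨δ, hδ, fun x hx y hy hxy => (h x hx y hy hxy).le⟩
  choose δ hδ h using h
  have : Nonempty (Fin m) := ⟨⟨0, S.hm⟩⟩
  obtain ⟨i0, hi0⟩ := Finite.exists_min δ
  obtain ⟨M, hM⟩ := S.diam_small (hδ i0)
  refine ⟨M + 1, fun ω n hn x hx y hy => ?_⟩
  exact h (ω 0) x (hx 0 (by omega)) y (hy 0 (by omega))
    ((hM ω n (by omega) x hx y hy).trans_le (hi0 _))

lemma BS_var {η : ℝ} (hη : 0 < η) : ∃ B ≥ 0, ∀ ω n, ∀ x ∈ S.Cy ω n, ∀ y ∈ S.Cy ω n,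
    S.BS n x ≤ S.BS n y + n * η + B := by
  obtain ⟨M, hM⟩ := S.log_unif hη
  obtain ⟨G, hG, hGb⟩ := S.log_bdd
  refine ⟨M * G, by positivity, ?_⟩
  have key : ∀ n, ∀ ω, ∀ x ∈ S.Cy ω n, ∀ y ∈ S.Cy ω n,
    S.BS n x ≤ S.BS n y + n * η + (min n M : ℕ) * G := by
    intro n
    induction n with
    | zero => intro ω x hx y hy; simp [BS]
    | succ n ih =>
      intro ω x hx y hy
      have hsplit : ∀ x, S.BS (n+1) x = S.BS n (S.T x) + Real.log (S.T' x) := by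
        intro x
        unfold BS
        rw [Finset.sum_range_succ']; rfl
      have h1 := ih (fun j => ω (1 + j)) (S.T x) (S.Cy_iter (n := 1) (by rwa [add_comm]))
        (S.T y) (S.Cy_iter (n := 1) (by rwa [add_comm]))
      rw [hsplit, hsplit]
      by_cases hn : M ≤ n + 1
      · have h2 := (abs_le.1 (hM ω (n+1) hn x hx y hy)).2
        have h3 : ((min n M : ℕ) : ℝ) * G ≤ (min (n+1) M : ℕ) * G := by
          gcongr; omega
        push_cast at *
        linarith
      · have h2 := hGb _ x (hx 0 (by omega))
        have h3 := S.log_nonneg (hy 0 (by omega))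
        simp only [Function.iterate_zero, id] at h3
        have e1 : min n M = n := by omega
        have e2 : min (n+1) M = n+1 := by omega
        rw [e1] at h1
        rw [e2]
        push_cast
        linarith
  intro ω n x hx y hy
  refine (key n ω x hx y hy).trans ?_
  have : ((min n M : ℕ) : ℝ) * G ≤ M * G := by gcongr; omega
  linarith

lemma BS_nonneg {ω : ℕ → Fin m} {n : ℕ} {x : ℝ} (hx : x ∈ S.Cy ω n) : 0 ≤ S.BS n x :=
  Finset.sum_nonneg fun j hj => S.log_nonneg (hx j (Finset.mem_range.1 hj))

end PCSystem

lemma pigeon_log {ι : Type*} [Fintype ι] [Nonempty ι] (f : ι → ℝ) (D s : ℝ) (hD : 0 ≤ D) (hs : 0 ≤ s)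
    (hf0 : ∀ w, 0 ≤ f w) (hfD : ∀ w, f w ≤ D) :
    ∃ L ≥ 0, ∃ W : Finset ι, (∀ w ∈ W, f w ≤ L) ∧
      s * L - s + Real.log (∑ w, Real.exp (-(s * f w))) - Real.log (D + 1) ≤ Real.log W.card := by
  classical
  set Z := ∑ w, Real.exp (-(s * f w)) with hZ
  have hZpos : 0 < Z := Finset.sum_pos (fun w _ => Real.exp_pos _) Finset.univ_nonempty
  set J := ⌊D⌋₊ + 1 with hJ
  set W : ℕ → Finset ι := fun j => Finset.univ.filter (fun w => ⌊f w⌋₊ = j) with hW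
  have h1 : Z = ∑ j ∈ Finset.range J, ∑ w ∈ W j, Real.exp (-(s * f w)) := by
    rw [hZ, Finset.sum_fiberwise_of_maps_to]
    intro w _
    rw [Finset.mem_range, hJ, Nat.lt_succ_iff]
    exact Nat.floor_le_floor (hfD w)
  have h2 : ∀ j, ∑ w ∈ W j, Real.exp (-(s * f w)) ≤ (W j).card * Real.exp (-(s * j)) := by
    intro j
    rw [← nsmul_eq_mul]
    refine Finset.sum_le_card_nsmul _ _ _ fun w hw => ?_
    have hw' : ⌊f w⌋₊ = j := (Finset.mem_filter.1 hw).2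
    have : (j : ℝ) ≤ f w := hw' ▸ Nat.floor_le (hf0 w)
    gcongr
  have h3 : ∃ j ∈ Finset.range J, Z / J ≤ (W j).card * Real.exp (-(s * j)) := by
    refine Finset.exists_le_of_sum_le (by simp [hJ]) ?_
    rw [Finset.sum_const, Finset.card_range, nsmul_eq_mul, mul_div_cancel₀ _ (by positivity), h1]
    exact Finset.sum_le_sum fun j _ => h2 j
  obtain ⟨j, -, hj⟩ := h3
  have hJ' : (J : ℝ) ≤ D + 1 := by
    rw [hJ]; push_cast; linarith [Nat.floor_le hD]
  have hJpos : (0:ℝ) < J := by positivity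
  have hcard : 0 < ((W j).card : ℝ) := by
    have : 0 < ((W j).card : ℝ) * Real.exp (-(s * j)) := lt_of_lt_of_le (by positivity) hj
    exact pos_of_mul_pos_left this (Real.exp_pos _).le
  refine ⟨j + 1, by positivity, W j, fun w hw => ?_, ?_⟩
  · have hw' : ⌊f w⌋₊ = j := (Finset.mem_filter.1 hw).2
    rw [← hw']
    exact (Nat.lt_floor_add_one _).le
  · have := Real.log_le_log (by positivity) hj
    rw [Real.log_div hZpos.ne' hJpos.ne', Real.log_mul hcard.ne' (Real.exp_pos _).ne',
      Real.log_exp] at this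
    have h4 := Real.log_le_log hJpos hJ'
    linarith

lemma negMulLog_sum_le {ι : Type*} (t : Finset ι) (a : ι → ℝ) (ha : ∀ i, 0 ≤ a i) :
    Real.negMulLog (∑ i ∈ t, a i) ≤ ∑ i ∈ t, Real.negMulLog (a i) := by
  have hneg : Real.negMulLog (∑ i ∈ t, a i) = ∑ i ∈ t, a i * (- Real.log (∑ i ∈ t, a i)) := by
    rw [← Finset.sum_mul, Real.negMulLog]; ring
  rw [hneg]
  refine Finset.sum_le_sum fun i hi => ?_
  rcases (ha i).eq_or_lt with h | h
  · rw [← h]; simp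
  · have := Real.log_le_log h (Finset.single_le_sum (fun j _ => ha j) hi)
    rw [Real.negMulLog]
    nlinarith

lemma gibbs_int {Q : Type*} [Fintype Q] (ν : Measure ℝ) [IsProbabilityMeasure ν] (B : Q → Set ℝ)
    (hB : ∀ q, MeasurableSet (B q)) (hd : Pairwise (Function.onFun Disjoint B))
    (hcov : ∀ᵐ x ∂ν, ∃ q, x ∈ B q) (θ : Q → ℝ) (hθ : ∀ q, 0 < θ q) (hθs : ∑ q, θ q ≤ 1)
    (H : ℝ → ℝ) (hH : Integrable H ν) (hHθ : ∀ q, ∀ x ∈ B q, - Real.log (θ q) ≤ H x) :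
    ∑ q, Real.negMulLog (ν.real (B q)) ≤ ∫ x, H x ∂ν := by
  have hfull : ν (⋃ q, B q)ᶜ = 0 := by
    rw [← mem_ae_iff]
    filter_upwards [hcov] with x hx
    exact mem_iUnion.2 hx
  have hres : ν.restrict (⋃ q, B q) = ν := Measure.restrict_eq_self_of_ae_mem (by
    filter_upwards [hcov] with x hx
    exact mem_iUnion.2 hx)
  have h1 : ∑ q, ν.real (B q) = 1 := by
    rw [← measureReal_iUnion_fintype hd hB]
    have : ν (⋃ q, B q) = 1 := by
      rw [← prob_compl_eq_zero_iff (MeasurableSet.iUnion hB)]; exact hfull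
    simp [measureReal_def, this]
  have h2 : ∫ x, H x ∂ν = ∑ q, ∫ x in B q, H x ∂ν := by
    conv_lhs => rw [← hres]
    exact integral_iUnion_fintype hB hd (fun q => hH.integrableOn)
  have h3 : ∀ q, ν.real (B q) * (- Real.log (θ q)) ≤ ∫ x in B q, H x ∂ν := by
    intro q
    have : ∫ x in B q, (- Real.log (θ q)) ∂ν ≤ ∫ x in B q, H x ∂ν :=
      setIntegral_mono_on (integrable_const _).integrableOn hH.integrableOn (hB q) (hHθ q)
    rwa [setIntegral_const, smul_eq_mul] at this
  have h4 : ∀ q, Real.negMulLog (ν.real (B q)) ≤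
      ν.real (B q) * (- Real.log (θ q)) + (θ q - ν.real (B q)) := by
    intro q
    set a := ν.real (B q)
    have ha : 0 ≤ a := measureReal_nonneg
    rcases ha.eq_or_lt with h | h
    · rw [← h]; simp [(hθ q).le]
    · have h5 := Real.log_le_sub_one_of_pos (div_pos (hθ q) h)
      rw [Real.log_div (hθ q).ne' h.ne'] at h5
      have h6 : a * (Real.log (θ q) - Real.log a) ≤ a * (θ q / a - 1) :=
        mul_le_mul_of_nonneg_left h5 ha
      have h7 : a * (θ q / a - 1) = θ q - a := by field_simp
      rw [Real.negMulLog]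
      linarith
  calc _ ≤ ∑ q, (ν.real (B q) * (- Real.log (θ q)) + (θ q - ν.real (B q))) :=
        Finset.sum_le_sum fun q _ => h4 q
    _ = ∑ q, ν.real (B q) * (- Real.log (θ q)) + (∑ q, θ q - ∑ q, ν.real (B q)) := by
        rw [Finset.sum_add_distrib, Finset.sum_sub_distrib]
    _ ≤ ∑ q, ∫ x in B q, H x ∂ν := by
        have := Finset.sum_le_sum (fun q (_ : q ∈ Finset.univ) => h3 q)
        linarith
    _ = _ := h2.symm

namespace PCSystem
variable {m : ℕ} (S : PCSystem m)

/-- cylinder of a finite word -/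
def A {n : ℕ} (w : Fin n → Fin m) : Set ℝ := {x | ∀ j : Fin n, S.T^[j] x ∈ S.I (w j)}

lemma mem_A_iff {n : ℕ} (ω : ℕ → Fin m) (x : ℝ) :
    x ∈ S.A (fun j : Fin n => ω j) ↔ x ∈ S.Cy ω n :=
  ⟨fun h j hj => h ⟨j, hj⟩, fun h j => h j j.2⟩

lemma A_eq_Cy {n : ℕ} (w : Fin n → Fin m) : ∃ ω : ℕ → Fin m, S.A w = S.Cy ω n := by
  refine ⟨fun j => if h : j < n then w ⟨j, h⟩ else ⟨0, S.hm⟩, ?_⟩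
  ext x
  rw [← mem_A_iff]
  simp [A]

lemma iter_meas (j : ℕ) : Measurable (S.T^[j]) := S.hTmeas.iterate j

lemma A_meas {n : ℕ} (w : Fin n → Fin m) : MeasurableSet (S.A w) := by
  have : S.A w = ⋂ j : Fin n, S.T^[j] ⁻¹' (S.I (w j)) := by ext; simp [A]
  rw [this]
  exact MeasurableSet.iInter fun j => S.iter_meas j (S.closedI _).measurableSet

lemma A_disj {n : ℕ} {w w' : Fin n → Fin m} (h : w ≠ w') : Disjoint (S.A w) (S.A w') := by
  obtain ⟨j, hj⟩ := Function.ne_iff.1 h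
  rw [Set.disjoint_left]
  intro x hx hx'
  exact Set.disjoint_left.1 (S.disjI hj) (hx j) (hx' j)

lemma A_nonempty {n : ℕ} (w : Fin n → Fin m) : (S.A w).Nonempty := by
  obtain ⟨ω, h⟩ := S.A_eq_Cy w
  rw [h]
  exact (S.Cy_nonempty n ω).mono inter_subset_left

/-- sup of the Birkhoff sum on a cylinder -/
def LL {n : ℕ} (w : Fin n → Fin m) : ℝ := sSup (S.BS n '' S.A w)

lemma BS_le {G : ℝ} (hG : ∀ i, ∀ x ∈ S.I i, Real.log (S.T' x) ≤ G) {ω : ℕ → Fin m} {n : ℕ} {x : ℝ}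
    (hx : x ∈ S.Cy ω n) : S.BS n x ≤ n * G := by
  have := Finset.sum_le_card_nsmul (Finset.range n) (fun j => Real.log (S.T' (S.T^[j] x))) G
    (fun j hj => hG _ _ (hx j (Finset.mem_range.1 hj)))
  simpa [BS] using this

lemma le_LL {n : ℕ} {w : Fin n → Fin m} {x : ℝ} (hx : x ∈ S.A w) : S.BS n x ≤ S.LL w := by
  obtain ⟨G, -, hG⟩ := S.log_bdd
  obtain ⟨ω, h⟩ := S.A_eq_Cy w
  refine le_csSup ⟨n * G, ?_⟩ (mem_image_of_mem _ hx)
  rintro _ ⟨y, hy, rfl⟩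
  exact S.BS_le hG (h ▸ hy)

lemma LL_le {n : ℕ} {w : Fin n → Fin m} {D : ℝ} (h : ∀ x ∈ S.A w, S.BS n x ≤ D) : S.LL w ≤ D := by
  refine csSup_le ((S.A_nonempty w).image _) ?_
  rintro _ ⟨y, hy, rfl⟩
  exact h y hy

lemma LL_nonneg {n : ℕ} (w : Fin n → Fin m) : 0 ≤ S.LL w := by
  obtain ⟨x, hx⟩ := S.A_nonempty w
  obtain ⟨ω, h⟩ := S.A_eq_Cy w
  exact (S.BS_nonneg (h ▸ hx)).trans (S.le_LL hx)

section measure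
variable {S} {ν : Measure ℝ}

lemma inv_mp (hν : ν ∈ S.invMeasures) : MeasurePreserving S.T ν ν := ⟨S.hTmeas, hν.2.1⟩

lemma inv_ae (hν : ν ∈ S.invMeasures) : ∀ᵐ x ∂ν, ∀ j : ℕ, ∃ i, S.T^[j] x ∈ S.I i := by
  have h0 : ∀ᵐ x ∂ν, ∃ i, x ∈ S.I i := by
    have : ∀ᵐ x ∂ν, x ∈ S.attractor := hν.2.2
    filter_upwards [this] with x hx
    exact mem_iUnion.1 hx.1
  rw [ae_all_iff]
  intro j
  exact ((inv_mp hν).iterate j).quasiMeasurePreserving.ae h0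

lemma inv_cover (hν : ν ∈ S.invMeasures) (n : ℕ) : ∀ᵐ x ∂ν, ∃ w : Fin n → Fin m, x ∈ S.A w := by
  filter_upwards [inv_ae hν] with x hx
  choose f hf using hx
  exact ⟨fun j => f j, fun j => hf j⟩

lemma log_int (hν : ν ∈ S.invMeasures) : Integrable (fun x => Real.log (S.T' x)) ν := by
  have : IsProbabilityMeasure ν := hν.1
  obtain ⟨G, hG, hGb⟩ := S.log_bdd
  refine Integrable.of_bound (C := G) (Real.measurable_log.comp S.hT'meas).aestronglyMeasurable ?_
  filter_upwards [inv_ae hν] with x hx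
  obtain ⟨i, hi⟩ := hx 0
  change x ∈ S.I i at hi
  rw [Real.norm_eq_abs, abs_of_nonneg (S.log_nonneg hi)]
  exact hGb i x hi

lemma BS_int (hν : ν ∈ S.invMeasures) (n : ℕ) : Integrable (S.BS n) ν ∧ ∫ x, S.BS n x ∂ν = n * S.lyap ν := by
  have hi : ∀ j, Integrable (fun x => Real.log (S.T' (S.T^[j] x))) ν := fun j =>
    ((inv_mp hν).iterate j).integrable_comp_of_integrable (log_int hν)
  refine ⟨integrable_finsetSum _ fun j _ => hi j, ?_⟩
  unfold BS
  rw [integral_finsetSum _ fun j _ => hi j]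
  have : ∀ j ∈ Finset.range n, ∫ x, Real.log (S.T' (S.T^[j] x)) ∂ν = S.lyap ν := by
    intro j _
    have h1 := ((inv_mp hν).iterate j).map_eq
    unfold lyap
    simp_rw [Real.log_abs]
    conv_rhs => rw [← h1]
    exact (integral_map (f := fun x => Real.log (S.T' x)) (S.iter_meas j).aemeasurable
      (Real.measurable_log.comp S.hT'meas).aestronglyMeasurable).symm
  rw [Finset.sum_congr rfl this]
  simp
end measure

end PCSystem

lemma sum_prod_le {n : ℕ} {P : Type*} [Fintype P] [DecidableEq P] (f : Fin n → P → ℝ) {V : ℝ}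
    (h0 : ∀ i p, 0 ≤ f i p) (h : ∀ i, ∑ p, f i p ≤ V) :
    ∑ c : Fin n → P, ∏ i, f i (c i) ≤ V ^ n := by
  have := Finset.prod_univ_sum (fun _ : Fin n => (Finset.univ : Finset P)) f
  rw [Fintype.piFinset_univ] at this
  rw [← this]
  calc _ ≤ ∏ _i : Fin n, V := Finset.prod_le_prod
        (fun i _ => Finset.sum_nonneg fun p _ => h0 i p) (fun i _ => h i)
    _ = V ^ n := by simp

namespace PCSystem
variable {m : ℕ} (S : PCSystem m)

/-- subword -/
def subw {n k : ℕ} (w : Fin (n + k) → Fin m) (i : Fin n) : Fin k → Fin m :=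
  fun j => w ⟨i + j, by omega⟩

lemma mem_subw {n k : ℕ} {w : Fin (n + k) → Fin m} (i : Fin n) {x : ℝ} (hx : x ∈ S.A w) :
    S.T^[i] x ∈ S.A (subw w i) := by
  intro j
  rw [← Function.iterate_add_apply, add_comm]
  exact hx ⟨i + j, by omega⟩

set_option maxHeartbeats 1000000 in
lemma entropy_ineq {ν : Measure ℝ} (hν : ν ∈ S.invMeasures) {P : Finset (Set ℝ)}
    (hP : IsMeasPartition P) {s η B β : ℝ} (hs : 0 ≤ s)
    (hB : ∀ ω n, ∀ x ∈ S.Cy ω n, ∀ y ∈ S.Cy ω n, S.BS n x ≤ S.BS n y + n * η + B)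
    (hβ : 0 < β) (hβ1 : β < 1) {k : ℕ} (φ : (Fin k → Fin m) → {p // p ∈ P})
    (Bad : Set ℝ) (hBad : MeasurableSet Bad)
    (hφ : ∀ v, ∀ x ∈ S.A v, ∀ p : {p // p ∈ P}, x ∈ (p : Set ℝ) → p ≠ φ v → x ∈ Bad) (n : ℕ) :
    partEntropy S.T ν P n ≤ Real.log (∑ w : Fin (n + k) → Fin m, Real.exp (-(s * S.LL w))) +
      s * ((n + k : ℕ) * S.lyap ν + (n + k : ℕ) * η + B) + n * Real.log (1 + P.card * β) +
      n * (Real.log (1 / β) * ν.real Bad) := by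
  classical
  have : IsProbabilityMeasure ν := hν.1
  have : Nonempty (Fin m) := ⟨⟨0, S.hm⟩⟩
  set Z := ∑ w : Fin (n + k) → Fin m, Real.exp (-(s * S.LL w)) with hZ
  have hZpos : 0 < Z := Finset.sum_pos (fun w _ => Real.exp_pos _) Finset.univ_nonempty
  set V : ℝ := 1 + P.card * β with hV
  have hVpos : 0 < V := by positivity
  let C : (Fin n → {p // p ∈ P}) → Set ℝ := fun c => ⋂ i : Fin n, S.T^[(i : ℕ)] ⁻¹' ((c i : Set ℝ))
  let Q := (Fin n → {p // p ∈ P}) × (Fin (n + k) → Fin m)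
  let E : Q → Set ℝ := fun q => C q.1 ∩ S.A q.2
  have hCmeas : ∀ c, MeasurableSet (C c) := fun c =>
    MeasurableSet.iInter fun i => S.iter_meas i (hP.1 _ (c i).2)
  have hEmeas : ∀ q, MeasurableSet (E q) := fun q => (hCmeas _).inter (S.A_meas _)
  have hdP : ∀ p p' : {p // p ∈ P}, p ≠ p' → Disjoint (p : Set ℝ) (p' : Set ℝ) := by
    intro p p' h
    exact hP.2.1 p.2 p'.2 (fun h' => h (Subtype.ext h'))
  have hCd : ∀ c c', c ≠ c' → Disjoint (C c) (C c') := by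
    intro c c' h
    obtain ⟨j, hj⟩ := Function.ne_iff.1 h
    rw [Set.disjoint_left]
    intro x hx hx'
    exact Set.disjoint_left.1 (hdP _ _ hj) (mem_iInter.1 hx j) (mem_iInter.1 hx' j)
  have hEd : Pairwise (Function.onFun Disjoint E) := by
    rintro ⟨c, w⟩ ⟨c', w'⟩ h
    by_cases hc : c = c'
    · have hw : w ≠ w' := fun hw => h (by rw [hc, hw])
      exact (S.A_disj hw).mono inter_subset_right inter_subset_right
    · exact (hCd _ _ hc).mono inter_subset_left inter_subset_left
  have hcov : ∀ᵐ x ∂ν, ∃ q, x ∈ E q := by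
    filter_upwards [inv_cover hν (n + k)] with x ⟨w, hw⟩
    have : ∀ y : ℝ, ∃ p : {p // p ∈ P}, y ∈ (p : Set ℝ) := by
      intro y
      have : y ∈ ⋃ s ∈ P, s := by rw [hP.2.2]; trivial
      simp only [mem_iUnion] at this
      obtain ⟨p, hp, hy⟩ := this
      exact ⟨⟨p, hp⟩, hy⟩
    choose f hf using this
    exact ⟨⟨fun i => f (S.T^[i] x), w⟩, mem_iInter.2 fun i => hf _, hw⟩
  have hstep1 : partEntropy S.T ν P n ≤ ∑ q : Q, Real.negMulLog (ν.real (E q)) := by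
    rw [Fintype.sum_prod_type]
    refine Finset.sum_le_sum fun c _ => ?_
    have h1 : (ν (C c)).toReal = ∑ w, ν.real (E (c, w)) := by
      have hd : Pairwise (Function.onFun Disjoint fun w => E (c, w)) := fun w w' h =>
        (S.A_disj h).mono inter_subset_right inter_subset_right
      rw [← measureReal_iUnion_fintype hd (fun w => hEmeas _)]
      change ν.real (C c) = _
      refine measureReal_congr ?_
      filter_upwards [inv_cover hν (n + k)] with x ⟨w, hw⟩
      refine propext ⟨fun h => mem_iUnion.2 ⟨w, h, hw⟩, fun h => ?_⟩
      obtain ⟨w', h'⟩ := mem_iUnion.1 h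
      exact h'.1
    change Real.negMulLog (ν (C c)).toReal ≤ _
    rw [h1]
    exact negMulLog_sum_le _ _ fun _ => measureReal_nonneg
  let κ : {p // p ∈ P} → {p // p ∈ P} → ℝ := fun p p' => if p = p' then 1 else β
  have hκpos : ∀ p p', 0 < κ p p' := by
    intro p p'; simp only [κ]; split_ifs <;> linarith
  have hκs : ∀ p', ∑ p, κ p p' ≤ V := by
    intro p'
    calc ∑ p, κ p p' ≤ ∑ p, ((if p = p' then 1 else 0) + β) := by
          refine Finset.sum_le_sum fun p _ => ?_
          simp only [κ]; split_ifs <;> linarith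
      _ = V := by
          rw [Finset.sum_add_distrib, Finset.sum_ite_eq' ]
          simp [hV]
  let θ : Q → ℝ := fun q => Real.exp (-(s * S.LL q.2)) / Z *
    ((∏ i, κ (q.1 i) (φ (subw q.2 i))) / V ^ n)
  have hprodpos : ∀ q : Q, 0 < ∏ i, κ (q.1 i) (φ (subw q.2 i)) := fun q =>
    Finset.prod_pos fun i _ => hκpos _ _
  have hθpos : ∀ q, 0 < θ q := fun q => by
    have := hprodpos q
    simp only [θ]
    positivity
  have hθs : ∑ q, θ q ≤ 1 := by
    rw [Fintype.sum_prod_type_right]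
    have h1 : ∀ w : Fin (n + k) → Fin m, ∑ c : Fin n → {p // p ∈ P}, θ (c, w) ≤
        Real.exp (-(s * S.LL w)) / Z := by
      intro w
      simp only [θ]
      rw [← Finset.mul_sum, ← Finset.sum_div]
      have h2 : ∑ c : Fin n → {p // p ∈ P}, ∏ i, κ (c i) (φ (subw w i)) ≤ V ^ n := by
        exact sum_prod_le (fun i p => κ p (φ (subw w i))) (fun i p => (hκpos _ _).le) (fun i => hκs _)
      have h3 : (∑ c : Fin n → {p // p ∈ P}, ∏ i, κ (c i) (φ (subw w i))) / V ^ n ≤ 1 :=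
        (div_le_one (by positivity)).2 h2
      exact mul_le_of_le_one_right (by positivity) h3
    refine (Finset.sum_le_sum fun w _ => h1 w).trans ?_
    rw [← Finset.sum_div, ← hZ, div_self hZpos.ne']
  let H : ℝ → ℝ := fun x => Real.log Z + s * (S.BS (n + k) x + ((n + k : ℕ) * η + B)) +
    n * Real.log V + Real.log (1 / β) * ∑ i : Fin n, Bad.indicator (fun _ => (1:ℝ)) (S.T^[(i:ℕ)] x)
  have hlogβ : 0 ≤ Real.log (1 / β) := Real.log_nonneg (by rw [le_div_iff₀ hβ]; linarith)
  have hHθ : ∀ q, ∀ x ∈ E q, - Real.log (θ q) ≤ H x := by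
    rintro ⟨c, w⟩ x ⟨hxC, hxA⟩
    have e1 : - Real.log (θ (c, w)) = Real.log Z + s * S.LL w + n * Real.log V +
        ∑ i, (- Real.log (κ (c i) (φ (subw w i)))) := by
      simp only [θ]
      have hp := hprodpos (c, w)
      simp only at hp
      rw [Real.log_mul (by positivity) (by positivity), Real.log_div (by positivity) hZpos.ne',
        Real.log_div hp.ne' (by positivity), Real.log_exp, Real.log_pow, Real.log_prod
          (fun i _ => (hκpos _ _).ne'), Finset.sum_neg_distrib]
      ring
    have e2 : S.LL w ≤ S.BS (n + k) x + ((n + k : ℕ) * η + B) := by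
      obtain ⟨ω, hω⟩ := S.A_eq_Cy w
      refine S.LL_le fun y hy => ?_
      have := hB ω (n + k) y (hω ▸ hy) x (hω ▸ hxA)
      linarith
    have e3 : ∑ i, (- Real.log (κ (c i) (φ (subw w i)))) ≤
        Real.log (1 / β) * ∑ i : Fin n, Bad.indicator (fun _ => (1:ℝ)) (S.T^[(i:ℕ)] x) := by
      rw [Finset.mul_sum]
      refine Finset.sum_le_sum fun i _ => ?_
      by_cases hc : c i = φ (subw w i)
      · simp only [κ, hc, if_true, Real.log_one, neg_zero]
        exact mul_nonneg hlogβ (indicator_nonneg (fun _ _ => zero_le_one) _)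
      · have : S.T^[(i:ℕ)] x ∈ Bad :=
          hφ _ _ (S.mem_subw i hxA) (c i) (mem_iInter.1 hxC i) hc
        rw [indicator_of_mem this]
        simp [κ, hc]
    have e4 := mul_le_mul_of_nonneg_left e2 hs
    rw [e1]
    simp only [H]
    linarith
  have hBi : ∀ i : ℕ, Integrable (fun x => Bad.indicator (fun _ => (1:ℝ)) (S.T^[i] x)) ν ∧
      ∫ x, Bad.indicator (fun _ => (1:ℝ)) (S.T^[i] x) ∂ν = ν.real Bad := by
    intro i
    have hBadInt : Integrable (Bad.indicator (fun _ => (1:ℝ))) ν :=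
      (integrable_const _).indicator hBad
    refine ⟨((inv_mp hν).iterate i).integrable_comp_of_integrable hBadInt, ?_⟩
    have h1 := ((inv_mp hν).iterate i).map_eq
    have h2 := integral_map (μ := ν) (f := Bad.indicator (fun _ => (1:ℝ)))
      (S.iter_meas i).aemeasurable (by rw [h1]; exact hBadInt.aestronglyMeasurable)
    rw [h1] at h2
    rw [← h2, integral_indicator hBad]
    simp
  have hBSi := BS_int hν (n + k)
  set K : ℝ := Real.log Z + s * ((n + k : ℕ) * η + B) + n * Real.log V with hK
  have i1 : Integrable (fun x => s * S.BS (n + k) x) ν := hBSi.1.const_mul s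
  have i2 : Integrable (fun x => Real.log (1 / β) *
      ∑ i : Fin n, Bad.indicator (fun _ => (1:ℝ)) (S.T^[(i:ℕ)] x)) ν :=
    (integrable_finsetSum _ fun (i : Fin n) _ => (hBi i).1).const_mul _
  have i0 : Integrable (fun _ : ℝ => K) ν := integrable_const _
  have i3 : Integrable (fun x => K + s * S.BS (n + k) x) ν := i0.add i1
  have hHeq : H = fun x => (K + s * S.BS (n + k) x) + Real.log (1 / β) *
      ∑ i : Fin n, Bad.indicator (fun _ => (1:ℝ)) (S.T^[(i:ℕ)] x) := by
    funext x
    simp only [H, hK]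
    ring
  have hHint : Integrable H ν := by rw [hHeq]; exact i3.add i2
  have hHval : ∫ x, H x ∂ν = Real.log Z +
      s * ((n + k : ℕ) * S.lyap ν + (n + k : ℕ) * η + B) + n * Real.log V +
      n * (Real.log (1 / β) * ν.real Bad) := by
    rw [hHeq]
    rw [integral_add i3 i2, integral_add i0 i1,
      integral_const_mul, integral_const_mul, hBSi.2,
      integral_finsetSum _ fun (i : Fin n) _ => (hBi i).1,
      Finset.sum_congr rfl fun (i : Fin n) _ => (hBi i).2]
    simp [hK]
    ring
  rw [← hHval]
  exact hstep1.trans (gibbs_int ν E hEmeas hEd hcov θ hθpos hθs H hHint hHθ)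

end PCSystem

namespace PCSystem
variable {m : ℕ} (S : PCSystem m)

lemma exists_phi {ν : Measure ℝ} [IsProbabilityMeasure ν] {P : Finset (Set ℝ)}
    (hP : IsMeasPartition P) {ε : ℝ} (hε : 0 < ε) :
    ∃ k : ℕ, ∃ φ : (Fin k → Fin m) → {p // p ∈ P}, ∃ Bad : Set ℝ, MeasurableSet Bad ∧
      (∀ v, ∀ x ∈ S.A v, ∀ p : {p // p ∈ P}, x ∈ (p : Set ℝ) → p ≠ φ v → x ∈ Bad) ∧
      ν.real Bad ≤ ε := by
  classical
  have hne : Nonempty {p // p ∈ P} := by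
    have : (0:ℝ) ∈ ⋃ s ∈ P, s := by rw [hP.2.2]; trivial
    simp only [mem_iUnion] at this
    obtain ⟨p, hp, hy⟩ := this
    exact ⟨⟨p, hp⟩⟩
  set e : ℝ := ε / (P.card + 1) with he
  have hepos : 0 < e := by positivity
  have h : ∀ p : {p // p ∈ P}, ∃ K ⊆ (p : Set ℝ), IsCompact K ∧ ν ((p : Set ℝ) \ K) <
      ENNReal.ofReal e := fun p =>
    (hP.1 p p.2).exists_isCompact_sdiff_lt (measure_ne_top ν _) (by simpa using hepos)
  choose K hKp hK hKν using h
  obtain ⟨δ, hδ, hgap⟩ := gap_aux K hK (fun p p' hpp => (hP.2.1 p.2 p'.2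
    (fun h' => hpp (Subtype.ext h'))).mono (hKp p) (hKp p'))
  obtain ⟨k, hk⟩ := S.diam_small hδ
  let φ : (Fin k → Fin m) → {p // p ∈ P} := fun v =>
    if h : ∃ p, (S.A v ∩ K p).Nonempty then h.choose else hne.some
  have hφ : ∀ v p, (S.A v ∩ K p).Nonempty → p = φ v := by
    intro v p hp
    have hex : ∃ p, (S.A v ∩ K p).Nonempty := ⟨p, hp⟩
    have h1 : φ v = hex.choose := dif_pos hex
    obtain ⟨y, hyA, hyK⟩ := hex.choose_spec
    obtain ⟨x, hxA, hxK⟩ := hp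
    rw [h1]
    by_contra hpn
    obtain ⟨ω, hω⟩ := S.A_eq_Cy v
    have h2 := hgap _ _ hpn x hxK y hyK
    have h3 := hk ω k le_rfl x (hω ▸ hxA) y (hω ▸ hyA)
    linarith
  refine ⟨k, φ, ⋃ p : {p // p ∈ P}, ((p : Set ℝ) \ K p), ?_, ?_, ?_⟩
  · exact MeasurableSet.iUnion fun p => (hP.1 p p.2).diff (hK p).measurableSet
  · intro v x hx p hxp hpφ
    exact mem_iUnion.2 ⟨p, hxp, fun hxK => hpφ (hφ v p ⟨x, hx, hxK⟩)⟩
  · have h1 : ν.real (⋃ p : {p // p ∈ P}, ((p : Set ℝ) \ K p)) ≤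
        ∑ p : {p // p ∈ P}, ν.real ((p : Set ℝ) \ K p) := measureReal_iUnion_fintype_le _
    have h2 : ∀ p : {p // p ∈ P}, ν.real ((p : Set ℝ) \ K p) ≤ e := fun p =>
      ENNReal.toReal_le_of_le_ofReal hepos.le (hKν p).le
    have h3 := Finset.sum_le_sum (fun p (_ : p ∈ Finset.univ) => h2 p)
    rw [Finset.sum_const, nsmul_eq_mul, Finset.card_univ, Fintype.card_coe] at h3
    refine h1.trans (h3.trans ?_)
    rw [he, mul_div_assoc', div_le_iff₀ (by positivity)]
    nlinarith

lemma exists_words {ν : Measure ℝ} (hν : ν ∈ S.invMeasures) {s : ℝ} (hs : 0 ≤ s)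
    (hl : 0 < S.lyap ν) (hh : s < metricEntropy S.T ν / S.lyap ν) :
    ∃ n ≥ 1, ∃ L ≥ (0:ℝ), ∃ W : Finset (Fin n → Fin m),
      (∀ w ∈ W, ∀ x ∈ S.A w, S.BS n x ≤ L) ∧ s * L + 1 ≤ Real.log W.card := by
  have : IsProbabilityMeasure ν := hν.1
  have : Nonempty (Fin m) := ⟨⟨0, S.hm⟩⟩
  rw [lt_div_iff₀ hl] at hh
  have hneP : Nonempty {P : Finset (Set ℝ) // IsMeasPartition P} :=
    ⟨⟨{univ}, by simp [IsMeasPartition]⟩⟩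
  obtain ⟨⟨P, hP⟩, hPc⟩ := exists_lt_of_lt_ciSup hh
  simp only at hPc
  set c := ⨅ n : ℕ, partEntropy S.T ν P (n + 1) / (n + 1) with hc
  have hcn : ∀ n : ℕ, (n + 1 : ℕ) * c ≤ partEntropy S.T ν P (n + 1) := by
    intro n
    have : c ≤ partEntropy S.T ν P (n + 1) / (n + 1) := by
      refine ciInf_le ⟨0, ?_⟩ n
      rintro _ ⟨k, rfl⟩
      refine div_nonneg (Finset.sum_nonneg fun c _ => ?_) (by positivity)
      exact Real.negMulLog_nonneg ENNReal.toReal_nonneg measureReal_le_one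
    rw [le_div_iff₀ (by positivity)] at this
    push_cast
    linarith
  set lam := S.lyap ν
  set δ := c - s * lam with hδ
  have hδpos : 0 < δ := by linarith
  obtain ⟨G, hG, hGb⟩ := S.log_bdd
  set η := δ / (8 * (s + 1)) with hη
  have hηpos : 0 < η := by positivity
  have hsη : s * η ≤ δ / 8 := by
    rw [hη, mul_div_assoc', div_le_div_iff₀ (by positivity) (by positivity)]
    nlinarith
  obtain ⟨B, hB0, hB⟩ := S.BS_var hηpos
  set β := min (1 / 2) (δ / (8 * (P.card + 1))) with hβ
  have hβpos : 0 < β := by positivity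
  have hβ1 : β < 1 := (min_le_left _ _).trans_lt (by norm_num)
  have hPβ : Real.log (1 + P.card * β) ≤ δ / 8 := by
    have h1 := Real.log_le_sub_one_of_pos (show 0 < 1 + P.card * β by positivity)
    have h2 : (P.card : ℝ) * β ≤ P.card * (δ / (8 * (P.card + 1))) := by
      gcongr; exact min_le_right _ _
    have h3 : (P.card : ℝ) * (δ / (8 * (P.card + 1))) ≤ δ / 8 := by
      rw [mul_div_assoc', div_le_div_iff₀ (by positivity) (by positivity)]
      nlinarith
    linarith
  have hlogβ : 0 ≤ Real.log (1 / β) := Real.log_nonneg (by rw [le_div_iff₀ hβpos]; linarith)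
  set ε := δ / (8 * (Real.log (1 / β) + 1)) with hε
  have hεpos : 0 < ε := by positivity
  have hβε : Real.log (1 / β) * ε ≤ δ / 8 := by
    rw [hε, mul_div_assoc', div_le_div_iff₀ (by positivity) (by positivity)]
    nlinarith
  obtain ⟨k, φ, Bad, hBad, hφ, hBadε⟩ := S.exists_phi (ν := ν) hP hεpos
  have hkey := S.entropy_ineq hν hP hs hB hβpos hβ1 φ Bad hBad hφ
  set δ' := δ / (8 * G) with hδ'
  have hδ'pos : 0 < δ' := by positivity
  obtain ⟨n, hn⟩ := exists_nat_gt ((s * (k * (lam + η)) + s * B + s + δ * k / 8 + δ' -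
    Real.log δ' - 1 + 1) / (δ / 2))
  rw [div_lt_iff₀ (by positivity)] at hn
  have e1 := hcn n
  have e2 := hkey (n + 1)
  have hD : (0:ℝ) ≤ ((n + 1 + k : ℕ) : ℝ) * G := by positivity
  obtain ⟨L, hL, W, hW, hWc⟩ := pigeon_log (fun w : Fin (n + 1 + k) → Fin m => S.LL w)
    (((n + 1 + k : ℕ) : ℝ) * G) s hD hs (fun w => S.LL_nonneg w) (fun w => S.LL_le fun x hx => by
      obtain ⟨ω, hω⟩ := S.A_eq_Cy w
      exact S.BS_le hGb (hω ▸ hx))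
  refine ⟨n + 1 + k, by omega, L, hL, W, fun w hw x hx => (S.le_LL hx).trans (hW w hw), ?_⟩
  refine le_trans ?_ hWc
  set Z := Real.log (∑ w : Fin (n + 1 + k) → Fin m, Real.exp (-(s * S.LL w)))
  have e3 : Real.log (((n + 1 + k : ℕ) : ℝ) * G + 1) ≤
      δ * (n + 1 + k : ℕ) / 8 + δ' - 1 - Real.log δ' := by
    have hpos : 0 < ((n + 1 + k : ℕ) : ℝ) * G + 1 := by positivity
    have h1 := Real.log_le_sub_one_of_pos (mul_pos hδ'pos hpos)
    rw [Real.log_mul hδ'pos.ne' hpos.ne'] at h1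
    have h2 : δ' * (((n + 1 + k : ℕ) : ℝ) * G + 1) = δ * (n + 1 + k : ℕ) / 8 + δ' := by
      rw [hδ']; field_simp
    linarith
  have e4 : Real.log (1 / β) * ν.real Bad ≤ δ / 8 :=
    (mul_le_mul_of_nonneg_left hBadε hlogβ).trans hβε
  push_cast at e1 e2 e3 ⊢
  have hn0 : (0:ℝ) ≤ n := by positivity
  have e5 := mul_le_mul_of_nonneg_left e4 (show (0:ℝ) ≤ n + 1 by positivity)
  have e6 := mul_le_mul_of_nonneg_left hPβ (show (0:ℝ) ≤ n + 1 by positivity)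
  have e7 := mul_le_mul_of_nonneg_left hsη (show (0:ℝ) ≤ n + 1 by positivity)
  have e8 : ((n:ℝ) + 1) * c = (n + 1) * δ + (n + 1) * (s * lam) := by rw [hδ]; ring
  rw [e8] at e1
  nlinarith

end PCSystem

lemma greedy_choice {E : Type*} [NormedAddCommGroup E] [InnerProductSpace ℝ E] {Y : Set E} {α : E}
    (hα : α ∈ convexHull ℝ Y) (v : E) : ∃ y ∈ Y, inner ℝ v (y - α) ≤ 0 := by
  by_contra hcon
  push Not at hcon
  have hsub : Y ⊆ {y | inner ℝ v α < inner ℝ v y} := by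
    intro y hy
    have := hcon y hy
    rw [inner_sub_right] at this
    change inner ℝ v α < inner ℝ v y
    linarith
  have hlin : IsLinearMap ℝ (fun y : E => inner ℝ v y) :=
    ⟨fun x y => inner_add_right _ _ _, fun c x => by simp [inner_smul_right]⟩
  have : inner ℝ v α < inner ℝ v α := convexHull_min hsub (convex_halfSpace_gt hlin _) hα
  exact lt_irrefl _ this

lemma greedy {E : Type*} [NormedAddCommGroup E] [InnerProductSpace ℝ E] {ι : Type*} (p : ι → Prop)
    (y : ι → E) {α : E} (hα : α ∈ convexHull ℝ {z | ∃ i, p i ∧ z = y i}) {D : ℝ}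
    (hD : ∀ i, ‖y i - α‖ ≤ D) :
    ∃ l : ℕ → ι, (∀ k, p (l k)) ∧
      (fun K : ℕ => ∑ k ∈ Finset.range K, ((2 * k + 1 : ℕ) : ℝ) • (y (l k) - α))
        =o[atTop] fun K : ℕ => (K : ℝ) ^ 2 := by
  have h : ∀ v : E, ∃ i, p i ∧ inner ℝ v (y i - α) ≤ 0 := by
    intro v
    obtain ⟨_, ⟨i, hi, rfl⟩, h⟩ := greedy_choice hα v
    exact ⟨i, hi, h⟩
  choose f hfp hf using h
  let s : ℕ → E := fun K => Nat.rec 0 (fun k v => v + ((2 * k + 1 : ℕ) : ℝ) • (y (f v) - α)) K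
  have hs : ∀ k, s (k + 1) = s k + ((2 * k + 1 : ℕ) : ℝ) • (y (f (s k)) - α) := fun k => rfl
  have hsum : ∀ K, ∑ k ∈ Finset.range K, ((2 * k + 1 : ℕ) : ℝ) • (y (f (s k)) - α) = s K := by
    intro K
    induction K with
    | zero => simp [s]
    | succ K ih => rw [Finset.sum_range_succ, ih, hs]
  refine ⟨fun k => f (s k), fun k => hfp _, ?_⟩
  simp_rw [hsum]
  have hb : ∀ K : ℕ, ‖s K‖ ^ 2 ≤ 4 * D ^ 2 * (K : ℝ) ^ 3 := by
    intro K
    induction K with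
    | zero => simp [s]
    | succ K ih =>
      rw [hs, norm_add_sq_real, inner_smul_right, norm_smul, Real.norm_eq_abs, mul_pow, sq_abs]
      have h1 : ((2 * K + 1 : ℕ) : ℝ) * inner ℝ (s K) (y (f (s K)) - α) ≤ 0 :=
        mul_nonpos_of_nonneg_of_nonpos (by positivity) (hf _)
      have h2 : ‖y (f (s K)) - α‖ ^ 2 ≤ D ^ 2 := pow_le_pow_left₀ (norm_nonneg _) (hD _) 2
      have h3 : ((2 * K + 1 : ℕ) : ℝ) ^ 2 * ‖y (f (s K)) - α‖ ^ 2 ≤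
          ((2 * K + 1 : ℕ) : ℝ) ^ 2 * D ^ 2 := by gcongr
      push_cast at *
      have h4 : (0:ℝ) ≤ D ^ 2 * (8 * K ^ 2 + 8 * K + 3) := by positivity
      nlinarith
  rw [Asymptotics.isLittleO_iff]
  intro c hc
  obtain ⟨K0, hK0⟩ := exists_nat_gt (4 * D ^ 2 / c ^ 2)
  filter_upwards [eventually_ge_atTop K0] with K hK
  rw [Real.norm_eq_abs, abs_of_nonneg (by positivity)]
  refine le_of_sq_le_sq ?_ (by positivity)
  have hK' : (K0 : ℝ) ≤ K := by exact_mod_cast hK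
  rw [div_lt_iff₀ (by positivity)] at hK0
  calc ‖s K‖ ^ 2 ≤ 4 * D ^ 2 * (K : ℝ) ^ 3 := hb K
    _ ≤ (K0 * c ^ 2) * K ^ 3 := by gcongr
    _ ≤ (K * c ^ 2) * K ^ 3 := by gcongr
    _ = _ := by ring

/-- free steps -/
def Fr (q : ℕ → ℕ) (t : ℕ) : Prop := t - (Nat.sqrt t) ^ 2 < q (Nat.sqrt t)

instance (q : ℕ → ℕ) : DecidablePred (Fr q) := fun t =>
  inferInstanceAs (Decidable (t - (Nat.sqrt t) ^ 2 < q (Nat.sqrt t)))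

lemma sqrt_blk {k r : ℕ} (hr : r < 2 * k + 1) : Nat.sqrt (k ^ 2 + r) = k :=
  Nat.sqrt_add_eq' k (by omega)

lemma Fr_blk (q : ℕ → ℕ) {k r : ℕ} (hr : r < 2 * k + 1) : Fr q (k ^ 2 + r) ↔ r < q k := by
  unfold Fr
  rw [sqrt_blk hr, Nat.add_sub_cancel_left]

lemma sum_sq {M : Type*} [AddCommMonoid M] (h : ℕ → M) (K : ℕ) : ∑ t ∈ Finset.range (K ^ 2), h t =
    ∑ k ∈ Finset.range K, ∑ r ∈ Finset.range (2 * k + 1), h (k ^ 2 + r) := by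
  induction K with
  | zero => simp
  | succ K ih =>
    rw [Finset.sum_range_succ, ← ih, ← Finset.sum_range_add]
    congr 2; ring

lemma sum_blk (q : ℕ → ℕ) (u : ℕ → ℝ) (hu : ∀ ρ, 0 ≤ u ρ) {D : ℝ} (hq : ∀ k, q k ≤ 2 * k + 1)
    (k : ℕ) :
    ∑ r ∈ Finset.range (2 * k + 1), (if Fr q (k ^ 2 + r) then D
      else u ((Nat.sqrt (k ^ 2 + r) + 1) ^ 2 - (k ^ 2 + r))) ≤
    q k * D + ∑ ρ ∈ Finset.range (2 * k + 1), u (ρ + 1) := by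
  have h1 : ∑ ρ ∈ Finset.range (2 * k + 1), u (ρ + 1) =
      ∑ r ∈ Finset.range (2 * k + 1), u ((2 * k + 1) - r) := by
    rw [← Finset.sum_range_reflect]
    refine Finset.sum_congr rfl fun r hr => ?_
    have := Finset.mem_range.1 hr
    congr 1; omega
  have h2 : (q k : ℝ) * D = ∑ r ∈ Finset.range (2 * k + 1), if r < q k then D else 0 := by
    rw [← Finset.sum_filter]
    have : (Finset.range (2 * k + 1)).filter (fun r => r < q k) = Finset.range (q k) := by
      ext r; simp only [Finset.mem_filter, Finset.mem_range]; have := hq k; omega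
    rw [this]; simp
  rw [h1, h2, ← Finset.sum_add_distrib]
  refine Finset.sum_le_sum fun r hr => ?_
  have hr' := Finset.mem_range.1 hr
  have h3 : (k + 1) ^ 2 - (k ^ 2 + r) = 2 * k + 1 - r := by
    have : (k + 1) ^ 2 = k ^ 2 + (2 * k + 1) := by ring
    omega
  rw [sqrt_blk hr', h3]
  have h4 := Fr_blk q hr'
  have h5 := hu (2 * k + 1 - r)
  by_cases h : r < q k
  · rw [if_pos (h4.2 h), if_pos h]; linarith
  · rw [if_neg (fun h' => h (h4.1 h')), if_neg h]; linarith

lemma count_sq (q : ℕ → ℕ) (hq : ∀ k, q k ≤ 2 * k + 1) (K : ℕ) :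
    (Nat.count (Fr q) (K ^ 2)) = ∑ k ∈ Finset.range K, q k := by
  have h0 : ∀ n, Nat.count (Fr q) n = ∑ t ∈ Finset.range n, if Fr q t then 1 else 0 := by
    intro n
    induction n with
    | zero => simp
    | succ n ih => rw [Nat.count_succ, ih, Finset.sum_range_succ]
  rw [h0, sum_sq]
  refine Finset.sum_congr rfl fun k _ => ?_
  rw [← Finset.sum_filter]
  have : (Finset.range (2 * k + 1)).filter (fun r => Fr q (k ^ 2 + r)) = Finset.range (q k) := by
    ext r
    simp only [Finset.mem_filter, Finset.mem_range]
    constructor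
    · rintro ⟨h1, h2⟩; exact (Fr_blk q h1).1 h2
    · intro h
      have h1 : r < 2 * k + 1 := h.trans_le (hq k)
      exact ⟨h1, (Fr_blk q h1).2 h⟩
  rw [this]; simp

lemma VV_littleO {u : ℕ → ℝ} (hu : Tendsto u atTop (𝓝 0)) :
    (fun k : ℕ => ∑ ρ ∈ Finset.range (2 * k + 1), u (ρ + 1)) =o[atTop]
      fun k : ℕ => ((2 * k + 1 : ℕ) : ℝ) := by
  have h1 : (fun n : ℕ => ∑ ρ ∈ Finset.range n, u (ρ + 1)) =o[atTop] fun n : ℕ => (n : ℝ) :=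
    Asymptotics.isLittleO_sum_range_of_tendsto_zero ((tendsto_add_atTop_iff_nat 1).2 hu)
  exact h1.comp_tendsto (tendsto_atTop_mono (fun k => by omega : ∀ k, k ≤ 2 * k + 1) tendsto_id)

lemma one_littleO : (fun _ : ℕ => (1:ℝ)) =o[atTop] fun k : ℕ => ((2 * k + 1 : ℕ) : ℝ) := by
  rw [Asymptotics.isLittleO_const_left]
  right
  refine tendsto_norm_atTop_atTop.comp (tendsto_natCast_atTop_atTop.comp ?_)
  exact tendsto_atTop_mono (fun k => by omega : ∀ k, k ≤ 2 * k + 1) tendsto_id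

/-- existence of the number of free steps per superblock -/
lemma exists_q {v : ℕ → ℝ} (hv0 : ∀ ρ, 0 ≤ v ρ) (hv : Tendsto v atTop (𝓝 0)) {a : ℝ} (ha : 0 ≤ a) :
    ∃ q : ℕ → ℕ, (∀ k, 1 ≤ q k) ∧ (∀ k, q k ≤ 2 * k + 1) ∧
      ((fun k => (q k : ℝ)) =o[atTop] fun k : ℕ => ((2 * k + 1 : ℕ) : ℝ)) ∧
      (∃ C, ∀ t, Fr q t → a * ∑ t' ∈ Finset.range t, (if Fr q t' then 0
        else v ((Nat.sqrt t' + 1) ^ 2 - t')) ≤ Nat.count (Fr q) t + C) := by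
  set V : ℕ → ℝ := fun k => ∑ ρ ∈ Finset.range (2 * k + 1), v (ρ + 1) with hV
  have hV0 : ∀ k, 0 ≤ V k := fun k => Finset.sum_nonneg fun _ _ => hv0 _
  have hVo := VV_littleO hv
  set q : ℕ → ℕ := fun k => min (2 * k + 1) (⌈a * V k⌉₊ + 1) with hq
  have hq1 : ∀ k, 1 ≤ q k := fun k => by simp only [hq]; omega
  have hq2 : ∀ k, q k ≤ 2 * k + 1 := fun k => min_le_left _ _
  have hbig : (fun k => a * V k + 2 * 1) =o[atTop] fun k : ℕ => ((2 * k + 1 : ℕ) : ℝ) :=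
    (hVo.const_mul_left a).add (one_littleO.const_mul_left 2)
  have hqo : (fun k => (q k : ℝ)) =o[atTop] fun k : ℕ => ((2 * k + 1 : ℕ) : ℝ) := by
    refine Asymptotics.IsBigO.trans_isLittleO (Asymptotics.IsBigO.of_bound 1 ?_) hbig
    refine Eventually.of_forall fun k => ?_
    have h0 := mul_nonneg ha (hV0 k)
    rw [Real.norm_eq_abs, Real.norm_eq_abs, abs_of_nonneg (by positivity),
      abs_of_nonneg (by positivity), one_mul]
    have h1 : q k ≤ ⌈a * V k⌉₊ + 1 := min_le_right _ _
    have h2 := Nat.ceil_lt_add_one h0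
    have h3 : (q k : ℝ) ≤ ⌈a * V k⌉₊ + 1 := by exact_mod_cast h1
    linarith
  refine ⟨q, hq1, hq2, hqo, ?_⟩
  have hev : ∀ᶠ k in atTop, a * V k ≤ q k := by
    have := hbig.def (show (0:ℝ) < 1 by norm_num)
    filter_upwards [this] with k hk
    have h0 := mul_nonneg ha (hV0 k)
    rw [Real.norm_eq_abs, Real.norm_eq_abs, abs_of_nonneg (by positivity),
      abs_of_nonneg (by positivity), one_mul] at hk
    simp only [hq]
    rw [Nat.cast_min, le_min_iff]
    refine ⟨by linarith, ?_⟩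
    push_cast
    linarith [Nat.le_ceil (a * V k)]
  obtain ⟨k0, hk0⟩ := eventually_atTop.1 hev
  refine ⟨∑ k ∈ Finset.range k0, a * V k, fun t ht => ?_⟩
  obtain ⟨K, hKt, hKt2⟩ : ∃ K : ℕ, K ^ 2 ≤ t ∧ t < (K + 1) ^ 2 :=
    ⟨Nat.sqrt t, Nat.sqrt_le' t, Nat.lt_succ_sqrt' t⟩
  have hexp : (K + 1) ^ 2 = K ^ 2 + (2 * K + 1) := by ring
  obtain ⟨r, rfl⟩ := Nat.exists_eq_add_of_le hKt
  have hr : r < 2 * K + 1 := by omega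
  have hrq : r < q K := (Fr_blk q hr).1 ht
  rw [Finset.sum_range_add]
  have hz : ∑ x ∈ Finset.range r, (if Fr q (K ^ 2 + x) then (0:ℝ)
      else v ((Nat.sqrt (K ^ 2 + x) + 1) ^ 2 - (K ^ 2 + x))) = 0 := by
    refine Finset.sum_eq_zero fun x hx => ?_
    have hx' := Finset.mem_range.1 hx
    rw [if_pos ((Fr_blk q (hx'.trans hr)).2 (hx'.trans hrq))]
  rw [hz, add_zero, sum_sq]
  have h1 : ∀ k, ∑ r ∈ Finset.range (2 * k + 1), (if Fr q (k ^ 2 + r) then (0:ℝ)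
      else v ((Nat.sqrt (k ^ 2 + r) + 1) ^ 2 - (k ^ 2 + r))) ≤ V k := fun k => by
    have := sum_blk q v hv0 (D := 0) hq2 k
    simpa using this
  have h2 : (∑ k ∈ Finset.range K, (q k : ℝ)) ≤ Nat.count (Fr q) (K ^ 2 + r) := by
    have : Nat.count (Fr q) (K ^ 2) ≤ Nat.count (Fr q) (K ^ 2 + r) :=
      Nat.count_monotone _ (by omega)
    rw [count_sq q hq2] at this
    exact_mod_cast this
  have h3 : ∑ k ∈ Finset.range K, a * V k ≤
      ∑ k ∈ Finset.range K, (q k : ℝ) + ∑ k ∈ Finset.range k0, a * V k := by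
    have h4 : ∑ k ∈ Finset.range K, a * V k ≤
      ∑ k ∈ Finset.range K, ((q k : ℝ) + if k < k0 then a * V k else 0) := by
      refine Finset.sum_le_sum fun k _ => ?_
      by_cases h : k < k0
      · rw [if_pos h]
        have : (0:ℝ) ≤ q k := by positivity
        linarith
      · rw [if_neg h]
        linarith [hk0 k (by omega)]
    rw [Finset.sum_add_distrib, ← Finset.sum_filter] at h4
    have h5 : ∑ k ∈ (Finset.range K).filter (fun k => k < k0), a * V k ≤
        ∑ k ∈ Finset.range k0, a * V k :=
      Finset.sum_le_sum_of_subset_of_nonneg (fun k hk => by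
        simp only [Finset.mem_filter, Finset.mem_range] at hk ⊢; omega)
        (fun k _ _ => mul_nonneg ha (hV0 k))
    linarith
  calc _ ≤ a * ∑ k ∈ Finset.range K, V k := by
        gcongr with k
        exact h1 k
    _ = ∑ k ∈ Finset.range K, a * V k := Finset.mul_sum _ _ _
    _ ≤ _ := by linarith

lemma exists_sup {Z : Type*} (P : ℕ → Z → Prop) (φ : Z → ℝ) (D : ℝ)
    (hD : ∀ ρ, 1 ≤ ρ → ∀ z, P ρ z → φ z ≤ D)
    (hsm : ∀ ε > 0, ∃ M : ℕ, ∀ ρ, M ≤ ρ → ∀ z, P ρ z → φ z ≤ ε) :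
    ∃ v : ℕ → ℝ, (∀ ρ, 0 ≤ v ρ) ∧ Tendsto v atTop (𝓝 0) ∧
      ∀ ρ, 1 ≤ ρ → ∀ z, P ρ z → φ z ≤ v ρ := by
  have h0 : ∀ ρ, 0 ≤ ⨆ z : {z // P ρ z}, max (φ z) 0 := fun ρ =>
    Real.iSup_nonneg fun z => le_max_right _ _
  refine ⟨fun ρ => ⨆ z : {z // P ρ z}, max (φ z) 0, h0, ?_, ?_⟩
  · rw [Metric.tendsto_atTop]
    intro ε hε
    obtain ⟨M, hM⟩ := hsm (ε / 2) (by positivity)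
    refine ⟨M, fun ρ hρ => ?_⟩
    rw [Real.dist_eq, sub_zero, abs_of_nonneg (h0 ρ)]
    refine lt_of_le_of_lt (Real.iSup_le (fun z => max_le (hM ρ hρ z z.2) (by positivity))
      (by positivity)) (half_lt_self hε)
  · intro ρ hρ z hz
    refine (le_max_left (φ z) 0).trans ?_
    refine le_ciSup (f := fun z : {z // P ρ z} => max (φ z) 0) ⟨max D 0, ?_⟩ ⟨z, hz⟩
    rintro _ ⟨w, rfl⟩
    exact max_le_max (hD ρ hρ w w.2) le_rfl

lemma forced_run (q : ℕ → ℕ) {n : ℕ} {t r i : ℕ} (ht : ¬ Fr q t) (hr : r < n)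
    (hi : i < (Nat.sqrt t + 1) ^ 2 - t) :
    ¬ Fr q ((t * n + r + i) / n) ∧ Nat.sqrt ((t * n + r + i) / n) = Nat.sqrt t ∧
      (t * n + r + i) / n < (Nat.sqrt t + 1) ^ 2 := by
  have hn : 0 < n := by omega
  have h1 : (t * n + r + i) / n = t + (r + i) / n := by
    rw [show t * n + r + i = (r + i) + n * t by ring, Nat.add_mul_div_left _ _ hn]; ring
  have h2 : (r + i) / n ≤ i := by
    refine Nat.lt_succ_iff.1 ((Nat.div_lt_iff_lt_mul hn).2 ?_)
    have : i * 1 ≤ i * n := Nat.mul_le_mul_left _ hn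
    rw [Nat.succ_mul]; omega
  obtain ⟨k, hk⟩ : ∃ k, Nat.sqrt t = k := ⟨_, rfl⟩
  rw [hk] at hi ⊢
  have h3 : k ^ 2 ≤ t := hk ▸ Nat.sqrt_le' t
  obtain ⟨a, rfl⟩ := Nat.exists_eq_add_of_le h3
  have hexp : (k + 1) ^ 2 = k ^ 2 + (2 * k + 1) := by ring
  obtain ⟨c, hc⟩ : ∃ c, (r + i) / n = c := ⟨_, rfl⟩
  rw [hc] at h1 h2
  have ha : a < 2 * k + 1 := by omega
  have hac : a + c < 2 * k + 1 := by omega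
  rw [h1, add_assoc, Fr_blk q hac, sqrt_blk hac]
  rw [Fr_blk q ha] at ht
  refine ⟨by omega, rfl, by omega⟩

lemma forced_before (q : ℕ → ℕ) {t t' : ℕ} (ht : Fr q t) (ht' : ¬ Fr q t') (h : t' < t) :
    (Nat.sqrt t' + 1) ^ 2 ≤ t := by
  by_contra hcon
  have h1 : Nat.sqrt t = Nat.sqrt t' := by
    refine le_antisymm ?_ (Nat.sqrt_le_sqrt h.le)
    have := Nat.sqrt_lt'.2 (not_le.1 hcon)
    omega
  unfold Fr at ht ht'
  rw [h1] at ht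
  omega

lemma sum_mul_blk {M : Type*} [AddCommMonoid M] (h : ℕ → M) (n t : ℕ) :
    ∑ j ∈ Finset.range (t * n), h j =
      ∑ t' ∈ Finset.range t, ∑ r ∈ Finset.range n, h (t' * n + r) := by
  induction t with
  | zero => simp
  | succ t ih => rw [Finset.sum_range_succ, ← ih, ← Finset.sum_range_add]; congr 2; ring

lemma b_littleO (q : ℕ → ℕ) {u : ℕ → ℝ} (hu0 : ∀ ρ, 0 ≤ u ρ) (hu : Tendsto u atTop (𝓝 0)) {D : ℝ}
    (hD : 0 ≤ D) (hq2 : ∀ k, q k ≤ 2 * k + 1)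
    (hq : (fun k => (q k : ℝ)) =o[atTop] fun k : ℕ => ((2 * k + 1 : ℕ) : ℝ)) :
    (fun K : ℕ => ∑ t ∈ Finset.range (K ^ 2), (if Fr q t then D
      else u ((Nat.sqrt t + 1) ^ 2 - t))) =o[atTop] fun K : ℕ => (K : ℝ) ^ 2 := by
  have hnn : ∀ t, 0 ≤ (if Fr q t then D else u ((Nat.sqrt t + 1) ^ 2 - t)) := fun t => by
    split_ifs
    exacts [hD, hu0 _]
  have h1 : (fun k : ℕ => ∑ r ∈ Finset.range (2 * k + 1), (if Fr q (k ^ 2 + r) then D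
      else u ((Nat.sqrt (k ^ 2 + r) + 1) ^ 2 - (k ^ 2 + r)))) =o[atTop]
      fun k : ℕ => ((2 * k + 1 : ℕ) : ℝ) := by
    refine Asymptotics.IsBigO.trans_isLittleO (Asymptotics.IsBigO.of_bound 1 ?_)
      ((hq.const_mul_left D).add (VV_littleO hu))
    refine Eventually.of_forall fun k => ?_
    rw [Real.norm_eq_abs, Real.norm_eq_abs, abs_of_nonneg (Finset.sum_nonneg fun _ _ => hnn _),
      one_mul]
    refine le_trans (sum_blk q u hu0 hq2 k) ?_
    rw [mul_comm]
    exact le_abs_self _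
  have h2 : ∀ K : ℕ, ∑ k ∈ Finset.range K, ((2 * k + 1 : ℕ) : ℝ) = (K : ℝ) ^ 2 := by
    intro K
    induction K with
    | zero => simp
    | succ K ih => rw [Finset.sum_range_succ, ih]; push_cast; ring
  have h3 := h1.sum_range (fun k => by positivity) (by
    simp_rw [h2]
    exact (tendsto_pow_atTop two_ne_zero).comp tendsto_natCast_atTop_atTop)
  simp_rw [h2] at h3
  simp_rw [sum_sq]
  exact h3

lemma birk_aux {E : Type*} [NormedAddCommGroup E] [NormedSpace ℝ E] (e : ℕ → E) {n : ℕ} (hn : 1 ≤ n)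
    (c : ℕ → E) (b : ℕ → ℝ) {B : ℝ} (hB : ∀ j, ‖e j‖ ≤ B)
    (h : ∀ j, ‖e j - c (Nat.sqrt (j / n))‖ ≤ b (j / n))
    (hc : (fun K : ℕ => ∑ k ∈ Finset.range K, ((2 * k + 1 : ℕ) : ℝ) • c k) =o[atTop]
      fun K : ℕ => (K : ℝ) ^ 2)
    (hb : (fun K : ℕ => ∑ t ∈ Finset.range (K ^ 2), b t) =o[atTop] fun K : ℕ => (K : ℝ) ^ 2) :
    (fun J : ℕ => ∑ j ∈ Finset.range J, e j) =o[atTop] fun J : ℕ => (J : ℝ) := by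
  have hB0 : 0 ≤ B := (norm_nonneg _).trans (hB 0)
  have hb0 : ∀ t, 0 ≤ b t := fun t => by
    have := (norm_nonneg _).trans (h (t * n))
    rwa [Nat.mul_div_cancel _ (by omega)] at this
  set R : ℕ → ℝ := fun K => n * ‖∑ k ∈ Finset.range K, ((2 * k + 1 : ℕ) : ℝ) • c k‖ +
    n * ∑ t ∈ Finset.range (K ^ 2), b t + (n * B) * ((2 * K + 1 : ℕ) : ℝ) with hR
  have hsq : (fun K : ℕ => ((2 * K + 1 : ℕ) : ℝ)) =o[atTop] fun K : ℕ => (K : ℝ) ^ 2 := by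
    rw [Asymptotics.isLittleO_iff]
    intro ε hε
    obtain ⟨K0, hK0⟩ := exists_nat_gt (3 / ε)
    filter_upwards [eventually_ge_atTop (K0 + 1)] with K hK
    have h1 : (K0 + 1 : ℝ) ≤ K := by exact_mod_cast hK
    have h2 : (0:ℝ) ≤ K0 := by positivity
    rw [div_lt_iff₀ hε] at hK0
    rw [Real.norm_eq_abs, Real.norm_eq_abs, abs_of_nonneg (by positivity),
      abs_of_nonneg (by positivity)]
    push_cast
    have h3 : (3:ℝ) ≤ ε * K := by nlinarith
    nlinarith
  have hRo : R =o[atTop] fun K : ℕ => (K : ℝ) ^ 2 :=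
    ((hc.norm_left.const_mul_left _).add (hb.const_mul_left _)).add (hsq.const_mul_left _)
  have hkey : ∀ J, ‖∑ j ∈ Finset.range J, e j‖ ≤ R (Nat.sqrt (J / n)) := by
    intro J
    obtain ⟨K, hK⟩ : ∃ K, Nat.sqrt (J / n) = K := ⟨_, rfl⟩
    rw [hK]
    have h1 : K ^ 2 ≤ J / n := hK ▸ Nat.sqrt_le' _
    have h2 : J / n < (K + 1) ^ 2 := hK ▸ Nat.lt_succ_sqrt' _
    rw [Nat.le_div_iff_mul_le (by omega)] at h1
    rw [Nat.div_lt_iff_lt_mul (by omega)] at h2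
    obtain ⟨a, rfl⟩ := Nat.exists_eq_add_of_le h1
    have ha : a ≤ n * (2 * K + 1) := by
      have : (K + 1) ^ 2 * n = K ^ 2 * n + n * (2 * K + 1) := by ring
      omega
    rw [Finset.sum_range_add]
    have h3 : ‖∑ x ∈ Finset.range a, e (K ^ 2 * n + x)‖ ≤ (n * B) * ((2 * K + 1 : ℕ) : ℝ) := by
      refine (norm_sum_le_of_le (Finset.range a) (fun x _ => hB (K ^ 2 * n + x))).trans ?_
      rw [Finset.sum_const, Finset.card_range, nsmul_eq_mul]
      have : (a : ℝ) ≤ n * ((2 * K + 1 : ℕ) : ℝ) := by exact_mod_cast ha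
      nlinarith
    have hdiv : ∀ t r, r < n → (t * n + r) / n = t := fun t r hr => by
      rw [mul_comm, Nat.mul_add_div (by omega), Nat.div_eq_of_lt hr, add_zero]
    have h4 : ‖∑ j ∈ Finset.range (K ^ 2 * n), (e j - c (Nat.sqrt (j / n)))‖ ≤
        n * ∑ t ∈ Finset.range (K ^ 2), b t := by
      refine (norm_sum_le_of_le _ (fun j _ => h j)).trans ?_
      rw [sum_mul_blk, Finset.mul_sum]
      refine Finset.sum_le_sum fun t _ => ?_
      rw [Finset.sum_congr rfl (fun r hr => by rw [hdiv t r (Finset.mem_range.1 hr)])]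
      simp
    have h5 : ∑ j ∈ Finset.range (K ^ 2 * n), c (Nat.sqrt (j / n)) =
        (n : ℝ) • ∑ k ∈ Finset.range K, ((2 * k + 1 : ℕ) : ℝ) • c k := by
      rw [sum_mul_blk, sum_sq, Finset.smul_sum]
      refine Finset.sum_congr rfl fun k _ => ?_
      rw [Finset.sum_congr rfl (fun x hx => ?_)]
      rotate_left
      · exact fun _ => n • c k
      · rw [Finset.sum_congr rfl (fun r hr => by
          rw [hdiv _ r (Finset.mem_range.1 hr), sqrt_blk (Finset.mem_range.1 hx)])]
        simp
      · rw [Finset.sum_const, Finset.card_range, Nat.cast_smul_eq_nsmul, Nat.cast_smul_eq_nsmul,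
          smul_comm]
    have h6 : ∑ j ∈ Finset.range (K ^ 2 * n), e j =
        (n : ℝ) • ∑ k ∈ Finset.range K, ((2 * k + 1 : ℕ) : ℝ) • c k +
        ∑ j ∈ Finset.range (K ^ 2 * n), (e j - c (Nat.sqrt (j / n))) := by
      rw [← h5, ← Finset.sum_add_distrib]
      exact Finset.sum_congr rfl fun j _ => by abel
    rw [h6]
    refine (norm_add_le _ _).trans (add_le_add ((norm_add_le _ _).trans (add_le_add ?_ h4)) h3)
    rw [norm_smul, Real.norm_natCast]
  have hsqrt : Tendsto (fun J : ℕ => Nat.sqrt (J / n)) atTop atTop := by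
    refine tendsto_atTop.2 fun K => ?_
    filter_upwards [eventually_ge_atTop (K ^ 2 * n)] with J hJ
    exact Nat.le_sqrt'.2 ((Nat.le_div_iff_mul_le (by omega)).2 hJ)
  refine Asymptotics.IsBigO.trans_isLittleO (Asymptotics.IsBigO.of_bound 1 ?_)
    ((hRo.comp_tendsto hsqrt).trans_isBigO (Asymptotics.IsBigO.of_bound 1 ?_))
  · refine Eventually.of_forall fun J => ?_
    rw [one_mul]
    exact (hkey J).trans (le_abs_self _)
  · refine Eventually.of_forall fun J => ?_
    rw [one_mul]
    simp only [Function.comp_apply, Real.norm_eq_abs]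
    rw [abs_of_nonneg (by positivity), abs_of_nonneg (by positivity)]
    have h1 : (Nat.sqrt (J / n)) ^ 2 ≤ J := (Nat.sqrt_le' _).trans (Nat.div_le_self _ _)
    exact_mod_cast h1

lemma dim_lower {N : ℕ} (hN : 1 < N) (x : (ℕ → Fin N) → ℝ) {s C : ℝ} (hs : 0 < s)
    (h : ∀ χ χ', |Real.ofDigits χ - Real.ofDigits χ'| ≤ C * |x χ - x χ'| ^ s) :
    ENNReal.ofReal s ≤ dimH (range x) := by
  classical
  have hc : ∀ y : range x, ∃ χ, x χ = y := fun y => y.2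
  choose g hg using hc
  set f : ℝ → ℝ := fun y => if hy : y ∈ range x then Real.ofDigits (g ⟨y, hy⟩) else 0 with hf
  have hfx : ∀ χ, f (x χ) = Real.ofDigits χ := by
    intro χ
    have hm : x χ ∈ range x := ⟨χ, rfl⟩
    simp only [hf, dif_pos hm]
    have h1 := h (g ⟨x χ, hm⟩) χ
    rw [hg ⟨x χ, hm⟩] at h1
    simp only [sub_self, abs_zero, Real.zero_rpow hs.ne', mul_zero] at h1
    exact sub_eq_zero.1 (abs_eq_zero.1 (le_antisymm h1 (abs_nonneg _)))
  have hC : ∀ χ χ', |Real.ofDigits χ - Real.ofDigits χ'| ≤ max C 0 * |x χ - x χ'| ^ s :=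
    fun χ χ' => (h χ χ').trans (by gcongr; exact le_max_left _ _)
  have hH : HolderOnWith (Real.toNNReal (max C 0)) (Real.toNNReal s) f (range x) := by
    rintro _ ⟨χ, rfl⟩ _ ⟨χ', rfl⟩
    rw [hfx, hfx, edist_dist, edist_dist, Real.dist_eq, Real.dist_eq, Real.coe_toNNReal s hs.le,
      ENNReal.ofReal_rpow_of_nonneg (abs_nonneg _) hs.le]
    change _ ≤ ENNReal.ofReal (max C 0) * _
    rw [← ENNReal.ofReal_mul (le_max_right _ _)]
    exact ENNReal.ofReal_le_ofReal (hC χ χ')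
  have hsub : Icc (0:ℝ) 1 ⊆ f '' range x := by
    intro y hy
    obtain ⟨χ, -, hχ⟩ := Real.ofDigits_SurjOn hN hy
    exact ⟨x χ, ⟨χ, rfl⟩, by rw [hfx, hχ]⟩
  have h1 : dimH (Icc (0:ℝ) 1) = 1 := by
    rw [Real.dimH_of_nonempty_interior (by simp)]; simp
  have h2 : (1 : ENNReal) ≤ dimH (range x) / (Real.toNNReal s : ENNReal) :=
    h1 ▸ (dimH_mono hsub).trans (hH.dimH_image_le (Real.toNNReal_pos.2 hs))
  rwa [ENNReal.le_div_iff_mul_le (Or.inl (by simpa using hs)) (Or.inl (by simp)), one_mul] at h2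

namespace PCSystem

variable {m : ℕ} (S : PCSystem m)

/-- points whose whole orbit stays in the union of the intervals -/
def Lt : Set ℝ := {x | ∀ j, ∃ i, S.T^[j] x ∈ S.I i}

lemma Lt_sub : S.Lt ⊆ S.attractor := fun x hx =>
  ⟨mem_iUnion.2 (hx 0), fun n => by obtain ⟨i, hi⟩ := hx n; exact S.hIsub i hi⟩

lemma Lt_compact : IsCompact S.Lt := by
  have h : S.Lt = ⋂ n : ℕ, ⋃ w : Fin n → Fin m, S.A w := by
    ext x
    simp only [mem_iInter, mem_iUnion]
    constructor
    · intro hx n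
      choose f hf using hx
      exact ⟨fun j => f j, fun j => hf j⟩
    · intro hx j
      obtain ⟨w, hw⟩ := hx (j + 1)
      exact ⟨_, hw ⟨j, by omega⟩⟩
  refine isCompact_Icc.of_isClosed_subset (s := Icc (0:ℝ) 1) ?_ ?_
  · rw [h]
    refine isClosed_iInter fun n => isClosed_iUnion_of_finite fun w => ?_
    obtain ⟨ω, hω⟩ := S.A_eq_Cy w
    rw [hω]; exact S.Cy_closed n ω
  · intro x hx
    obtain ⟨i, hi⟩ := hx 0
    exact S.hIsub i hi

lemma iter_fix (i : Fin m) (j : ℕ) : S.T^[j] (S.fixPt i) = S.fixPt i :=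
  Function.iterate_fixed (S.hfix i) j

lemma fix_Cy (i : Fin m) (n : ℕ) : S.fixPt i ∈ S.Cy (fun _ => i) n := fun j _ => by
  rw [S.iter_fix]; exact S.hfixmem i

lemma fix_Lt (i : Fin m) : S.fixPt i ∈ S.Lt := fun j => ⟨i, by
  rw [S.iter_fix]; exact S.hfixmem i⟩

lemma exists_v : ∃ v : ℕ → ℝ, (∀ ρ, 0 ≤ v ρ) ∧ Tendsto v atTop (𝓝 0) ∧
    ∀ ρ, 1 ≤ ρ → ∀ i, S.T' (S.fixPt i) = 1 → ∀ z ∈ S.Cy (fun _ => i) ρ,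
      Real.log (S.T' z) ≤ v ρ := by
  obtain ⟨G, hG, hGb⟩ := S.log_bdd
  obtain ⟨v, h0, h1, h2⟩ := exists_sup (Z := Fin m × ℝ)
    (fun ρ p => S.T' (S.fixPt p.1) = 1 ∧ p.2 ∈ S.Cy (fun _ => p.1) ρ)
    (fun p => Real.log (S.T' p.2)) G
    (fun ρ hρ p hp => hGb p.1 _ (hp.2 0 (by omega))) (fun ε hε => by
      obtain ⟨M, hM⟩ := S.log_unif hε
      refine ⟨M, fun ρ hρ p hp => ?_⟩
      have := hM (fun _ => p.1) ρ hρ _ hp.2 _ (S.fix_Cy p.1 ρ)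
      rw [hp.1, Real.log_one, sub_zero] at this
      exact (le_abs_self _).trans this)
  exact ⟨v, h0, h1, fun ρ hρ i hi z hz => h2 ρ hρ (i, z) ⟨hi, hz⟩⟩

lemma exists_u {E : Type*} [NormedAddCommGroup E] {F : ℝ → E} (hF : ContinuousOn F S.attractor) :
    ∃ u : ℕ → ℝ, (∀ ρ, 0 ≤ u ρ) ∧ Tendsto u atTop (𝓝 0) ∧
    ∀ ρ, 1 ≤ ρ → ∀ i, ∀ z ∈ S.Cy (fun _ => i) ρ, z ∈ S.Lt →
      ‖F z - F (S.fixPt i)‖ ≤ u ρ := by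
  have hF' : ContinuousOn F S.Lt := hF.mono S.Lt_sub
  obtain ⟨B, hB⟩ := S.Lt_compact.exists_bound_of_continuousOn hF'
  have hU := S.Lt_compact.uniformContinuousOn_of_continuous hF'
  rw [Metric.uniformContinuousOn_iff] at hU
  obtain ⟨v, h0, h1, h2⟩ := exists_sup (Z := Fin m × ℝ)
    (fun ρ p => p.2 ∈ S.Cy (fun _ => p.1) ρ ∧ p.2 ∈ S.Lt)
    (fun p => ‖F p.2 - F (S.fixPt p.1)‖) (B + B)
    (fun ρ hρ p hp => (norm_sub_le _ _).trans (add_le_add (hB _ hp.2) (hB _ (S.fix_Lt _))))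
    (fun ε hε => by
      obtain ⟨δ, hδ, hd⟩ := hU ε hε
      obtain ⟨M, hM⟩ := S.diam_small hδ
      refine ⟨M, fun ρ hρ p hp => ?_⟩
      have h1 := hM (fun _ => p.1) ρ hρ _ hp.1 _ (S.fix_Cy p.1 ρ)
      rw [← dist_eq_norm]
      exact (hd _ hp.2 _ (S.fix_Lt _) (by rwa [Real.dist_eq])).le)
  exact ⟨v, h0, h1, fun ρ hρ i z hz hz' => h2 ρ hρ (i, z) ⟨hz, hz'⟩⟩

lemma BS_add (a b : ℕ) (z : ℝ) : S.BS (a + b) z = S.BS a z + S.BS b (S.T^[a] z) := by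
  unfold BS
  rw [Finset.sum_range_add]
  congr 1
  refine Finset.sum_congr rfl fun j _ => ?_
  rw [← Function.iterate_add_apply, add_comm]

/-- coding sequence assembled from free words `g` and forced letters `l` -/
def om (q : ℕ → ℕ) {n : ℕ} (hn : 0 < n) (l : ℕ → Fin m) (g : ℕ → Fin n → Fin m) (j : ℕ) : Fin m :=
  if Fr q (j / n) then g (Nat.count (Fr q) (j / n)) ⟨j % n, Nat.mod_lt _ hn⟩
  else l (Nat.sqrt (j / n))

variable {q : ℕ → ℕ} {n : ℕ} {hn : 0 < n} {l : ℕ → Fin m} {g g' : ℕ → Fin n → Fin m}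

lemma om_forced {j : ℕ} (h : ¬ Fr q (j / n)) : om q hn l g j = l (Nat.sqrt (j / n)) := if_neg h

lemma om_free {t r : ℕ} (ht : Fr q t) (hr : r < n) :
    om q hn l g (t * n + r) = g (Nat.count (Fr q) t) ⟨r, hr⟩ := by
  have h1 : (t * n + r) / n = t := by
    rw [mul_comm, Nat.mul_add_div hn, Nat.div_eq_of_lt hr, add_zero]
  have h2 : (t * n + r) % n = r := by
    rw [mul_comm, Nat.mul_add_mod, Nat.mod_eq_of_lt hr]
  unfold om
  rw [h1, if_pos ht]
  congr 1
  exact Fin.ext h2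

lemma forced_Cy {J t r : ℕ} (ht : ¬ Fr q t) (hr : r < n) (hJ : (Nat.sqrt t + 1) ^ 2 * n ≤ J) {z : ℝ}
    (hz : z ∈ S.Cy (om q hn l g) J) :
    S.T^[t * n + r] z ∈ S.Cy (fun _ => l (Nat.sqrt t)) ((Nat.sqrt t + 1) ^ 2 - t) := by
  intro i hi
  obtain ⟨h1, h2, h3⟩ := forced_run q ht hr hi
  rw [← Function.iterate_add_apply, add_comm i]
  rw [Nat.div_lt_iff_lt_mul hn] at h3
  have := hz (t * n + r + i) (by omega)
  rwa [om_forced h1, h2] at this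

lemma BS_est {v : ℕ → ℝ} (hv : ∀ ρ, 1 ≤ ρ → ∀ i, S.T' (S.fixPt i) = 1 → ∀ z ∈ S.Cy (fun _ => i) ρ,
      Real.log (S.T' z) ≤ v ρ) {L : ℝ} (hg : ∀ a, ∀ x ∈ S.A (g a), S.BS n x ≤ L)
    (hl : ∀ k, S.T' (S.fixPt (l k)) = 1) {t : ℕ} (ht : Fr q t) {z : ℝ}
    (hz : z ∈ S.Cy (om q hn l g) (t * n)) :
    S.BS (t * n) z ≤ L * Nat.count (Fr q) t + n * ∑ t' ∈ Finset.range t, (if Fr q t' then 0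
        else v ((Nat.sqrt t' + 1) ^ 2 - t')) := by
  have hcount : (Nat.count (Fr q) t : ℝ) = ∑ t' ∈ Finset.range t, if Fr q t' then (1:ℝ) else 0 := by
    rw [Nat.count_eq_card_filter_range, Finset.sum_boole]
  unfold BS
  rw [sum_mul_blk, hcount, Finset.mul_sum, Finset.mul_sum, ← Finset.sum_add_distrib]
  refine Finset.sum_le_sum fun t' ht' => ?_
  have ht't := Finset.mem_range.1 ht'
  have hle : t' * n + n ≤ t * n := by
    have : (t' + 1) * n ≤ t * n := Nat.mul_le_mul_right _ ht't
    linarith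
  by_cases h : Fr q t'
  · rw [if_pos h, if_pos h, mul_one, mul_zero, add_zero]
    have h1 : S.T^[t' * n] z ∈ S.A (g (Nat.count (Fr q) t')) := by
      intro r
      rw [← Function.iterate_add_apply, add_comm]
      have := hz (t' * n + r) (by have := r.2; omega)
      rwa [om_free h r.2] at this
    have h2 := hg _ _ h1
    unfold BS at h2
    refine le_of_eq_of_le (Finset.sum_congr rfl fun r _ => ?_) h2
    rw [← Function.iterate_add_apply, add_comm]
  · rw [if_neg h, if_neg h, mul_zero, zero_add]
    have hJ : (Nat.sqrt t' + 1) ^ 2 * n ≤ t * n :=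
      Nat.mul_le_mul_right _ (forced_before q ht h ht't)
    have hpos : 1 ≤ (Nat.sqrt t' + 1) ^ 2 - t' := by
      have := Nat.lt_succ_sqrt' t'
      simp only [Nat.succ_eq_add_one] at this
      omega
    have := Finset.sum_le_card_nsmul (Finset.range n)
      (fun r => Real.log (S.T' (S.T^[t' * n + r] z))) (v ((Nat.sqrt t' + 1) ^ 2 - t'))
      (fun r hr => hv _ hpos _ (hl _) _ (S.forced_Cy h (Finset.mem_range.1 hr) hJ hz))
    simpa using this

lemma Fr_infinite (hq : ∀ k, 1 ≤ q k) : {t | Fr q t}.Infinite := by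
  refine Set.infinite_of_injective_forall_mem (f := fun k : ℕ => k ^ 2)
    (Nat.pow_left_injective (by norm_num)) fun k => ?_
  have := (Fr_blk q (k := k) (r := 0) (by omega)).2 (hq k)
  rw [add_zero] at this
  exact this

lemma sep {v : ℕ → ℝ} (hv : ∀ ρ, 1 ≤ ρ → ∀ i, S.T' (S.fixPt i) = 1 → ∀ z ∈ S.Cy (fun _ => i) ρ,
      Real.log (S.T' z) ≤ v ρ) {L : ℝ} (hg : ∀ a, ∀ x ∈ S.A (g a), S.BS n x ≤ L)
    (hl : ∀ k, S.T' (S.fixPt (l k)) = 1) (hq : ∀ k, 1 ≤ q k)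
    {G : ℝ} (hG0 : 0 < G) (hG : ∀ i, ∀ x ∈ S.I i, Real.log (S.T' x) ≤ G)
    {δ : ℝ} (hδ : ∀ i j, i ≠ j → ∀ x ∈ S.I i, ∀ y ∈ S.I j, δ ≤ |x - y|)
    {i : ℕ} (hlt : ∀ a < i, g a = g' a) (hi : g i ≠ g' i) {x y : ℝ}
    (hx : ∀ j, S.T^[j] x ∈ S.I (om q hn l g j)) (hy : ∀ j, S.T^[j] y ∈ S.I (om q hn l g' j)) :
    ∃ t, Fr q t ∧ Nat.count (Fr q) t = i ∧
      δ ≤ Real.exp (L * i + n * ∑ t' ∈ Finset.range t, (if Fr q t' then 0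
        else v ((Nat.sqrt t' + 1) ^ 2 - t')) + n * G) * |x - y| := by
  have hinf := Fr_infinite hq
  obtain ⟨t, ht, hct⟩ : ∃ t, Fr q t ∧ Nat.count (Fr q) t = i :=
    ⟨Nat.nth (Fr q) i, Nat.nth_mem_of_infinite hinf i, Nat.count_nth_of_infinite hinf i⟩
  refine ⟨t, ht, hct, ?_⟩
  obtain ⟨r, hr⟩ := Function.ne_iff.1 hi
  have hex : ∃ j, om q hn l g j ≠ om q hn l g' j :=
    ⟨t * n + r, by rw [om_free ht r.2, om_free ht r.2, hct]; exact hr⟩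
  classical
  obtain ⟨j0, hj0, hmin⟩ : ∃ j, om q hn l g j ≠ om q hn l g' j ∧
      ∀ j' < j, om q hn l g j' = om q hn l g' j' :=
    ⟨Nat.find hex, Nat.find_spec hex, fun j' hj' => not_not.1 (Nat.find_min hex hj')⟩
  have hge : t * n ≤ j0 := by
    by_contra hcon
    refine hj0 ?_
    have h1 : j0 / n < t := (Nat.div_lt_iff_lt_mul hn).2 (not_le.1 hcon)
    unfold om
    by_cases h : Fr q (j0 / n)
    · rw [if_pos h, if_pos h, hlt]
      rw [← hct]
      exact Nat.count_strict_mono h h1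
    · rw [if_neg h, if_neg h]
  have hle : j0 ≤ t * n + r := by
    by_contra hcon
    have := hmin _ (not_le.1 hcon)
    rw [om_free ht r.2, om_free ht r.2, hct] at this
    exact hr this
  obtain ⟨a, rfl⟩ := Nat.exists_eq_add_of_le hge
  have ha : a ≤ n := by have := r.2; omega
  have hxC : x ∈ S.Cy (om q hn l g) (t * n + a) := fun j _ => hx j
  have hyC : y ∈ S.Cy (om q hn l g) (t * n + a) := fun j hj => by rw [hmin j hj]; exact hy j
  refine (hδ _ _ hj0 _ (hx _) _ (hy _)).trans (S.lip_iter _ _ (fun z hz => ?_) hxC hyC)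
  rw [BS_add]
  have h1 := S.BS_est hv hg hl ht (S.Cy_mono _ (Nat.le_add_right _ _) hz)
  have h2 := S.BS_le hG (S.Cy_iter hz)
  rw [hct] at h1
  have h3 : (a : ℝ) * G ≤ n * G := by
    have : (a : ℝ) ≤ n := by exact_mod_cast ha
    gcongr
  linarith

lemma lower {d : ℕ} {F : ℝ → EuclideanSpace ℝ (Fin d)} (hF : ContinuousOn F S.attractor)
    {α : EuclideanSpace ℝ (Fin d)} (hα : α ∈ convexHull ℝ (F '' S.parabolicSet))
    {s : ℝ} (hs : 0 < s) {n : ℕ} (hn : 1 ≤ n) {L : ℝ} (hL : 0 ≤ L) (W : Finset (Fin n → Fin m))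
    (hW : ∀ w ∈ W, ∀ x ∈ S.A w, S.BS n x ≤ L) (hN : s * L + 1 ≤ Real.log W.card) :
    ENNReal.ofReal s ≤ dimH (S.levelSet F α) := by
  obtain ⟨v, hv0, hv1, hv⟩ := S.exists_v
  obtain ⟨u, hu0, hu1, hu⟩ := S.exists_u hF
  obtain ⟨B, hB⟩ := S.Lt_compact.exists_bound_of_continuousOn (hF.mono S.Lt_sub)
  obtain ⟨G, hG0, hG⟩ := S.log_bdd
  obtain ⟨δ, hδ0, hδ⟩ := S.gap
  obtain ⟨q, hq1, hq2, hqo, C, hC⟩ := exists_q hv0 hv1 (a := s * n) (by positivity)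
  have hα' : α ∈ convexHull ℝ {z | ∃ i, S.T' (S.fixPt i) = 1 ∧ z = F (S.fixPt i)} := by
    refine convexHull_mono ?_ hα
    rintro _ ⟨y, ⟨i, rfl, hi⟩, rfl⟩
    exact ⟨i, hi, rfl⟩
  obtain ⟨l, hl, hlo⟩ := greedy (fun i => S.T' (S.fixPt i) = 1) (fun i => F (S.fixPt i)) hα'
    (D := B + ‖α‖) (fun i => (norm_sub_le _ _).trans (add_le_add (hB _ (S.fix_Lt i)) le_rfl))
  have hB0 : 0 ≤ B := (norm_nonneg _).trans (hB _ (S.fix_Lt ⟨0, S.hm⟩))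
  set N := W.card with hNdef
  have hsL : 0 ≤ s * L := by positivity
  have hN1 : 1 < N := by
    by_contra hcon
    have h1 : N = 0 ∨ N = 1 := by omega
    rcases h1 with h1 | h1 <;> rw [h1] at hN <;> simp at hN <;> linarith
  set gg : (ℕ → Fin N) → ℕ → Fin n → Fin m := fun χ a => (W.equivFin.symm (χ a)).1 with hgg
  have hn' : 0 < n := hn
  choose x hx using fun χ : ℕ → Fin N => S.exists_point (om q hn' l (gg χ))
  have hxLt : ∀ χ j, S.T^[j] (x χ) ∈ S.Lt := fun χ j i =>
    ⟨_, by rw [← Function.iterate_add_apply]; exact hx χ _⟩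
  have hsub : range x ⊆ S.levelSet F α := by
    rintro _ ⟨χ, rfl⟩
    refine ⟨S.Lt_sub (hxLt χ 0), ?_⟩
    have hbo := b_littleO q hu0 hu1 (D := B + B) (by positivity) hq2 hqo
    have key := birk_aux (fun j => F (S.T^[j] (x χ)) - α) hn (fun k => F (S.fixPt (l k)) - α) _
      (B := B + ‖α‖) (fun j => (norm_sub_le _ _).trans (add_le_add (hB _ (hxLt χ j)) le_rfl))
      (fun j => by
        rw [sub_sub_sub_cancel_right]
        by_cases h : Fr q (j / n)
        · refine le_of_le_of_eq ((norm_sub_le _ _).trans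
            (add_le_add (hB _ (hxLt χ j)) (hB _ (S.fix_Lt _)))) ?_
          exact (if_pos h).symm
        · refine le_of_le_of_eq (hu ((Nat.sqrt (j / n) + 1) ^ 2 - j / n) ?_ _ _ ?_ (hxLt χ j))
            (if_neg h).symm
          · have := Nat.lt_succ_sqrt' (j / n)
            simp only [Nat.succ_eq_add_one] at this
            omega
          · have := S.forced_Cy (hn := hn') (l := l) (g := gg χ) h (Nat.mod_lt j hn') le_rfl
              (z := x χ) (fun j _ => hx χ j)
            rwa [Nat.div_add_mod'] at this) hlo hbo
    rw [tendsto_iff_norm_sub_tendsto_zero]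
    have h0 := key.norm_left.tendsto_div_nhds_zero
    refine h0.congr' ?_
    filter_upwards [eventually_ge_atTop 1] with J hJ
    have hJ0 : (J : ℝ) ≠ 0 := by positivity
    unfold birkhoff
    rw [Finset.sum_sub_distrib, Finset.sum_const, Finset.card_range, ← Nat.cast_smul_eq_nsmul ℝ]
    have : (J : ℝ)⁻¹ • ∑ j ∈ Finset.range J, F (S.T^[j] (x χ)) - α = (J : ℝ)⁻¹ •
        (∑ j ∈ Finset.range J, F (S.T^[j] (x χ)) - (J : ℝ) • α) := by
      rw [smul_sub, smul_smul, inv_mul_cancel₀ hJ0, one_smul]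
    rw [this, norm_smul, norm_inv, Real.norm_natCast]
    ring
  refine le_trans (dim_lower hN1 x (C := Real.exp (C + s * n * G) * (δ ^ s)⁻¹) hs ?_)
    (dimH_mono hsub)
  intro χ χ'
  by_cases hne : χ = χ'
  · subst hne; simp; positivity
  obtain ⟨i0, hi0⟩ := Function.ne_iff.1 hne
  classical
  have hex : ∃ i, χ i ≠ χ' i := ⟨i0, hi0⟩
  obtain ⟨i, hi, hmin⟩ : ∃ i, χ i ≠ χ' i ∧ ∀ a < i, χ a = χ' a :=
    ⟨Nat.find hex, Nat.find_spec hex, fun a ha => not_not.1 (Nat.find_min hex ha)⟩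
  have hgi : gg χ i ≠ gg χ' i := fun h =>
    hi (W.equivFin.symm.injective (Subtype.ext h))
  obtain ⟨t, ht, hct, hsep⟩ := S.sep (hn := hn') hv (g := gg χ) (g' := gg χ') (L := L)
    (fun a => hW _ (W.equivFin.symm (χ a)).2) hl hq1 hG0 hG hδ
    (fun a ha => by simp only [hgg, hmin a ha]) hgi (hx χ) (hx χ')
  have hCt := hC t ht
  rw [hct] at hCt
  set Sg := ∑ t' ∈ Finset.range t, (if Fr q t' then 0 else v ((Nat.sqrt t' + 1) ^ 2 - t')) with hSg
  set D := L * i + n * Sg + n * G with hD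
  have h1 := Real.abs_ofDigits_sub_ofDigits_le (x := χ) (y := χ') (n := i) hmin
  have h2 : ((N : ℝ) ^ i)⁻¹ = Real.exp (-(i * Real.log N)) := by
    rw [Real.exp_neg, mul_comm, ← Real.rpow_def_of_pos (by positivity), Real.rpow_natCast]
  have h3 : -(i * Real.log N) ≤ C + s * n * G - s * D := by
    have h4 : (i : ℝ) * (s * L + 1) ≤ i * Real.log N := by gcongr
    rw [hD]
    nlinarith
  have h5 : δ ^ s ≤ Real.exp (s * D) * |x χ - x χ'| ^ s := by
    have := Real.rpow_le_rpow hδ0.le hsep hs.le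
    rwa [Real.mul_rpow (Real.exp_pos _).le (abs_nonneg _), ← Real.exp_mul, mul_comm D s] at this
  have h6 : 0 < δ ^ s := Real.rpow_pos_of_pos hδ0 s
  calc |Real.ofDigits χ - Real.ofDigits χ'| ≤ Real.exp (C + s * n * G - s * D) := by
        refine h1.trans ?_
        rw [h2]; exact Real.exp_le_exp.2 h3
    _ = Real.exp (C + s * n * G) * (δ ^ s)⁻¹ * (δ ^ s * Real.exp (-(s * D))) := by
        rw [sub_eq_add_neg, Real.exp_add]
        field_simp
    _ ≤ Real.exp (C + s * n * G) * (δ ^ s)⁻¹ * |x χ - x χ'| ^ s := by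
        gcongr
        rw [Real.exp_neg, ← div_eq_mul_inv, div_le_iff₀ (Real.exp_pos _), mul_comm]
        exact h5

end PCSystem

/-- **Theorem 2, second part (Statement 2).** Under the dimension-approximation
assumption, for every `α` in the convex hull `A` of the values of `F` at the
parabolic fixed points, `dim_H Λ_α = dim_H Λ`. -/
theorem statement2 {m d : ℕ} (S : PCSystem m)
    (F : ℝ → EuclideanSpace ℝ (Fin d)) (hF : ContinuousOn F S.attractor)
    (hdim : ∀ ε : ℝ, 0 < ε → ∃ ν ∈ S.invMeasures, 0 < S.lyap ν ∧
      (dimH S.attractor).toReal - ε < metricEntropy S.T ν / S.lyap ν)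
    (α : EuclideanSpace ℝ (Fin d))
    (hαA : α ∈ convexHull ℝ (F '' S.parabolicSet)) :
    dimH (S.levelSet F α) = dimH S.attractor := by
  refine le_antisymm (dimH_mono fun x hx => hx.1) ?_
  refine le_of_forall_lt fun c hc => ?_
  have hcT : c ≠ ⊤ := hc.ne_top
  have hc' : c.toReal < (dimH S.attractor).toReal :=
    (ENNReal.toReal_lt_toReal hcT (Real.dimH_ne_top _)).2 hc
  obtain ⟨s, hs1, hs2⟩ := exists_between hc'
  have hs0 : 0 < s := ENNReal.toReal_nonneg.trans_lt hs1
  obtain ⟨ν, hν, hl, hh⟩ := hdim ((dimH S.attractor).toReal - s) (by linarith)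
  rw [sub_sub_cancel] at hh
  obtain ⟨n, hn, L, hL, W, hW, hN⟩ := S.exists_words hν hs0.le hl hh
  refine lt_of_lt_of_le ?_ (S.lower hF hαA hs0 hn hL W hW hN)
  exact (ENNReal.lt_ofReal_iff_toReal_lt hcT).2 hs1
end
end

section
/- Let X_1, X_2 be compact metric spaces, T_i: X_i → X_i continuous, and Π: X_1 → X_2 a continuous surjection with Π∘T_1 = T_2∘Π. Then the pushforward map Π_*: M(X_1,T_1) → M(X_2,T_2) is surjective. If in addition there is an integer m > 0 such that Π^{-1}(y) has at most m elements for each y ∈ X_2, then h(μ,T_1) = h(Π_*μ,T_2) for every μ ∈ M(X_1,T_1). -/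
open MeasureTheory Set Filter Topology

noncomputable section

lemma aux_lift {X₁ X₂ : Type*}
    [MetricSpace X₁] [CompactSpace X₁] [MeasurableSpace X₁] [BorelSpace X₁]
    [MetricSpace X₂] [CompactSpace X₂] [MeasurableSpace X₂] [BorelSpace X₂]
    (π : X₁ → X₂) (hπ : Continuous π) (hπsurj : Function.Surjective π)
    (ν : ProbabilityMeasure X₂) :
    ∃ μ : ProbabilityMeasure X₁, μ.map hπ.measurable.aemeasurable = ν := by
  have hne : Nonempty X₂ := ν.nonempty
  obtain ⟨y₀⟩ := hne
  let φ : ℕ → SimpleFunc X₂ X₂ := fun n => SimpleFunc.approxOn id measurable_id univ y₀ (mem_univ _) n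
  have hφ : ∀ y, Tendsto (fun n => φ n y) atTop (𝓝 y) := fun y =>
    SimpleFunc.tendsto_approxOn measurable_id (mem_univ _) (by simp)
  let s : ℕ → SimpleFunc X₂ X₁ := fun n => (φ n).map (Function.surjInv hπsurj)
  have hs : ∀ n y, π (s n y) = φ n y := fun n y => by
    simp [s, Function.surjInv_eq]
  let u : ℕ → ProbabilityMeasure X₁ := fun n => ν.map (s n).measurable.aemeasurable
  let U : Ultrafilter ℕ := hyperfilter ℕ
  have hU : (U : Filter ℕ) ≤ atTop := Nat.hyperfilter_le_atTop
  obtain ⟨μ, hμ⟩ : ∃ μ, Tendsto u U (𝓝 μ) := ⟨_, (U.map u).le_nhds_lim⟩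
  refine ⟨μ, ?_⟩
  have h1 := (ProbabilityMeasure.continuous_map hπ).tendsto μ |>.comp hμ
  have h2 : Tendsto (fun n => (u n).map hπ.measurable.aemeasurable) atTop (𝓝 ν) := by
    have h3 := tendstoInDistribution_of_ae_tendsto (μ' := (ν : Measure X₂)) (l := atTop)
      (X := fun n => (φ n : X₂ → X₂)) (Z := id)
      (fun n => (φ n).measurable.aemeasurable) aemeasurable_id (Eventually.of_forall hφ)
    have h4 := h3.tendsto
    have e1 : ∀ n, (u n).map hπ.measurable.aemeasurable =
        ν.map (φ n).measurable.aemeasurable := by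
      intro n
      apply Subtype.ext
      change Measure.map π (Measure.map (s n) (ν : Measure X₂)) = Measure.map (φ n) (ν : Measure X₂)
      rw [Measure.map_map hπ.measurable (s n).measurable]
      congr 1
      funext y
      exact hs n y
    have e2 : ν = ν.map (f := id) aemeasurable_id := by
      apply Subtype.ext
      simp
    have h5 : Tendsto (fun n => ν.map (φ n).measurable.aemeasurable) atTop
      (𝓝 (ν.map (f := id) aemeasurable_id)) := h4
    rw [← e2] at h5
    simpa only [e1] using h5
  exact tendsto_nhds_unique h1 (h2.mono_left hU)

lemma aux_KB {X₁ X₂ : Type*}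
    [MetricSpace X₁] [CompactSpace X₁] [MeasurableSpace X₁] [BorelSpace X₁]
    [MetricSpace X₂] [CompactSpace X₂] [MeasurableSpace X₂] [BorelSpace X₂]
    (T₁ : X₁ → X₁) (T₂ : X₂ → X₂) (hT₁ : Continuous T₁) (hT₂ : Continuous T₂)
    (π : X₁ → X₂) (hπ : Continuous π) 
    (hcomm : π ∘ T₁ = T₂ ∘ π) (ν : Measure X₂) [IsProbabilityMeasure ν] (hν : ν.map T₂ = ν)
    (μ : Measure X₁) [IsProbabilityMeasure μ] (hμ : μ.map π = ν) :
    ∃ μ₁ : Measure X₁, IsProbabilityMeasure μ₁ ∧ μ₁.map T₁ = μ₁ ∧ μ₁.map π = ν := by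
  have hit : ∀ j, Measurable (T₁^[j]) := fun j => (hT₁.iterate j).measurable
  have hpush : ∀ j, (μ.map T₁^[j]).map π = ν := by
    intro j
    rw [Measure.map_map hπ.measurable (hit j)]
    have hc : π ∘ T₁^[j] = T₂^[j] ∘ π := by
      have : Function.Semiconj π T₁ T₂ := fun x => congrFun hcomm x
      funext x
      exact (this.iterate_right j) x
    rw [hc, ← Measure.map_map (hT₂.iterate j).measurable hπ.measurable, hμ]
    exact ((MeasurePreserving.mk hT₂.measurable hν).iterate j).map_eq
  have hprob : ∀ j, IsProbabilityMeasure (μ.map T₁^[j]) := fun j =>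
    Measure.isProbabilityMeasure_map (hit j).aemeasurable
  let a : ℕ → Measure X₁ := fun n => ((n + 1 : ℕ) : ENNReal)⁻¹ • ∑ j ∈ Finset.range (n+1), μ.map T₁^[j]
  have hinv : ∀ n : ℕ, ((n + 1 : ℕ) : ENNReal)⁻¹ * ((n + 1 : ℕ) : ENNReal) = 1 := fun n =>
    ENNReal.inv_mul_cancel (by simp) (by simp)
  have ha : ∀ n, IsProbabilityMeasure (a n) := fun n => ⟨by
    simp only [a, Measure.smul_apply, Measure.finsetSum_apply, measure_univ, smul_eq_mul]
    simpa using hinv n⟩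
  have haπ : ∀ n, (a n).map π = ν := by
    intro n
    ext t ht
    rw [Measure.map_apply hπ.measurable ht]
    simp only [a, Measure.smul_apply, Measure.finsetSum_apply, smul_eq_mul]
    have : ∀ j ∈ Finset.range (n+1), (μ.map T₁^[j]) (π ⁻¹' t) = ν t := by
      intro j _
      rw [← Measure.map_apply hπ.measurable ht, hpush]
    rw [Finset.sum_congr rfl this, Finset.sum_const, Finset.card_range, nsmul_eq_mul, ← mul_assoc,
      hinv, one_mul]
  let u : ℕ → ProbabilityMeasure X₁ := fun n => ⟨a n, ha n⟩
  let U : Ultrafilter ℕ := hyperfilter ℕ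
  have hU : (U : Filter ℕ) ≤ atTop := Nat.hyperfilter_le_atTop
  obtain ⟨m, hm⟩ : ∃ m, Tendsto u U (𝓝 m) := 
    haveI : Nonempty (ProbabilityMeasure X₁) := ⟨u 0⟩
    ⟨_, (U.map u).le_nhds_lim⟩
  refine ⟨m, inferInstance, ?_, ?_⟩
  · apply ext_of_forall_integral_eq_of_IsFiniteMeasure
    intro f
    have h1 := (ProbabilityMeasure.tendsto_iff_forall_integral_tendsto.1 hm) f
    have h2 := (ProbabilityMeasure.tendsto_iff_forall_integral_tendsto.1 hm) 
      (f.compContinuous ⟨T₁, hT₁⟩)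
    rw [integral_map hT₁.measurable.aemeasurable f.continuous.aestronglyMeasurable]
    have hint : ∀ (g : BoundedContinuousFunction X₁ ℝ) n, ∫ x, g x ∂(u n : Measure X₁) =
        ((n:ℝ)+1)⁻¹ * ∑ j ∈ Finset.range (n+1), ∫ x, g (T₁^[j] x) ∂μ := by
      intro g n
      change ∫ x, g x ∂(a n) = _
      simp only [a]
      rw [integral_smul_measure, integral_finsetSum_measure]
      · simp only [smul_eq_mul]
        congr 1
        · simp
          norm_cast
        · apply Finset.sum_congr rfl
          intro j _
          rw [integral_map (hit j).aemeasurable g.continuous.aestronglyMeasurable]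
      · intro j _
        exact g.integrable _
    have hdiff : Tendsto (fun n => ∫ x, (f.compContinuous ⟨T₁, hT₁⟩) x ∂(u n : Measure X₁) -
        ∫ x, f x ∂(u n : Measure X₁)) atTop (𝓝 0) := by
      have hb : Tendsto (fun n : ℕ => (2 * ‖f‖) * (1 / ((n:ℝ)+1))) atTop (𝓝 0) := by
        simpa using tendsto_one_div_add_atTop_nhds_zero_nat.const_mul (2 * ‖f‖)
      apply squeeze_zero_norm _ hb
      intro n
      rw [hint, hint, ← mul_sub, ← Finset.sum_sub_distrib]
      have : ∀ j ∈ Finset.range (n+1), (∫ x, (f.compContinuous ⟨T₁, hT₁⟩) (T₁^[j] x) ∂μ - ∫ x, f (T₁^[j] x) ∂μ)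
        = (fun i => ∫ x, f (T₁^[i] x) ∂μ) (j+1) - (fun i => ∫ x, f (T₁^[i] x) ∂μ) j := by
        intro j _
        simp [Function.iterate_succ_apply']
      rw [Finset.sum_congr rfl this, Finset.sum_range_sub (fun i => ∫ x, f (T₁^[i] x) ∂μ), norm_mul, mul_comm]
      have hle : ∀ i, ‖∫ x, f (T₁^[i] x) ∂μ‖ ≤ ‖f‖ := by
        intro i
        have := norm_integral_le_of_norm_le_const (μ := μ) (f := fun x => f (T₁^[i] x)) (C := ‖f‖)
          (Eventually.of_forall fun x => f.norm_coe_le_norm _)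
        simpa using this
      have h3 : ‖((n:ℝ)+1)⁻¹‖ = 1 / ((n:ℝ)+1) := by
        rw [Real.norm_of_nonneg (by positivity), one_div]
      rw [h3]
      apply mul_le_mul_of_nonneg_right _ (by positivity)
      refine (norm_sub_le _ _).trans ?_
      have := hle (n+1)
      have := hle 0
      linarith [hle (n+1), hle 0]
    have h5 := (h2.sub h1)
    have h6 := tendsto_nhds_unique h5 (hdiff.mono_left hU)
    have := sub_eq_zero.1 h6
    simpa using this
  · have h1 := (ProbabilityMeasure.continuous_map hπ).tendsto m |>.comp hm
    have h2 : ((fun μ : ProbabilityMeasure X₁ => μ.map hπ.measurable.aemeasurable) ∘ u) = fun _ => (⟨ν, inferInstance⟩ : ProbabilityMeasure X₂) := by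
      funext n
      apply Subtype.ext
      exact haπ n
    have h3 : m.map hπ.measurable.aemeasurable = (⟨ν, inferInstance⟩ : ProbabilityMeasure X₂) := by
      apply tendsto_nhds_unique h1
      erw [h2]
      exact tendsto_const_nhds
    exact congrArg Subtype.val h3

/-- Shannon entropy of a finite-valued function. -/
def auxH {X ι : Type*} [MeasurableSpace X] [Fintype ι] (μ : Measure X) (f : X → ι) : ℝ :=
  ∑ i, Real.negMulLog (μ.real (f ⁻¹' {i}))

/-- All fibres are measurable. -/
def auxM {X ι : Type*} [MeasurableSpace X] (f : X → ι) : Prop :=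
  ∀ i, MeasurableSet (f ⁻¹' {i})

lemma auxM.prod {X ι κ : Type*} [MeasurableSpace X] {f : X → ι} {g : X → κ}
    (hf : auxM f) (hg : auxM g) : auxM (fun x => (f x, g x)) := by
  rintro ⟨i, j⟩
  have : (fun x => (f x, g x)) ⁻¹' {(i, j)} = f ⁻¹' {i} ∩ g ⁻¹' {j} := by
    ext x; simp
  rw [this]
  exact (hf i).inter (hg j)

lemma auxM.pi {X ι κ : Type*} [MeasurableSpace X] [Finite κ] {f : κ → X → ι}
    (hf : ∀ j, auxM (f j)) : auxM (fun x j => f j x) := by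
  intro c
  have : (fun x j => f j x) ⁻¹' {c} = ⋂ j, f j ⁻¹' {c j} := by
    ext x; simp [funext_iff]
  rw [this]
  exact MeasurableSet.iInter fun j => hf j _

lemma auxM.comp {X Y ι : Type*} [MeasurableSpace X] [MeasurableSpace Y] {f : Y → ι} {T : X → Y}
    (hf : auxM f) (hT : Measurable T) : auxM (fun x => f (T x)) :=
  fun i => hT (hf i)

lemma auxH_nonneg {X ι : Type*} [MeasurableSpace X] [Fintype ι] (μ : Measure X)
    [IsProbabilityMeasure μ] (f : X → ι) : 0 ≤ auxH μ f :=
  Finset.sum_nonneg fun _ _ => Real.negMulLog_nonneg measureReal_nonneg measureReal_le_one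

lemma auxH_comp {X Y ι : Type*} [MeasurableSpace X] [MeasurableSpace Y] [Fintype ι]
    (μ : Measure X) {f : Y → ι} {T : X → Y}
    (hf : auxM f) (hT : Measurable T) : auxH μ (fun x => f (T x)) = auxH (μ.map T) f := by
  unfold auxH
  apply Finset.sum_congr rfl
  intro i _
  rw [map_measureReal_apply hT (hf i)]
  rfl

lemma aux_marg {X κ : Type*} [MeasurableSpace X] [Fintype κ] (μ : Measure X)
    [IsFiniteMeasure μ] {g : X → κ} (hg : auxM g) {A : Set X} (hA : MeasurableSet A) :
    ∑ j, μ.real (A ∩ g ⁻¹' {j}) = μ.real A := by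
  rw [← measureReal_biUnion_finset]
  · congr 1
    ext x; simp
  · intro i _ j _ hij
    refine Set.disjoint_left.2 ?_
    rintro x ⟨_, h1⟩ ⟨_, h2⟩
    simp only [mem_preimage, mem_singleton_iff] at h1 h2
    exact hij (h1.symm.trans h2)
  · exact fun j _ => hA.inter (hg j)

lemma aux_marg_univ {X κ : Type*} [MeasurableSpace X] [Fintype κ] (μ : Measure X)
    [IsProbabilityMeasure μ] {g : X → κ} (hg : auxM g) :
    ∑ j, μ.real (g ⁻¹' {j}) = 1 := by
  have := aux_marg μ hg MeasurableSet.univ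
  simpa using this

lemma aux_gibbs {p q : ℝ} (hp : 0 ≤ p) (hq : 0 ≤ q) (h : q = 0 → p = 0) :
    Real.negMulLog p ≤ -(p * Real.log q) + q - p := by
  rcases hp.eq_or_lt with rfl | hp
  · simpa using hq
  · have hq' : 0 < q := lt_of_le_of_ne hq (fun h' => hp.ne' (h h'.symm))
    have h1 := Real.log_le_sub_one_of_pos (div_pos hq' hp)
    rw [Real.log_div hq'.ne' hp.ne'] at h1
    have h2 := mul_le_mul_of_nonneg_left h1 hp.le
    have h3 : p * (q / p - 1) = q - p := by field_simp
    rw [h3] at h2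
    unfold Real.negMulLog
    linarith

/-- Counting bound for entropy. -/
lemma auxH_le {X ι κ : Type*} [MeasurableSpace X] [Fintype ι] [Fintype κ] (μ : Measure X)
    [IsProbabilityMeasure μ] {f : X → ι} {g : X → κ} (hf : auxM f) (hg : auxM g)
    (C : ℕ) (hC : 0 < C) (S : κ → Finset ι) (hS : ∀ j, (S j).card ≤ C)
    (hfg : ∀ᵐ x ∂μ, f x ∈ S (g x)) : auxH μ f ≤ auxH μ g + Real.log C := by
  classical
  have hC' : (0:ℝ) < C := by exact_mod_cast hC
  set p : ι → κ → ℝ := fun i j => μ.real (f ⁻¹' {i} ∩ g ⁻¹' {j}) with hp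
  set a : ι → ℝ := fun i => μ.real (f ⁻¹' {i}) with ha
  set b : κ → ℝ := fun j => μ.real (g ⁻¹' {j}) with hb
  have hpa : ∀ i, ∑ j, p i j = a i := fun i => aux_marg μ hg (hf i)
  have hpb : ∀ j, ∑ i, p i j = b j := fun j => by
    have := aux_marg μ hf (hg j)
    simp only [hp, hb]
    rw [← this]
    simp only [inter_comm]
  have hp0 : ∀ i j, 0 ≤ p i j := fun i j => measureReal_nonneg
  have hb0 : ∀ j, 0 ≤ b j := fun j => measureReal_nonneg
  have hple : ∀ i j, p i j ≤ a i := fun i j => measureReal_mono inter_subset_left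
  have hplb : ∀ i j, p i j ≤ b j := fun i j => measureReal_mono inter_subset_right
  have hpS : ∀ i j, i ∉ S j → p i j = 0 := by
    intro i j hij
    have : μ (f ⁻¹' {i} ∩ g ⁻¹' {j}) = 0 := by
      refine measure_mono_null ?_ (ae_iff.1 hfg)
      rintro x ⟨h1, h2⟩
      simp only [mem_preimage, mem_singleton_iff] at h1 h2
      simpa [h1, h2] using hij
    simp [hp, measureReal_def, this]
  let q : ι → κ → ℝ := fun i j => if i ∈ S j then b j / C else 0
  have hterm : ∀ i j, -(p i j * Real.log (a i)) ≤ -(p i j * Real.log (b j)) + p i j * Real.log C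
      + q i j - p i j := by
    intro i j
    rcases (hp0 i j).eq_or_lt with h0 | h0
    · rw [← h0]
      have : 0 ≤ q i j := by
        simp only [q]; split_ifs
        · exact div_nonneg (hb0 j) hC'.le
        · exact le_rfl
      simpa using this
    · have hij : i ∈ S j := by
        by_contra h
        exact h0.ne' (hpS i j h)
      have hbj : 0 < b j := h0.trans_le (hplb i j)
      have h1 := aux_gibbs (p := p i j) (q := b j / C) (hp0 i j) (by positivity)
        (fun h => absurd h (by positivity))
      rw [Real.log_div hbj.ne' hC'.ne'] at h1
      have h2 : Real.log (p i j) ≤ Real.log (a i) := Real.log_le_log h0 (hple i j)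
      have h3 := mul_le_mul_of_nonneg_left h2 h0.le
      have hq : q i j = b j / C := by simp [q, hij]
      rw [hq]
      unfold Real.negMulLog at h1
      linarith
  have hq : ∑ i, ∑ j, q i j ≤ 1 := by
    rw [Finset.sum_comm, ← aux_marg_univ μ hg]
    apply Finset.sum_le_sum
    intro j _
    simp only [q, Finset.sum_ite_mem, Finset.univ_inter, Finset.sum_const, nsmul_eq_mul]
    have h1 : ((S j).card : ℝ) ≤ C := by exact_mod_cast hS j
    calc ((S j).card : ℝ) * (b j / C) ≤ C * (b j / C) :=
          mul_le_mul_of_nonneg_right h1 (div_nonneg (hb0 j) hC'.le)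
      _ = b j := by field_simp
  have hpsum : ∑ i, ∑ j, p i j = 1 := by
    simp_rw [hpa]
    exact aux_marg_univ μ hf
  calc auxH μ f = ∑ i, ∑ j, -(p i j * Real.log (a i)) := by
        unfold auxH
        apply Finset.sum_congr rfl
        intro i _
        rw [Finset.sum_neg_distrib, ← Finset.sum_mul, hpa]
        simp [Real.negMulLog, ha]
    _ ≤ ∑ i, ∑ j, (-(p i j * Real.log (b j)) + p i j * Real.log C + q i j - p i j) :=
        Finset.sum_le_sum fun i _ => Finset.sum_le_sum fun j _ => hterm i j
    _ = ∑ j, ∑ i, -(p i j * Real.log (b j)) + (∑ i, ∑ j, p i j) * Real.log C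
          + ∑ i, ∑ j, q i j - ∑ i, ∑ j, p i j := by
        rw [Finset.sum_comm (s := (Finset.univ : Finset κ))]
        simp only [Finset.sum_add_distrib, Finset.sum_sub_distrib, Finset.sum_mul]
    _ ≤ ∑ j, ∑ i, -(p i j * Real.log (b j)) + Real.log C := by
        rw [hpsum]; linarith
    _ = auxH μ g + Real.log C := by
        congr 1
        unfold auxH
        apply Finset.sum_congr rfl
        intro j _
        rw [Finset.sum_neg_distrib, ← Finset.sum_mul, hpb]
        simp [Real.negMulLog, hb]

/-- Entropy decreases under post-composition. -/
lemma auxH_mono {X ι κ : Type*} [MeasurableSpace X] [Fintype ι] [Fintype κ] (μ : Measure X)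
    [IsProbabilityMeasure μ] {f : X → ι} {g : X → κ} (hf : auxM f) (hg : auxM g)
    (φ : κ → ι) (h : ∀ x, f x = φ (g x)) : auxH μ f ≤ auxH μ g := by
  have := auxH_le μ hf hg 1 one_pos (fun j => {φ j}) (by simp)
    (Eventually.of_forall fun x => by simp [h])
  simpa using this

lemma auxH_prod {X ι κ : Type*} [MeasurableSpace X] [Fintype ι] [Fintype κ] (μ : Measure X)
    [IsProbabilityMeasure μ] {f : X → ι} {g : X → κ} (hf : auxM f) (hg : auxM g) :
    auxH μ (fun x => (f x, g x)) ≤ auxH μ f + auxH μ g := by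
  set p : ι → κ → ℝ := fun i j => μ.real (f ⁻¹' {i} ∩ g ⁻¹' {j}) with hp
  set a : ι → ℝ := fun i => μ.real (f ⁻¹' {i}) with ha
  set b : κ → ℝ := fun j => μ.real (g ⁻¹' {j}) with hb
  have hpa : ∀ i, ∑ j, p i j = a i := fun i => aux_marg μ hg (hf i)
  have hpb : ∀ j, ∑ i, p i j = b j := fun j => by
    have := aux_marg μ hf (hg j)
    simp only [hp, hb]
    rw [← this]
    simp only [inter_comm]
  have hp0 : ∀ i j, 0 ≤ p i j := fun i j => measureReal_nonneg
  have hple : ∀ i j, p i j ≤ a i := fun i j => measureReal_mono inter_subset_left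
  have hplb : ∀ i j, p i j ≤ b j := fun i j => measureReal_mono inter_subset_right
  have ha0 : ∀ j, 0 ≤ a j := fun j => measureReal_nonneg
  have hb0 : ∀ j, 0 ≤ b j := fun j => measureReal_nonneg
  have hterm : ∀ i j, Real.negMulLog (p i j) ≤ -(p i j * Real.log (a i)) +
      -(p i j * Real.log (b j)) + a i * b j - p i j := by
    intro i j
    rcases (hp0 i j).eq_or_lt with h0 | h0
    · rw [← h0]
      simpa using mul_nonneg (ha0 i) (hb0 j)
    · have h1 : 0 < a i := h0.trans_le (hple i j)
      have h2 : 0 < b j := h0.trans_le (hplb i j)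
      have h3 := aux_gibbs (p := p i j) (q := a i * b j) h0.le (by positivity)
        (fun h => absurd h (by positivity))
      rw [Real.log_mul h1.ne' h2.ne'] at h3
      linarith
  have hpsum : ∑ i, ∑ j, p i j = 1 := by
    simp_rw [hpa]
    exact aux_marg_univ μ hf
  have hab : ∑ i, ∑ j, a i * b j = 1 := by
    rw [← Finset.sum_mul_sum]
    rw [show ∑ i, a i = 1 from aux_marg_univ μ hf, show ∑ i, b i = 1 from aux_marg_univ μ hg]
    norm_num
  calc auxH μ (fun x => (f x, g x)) = ∑ i, ∑ j, Real.negMulLog (p i j) := by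
        unfold auxH
        rw [Fintype.sum_prod_type]
        apply Finset.sum_congr rfl
        intro i _
        apply Finset.sum_congr rfl
        intro j _
        congr 2
        ext x; simp
    _ ≤ ∑ i, ∑ j, (-(p i j * Real.log (a i)) + -(p i j * Real.log (b j)) + a i * b j - p i j) :=
        Finset.sum_le_sum fun i _ => Finset.sum_le_sum fun j _ => hterm i j
    _ = ∑ i, ∑ j, -(p i j * Real.log (a i)) + ∑ j, ∑ i, -(p i j * Real.log (b j))
          + ∑ i, ∑ j, a i * b j - ∑ i, ∑ j, p i j := by
        rw [Finset.sum_comm (s := (Finset.univ : Finset κ))]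
        simp only [Finset.sum_add_distrib, Finset.sum_sub_distrib]
    _ = ∑ i, ∑ j, -(p i j * Real.log (a i)) + ∑ j, ∑ i, -(p i j * Real.log (b j)) := by
        rw [hpsum, hab]; ring
    _ = auxH μ f + auxH μ g := by
        unfold auxH
        congr 1
        · apply Finset.sum_congr rfl
          intro i _
          rw [Finset.sum_neg_distrib, ← Finset.sum_mul, hpa]
          simp [Real.negMulLog, ha]
        · apply Finset.sum_congr rfl
          intro j _
          rw [Finset.sum_neg_distrib, ← Finset.sum_mul, hpb]
          simp [Real.negMulLog, hb]

/-- The name of length `n`. -/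
def auxName {X ι : Type*} (T : X → X) (f : X → ι) (n : ℕ) (x : X) : Fin n → ι :=
  fun i => f (T^[(i : ℕ)] x)

lemma auxM.name {X ι : Type*} [MeasurableSpace X] {T : X → X} (hT : Measurable T) {f : X → ι}
    (hf : auxM f) (n : ℕ) : auxM (auxName T f n) :=
  auxM.pi (f := fun (i : Fin n) x => f (T^[(i : ℕ)] x)) fun i => hf.comp (hT.iterate i)

lemma auxH_name_add {X ι : Type*} [MeasurableSpace X] [Fintype ι] (μ : Measure X)
    [IsProbabilityMeasure μ] {T : X → X} (hT : Measurable T) (hμ : μ.map T = μ) {f : X → ι}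
    (hf : auxM f) (a b : ℕ) :
    auxH μ (auxName T f (a + b)) ≤ auxH μ (auxName T f a) + auxH μ (auxName T f b) := by
  have h1 : auxH μ (auxName T f b) = auxH μ (fun x => auxName T f b (T^[a] x)) := by
    rw [auxH_comp μ (hf.name hT b) (hT.iterate a)]
    rw [((MeasurePreserving.mk hT hμ).iterate a).map_eq]
  rw [h1]
  have hM := (hf.name hT b).comp (hT.iterate a)
  refine le_trans ?_ (auxH_prod μ (hf.name hT a) hM)
  refine auxH_mono μ (hf.name hT _) ((hf.name hT a).prod hM)
    (fun c => Fin.append c.1 c.2) ?_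
  intro x
  funext i
  refine Fin.addCases (fun i => ?_) (fun i => ?_) i
  · simp [auxName]
  · simp only [auxName, Fin.append_right, Fin.val_natAdd]
    rw [← Function.iterate_add_apply, add_comm]

lemma auxH_name_mul {X ι : Type*} [MeasurableSpace X] [Fintype ι] (μ : Measure X)
    [IsProbabilityMeasure μ] {T : X → X} (hT : Measurable T) (hμ : μ.map T = μ) {f : X → ι}
    (hf : auxM f) (n N : ℕ) :
    auxH μ (auxName T f ((n + 1) * N)) ≤ (n + 1) * auxH μ (auxName T f N) := by
  induction n with
  | zero => rw [zero_add, one_mul]; simp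
  | succ n ih =>
    have h := auxH_name_add μ hT hμ hf ((n+1) * N) N
    have h2 : (n + 1 + 1) * N = (n + 1) * N + N := by ring
    rw [h2]
    push_cast
    linarith

lemma aux_atom {X : Type*} [MeasurableSpace X] {P : Finset (Set X)} (hP : IsMeasPartition P) :
    ∃ f : X → {s // s ∈ P}, ∀ s : {s // s ∈ P}, f ⁻¹' {s} = (s : Set X) := by
  obtain ⟨_, hd, hU⟩ := hP
  have : ∀ x, ∃ s : {s // s ∈ P}, x ∈ (s : Set X) := by
    intro x
    have : x ∈ ⋃ s ∈ P, s := hU ▸ mem_univ x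
    simp only [mem_iUnion] at this
    obtain ⟨s, hs, hx⟩ := this
    exact ⟨⟨s, hs⟩, hx⟩
  choose f hf using this
  refine ⟨f, fun s => ?_⟩
  ext x
  simp only [mem_preimage, mem_singleton_iff]
  constructor
  · rintro rfl; exact hf x
  · intro hx
    apply Subtype.ext
    by_contra hne
    exact Set.disjoint_left.1 (hd (f x).2 s.2 hne) (hf x) hx

lemma aux_part {X : Type*} [MeasurableSpace X] {P : Finset (Set X)} (T : X → X) (μ : Measure X)
    {f : X → {s // s ∈ P}} (hf : ∀ s : {s // s ∈ P}, f ⁻¹' {s} = (s : Set X)) (n : ℕ) :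
    partEntropy T μ P n = auxH μ (auxName T f n) := by
  unfold partEntropy auxH
  apply Finset.sum_congr rfl
  intro c _
  rw [measureReal_def]
  congr 3
  ext x
  simp only [mem_iInter, ← hf, mem_preimage, mem_singleton_iff, auxName, funext_iff]

lemma aux_atomM {X : Type*} [MeasurableSpace X] {P : Finset (Set X)} (hP : IsMeasPartition P)
    {f : X → {s // s ∈ P}} (hf : ∀ s : {s // s ∈ P}, f ⁻¹' {s} = (s : Set X)) : auxM f :=
  fun s => by rw [hf]; exact hP.1 _ s.2

/-- Any finite-valued measurable function induces a partition. -/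
lemma aux_mkPart {X κ : Type*} [MeasurableSpace X] [Fintype κ] {g : X → κ} (hg : auxM g) :
    ∃ Q : Finset (Set X), IsMeasPartition Q ∧ ∀ s ∈ Q, ∃ j, s = g ⁻¹' {j} := by
  classical
  refine ⟨Finset.univ.image (fun j => g ⁻¹' {j}), ⟨?_, ?_, ?_⟩, ?_⟩
  · intro s hs
    simp only [Finset.mem_image, Finset.mem_univ, true_and] at hs
    obtain ⟨j, rfl⟩ := hs
    exact hg j
  · intro s hs t ht hst
    simp only [Finset.coe_image, Finset.coe_univ, image_univ, mem_range] at hs ht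
    obtain ⟨j, rfl⟩ := hs
    obtain ⟨i, rfl⟩ := ht
    refine Set.disjoint_left.2 fun x h1 h2 => hst ?_
    simp only [id, mem_preimage, mem_singleton_iff] at h1 h2
    rw [← h1, ← h2]
  · ext x; simp
  · intro s hs
    simp only [Finset.mem_image, Finset.mem_univ, true_and] at hs
    obtain ⟨j, rfl⟩ := hs
    exact ⟨j, rfl⟩

lemma aux_sigma {X : Type*} [MetricSpace X] [CompactSpace X] [MeasurableSpace X] [BorelSpace X]
    (μ : Measure X) [IsProbabilityMeasure μ] {A : Set X} (hA : MeasurableSet A) :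
    ∃ K : ℕ → Set X, (∀ m, IsCompact (K m)) ∧ (∀ m, K m ⊆ A) ∧ μ (A \ ⋃ m, K m) = 0 := by
  have h : ∀ m : ℕ, ∃ K, K ⊆ A ∧ IsCompact K ∧ μ (A \ K) < ((m : ENNReal) + 1)⁻¹ := fun m =>
    hA.exists_isCompact_sdiff_lt (measure_ne_top _ _) (by simp)
  choose K hKA hK hlt using h
  refine ⟨K, hK, hKA, ?_⟩
  by_contra hne
  obtain ⟨m, hm⟩ := ENNReal.exists_inv_nat_lt hne
  have h1 : μ (A \ ⋃ m, K m) ≤ μ (A \ K m) :=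
    measure_mono (sdiff_subset_sdiff_right (subset_iUnion K m))
  have h2 : ((m : ENNReal) + 1)⁻¹ ≤ (m : ENNReal)⁻¹ := ENNReal.inv_le_inv.2 le_self_add
  exact absurd (hm.trans_le (h1.trans ((hlt m).le.trans h2))) (lt_irrefl _)

/-- The finite-to-one partition of the factor. -/
lemma aux_Q {X₁ X₂ ι : Type*} [Fintype ι]
    [MetricSpace X₁] [CompactSpace X₁] [MeasurableSpace X₁] [BorelSpace X₁]
    [MetricSpace X₂] [MeasurableSpace X₂] [BorelSpace X₂]
    (π : X₁ → X₂) (hπ : Continuous π) (k : ℕ)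
    (hk : ∀ y : X₂, (π ⁻¹' {y}).Finite ∧ (π ⁻¹' {y}).ncard ≤ k)
    (μ : Measure X₁) [IsProbabilityMeasure μ] {F : X₁ → ι} (hF : auxM F) :
    ∃ g : X₂ → Finset ι, auxM g ∧ (∀ y, (g y).card ≤ k) ∧ ∀ᵐ x ∂μ, F x ∈ g (π x) := by
  classical
  choose K hK hKF hK0 using fun i => aux_sigma μ (hF i)
  let B : ι → Set X₂ := fun i => ⋃ m, π '' (K i m)
  have hB : ∀ i, MeasurableSet (B i) := fun i =>
    MeasurableSet.iUnion fun m => ((hK i m).image hπ).measurableSet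
  let g : X₂ → Finset ι := fun y => Finset.univ.filter fun i => y ∈ B i
  refine ⟨g, ?_, ?_, ?_⟩
  · intro S
    have : g ⁻¹' {S} = ⋂ i, {y | y ∈ B i ↔ i ∈ S} := by
      ext y
      simp [g, Finset.ext_iff]
    rw [this]
    refine MeasurableSet.iInter fun i => ?_
    by_cases hi : i ∈ S
    · simpa [hi] using hB i
    · have e : {y | y ∈ B i ↔ i ∈ S} = (B i)ᶜ := by
        ext y
        simp [hi]
      rw [e]
      exact (hB i).compl
  · intro y
    refine le_trans ?_ (hk y).2
    have hsub : (g y : Set ι) ⊆ F '' (π ⁻¹' {y}) := by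
      intro i hi
      simp only [g, B, Finset.coe_filter, Finset.mem_univ, true_and, mem_ofPred_eq, mem_iUnion,
        mem_image] at hi
      obtain ⟨m, x, hx, rfl⟩ := hi
      exact ⟨x, rfl, hKF i m hx⟩
    rw [← Set.ncard_coe_finset]
    exact (Set.ncard_le_ncard hsub ((hk y).1.image F)).trans (Set.ncard_image_le (hk y).1)
  · have : ∀ᵐ x ∂μ, ∀ i, x ∉ F ⁻¹' {i} \ ⋃ m, K i m :=
      ae_all_iff.2 fun i => measure_eq_zero_iff_ae_notMem.1 (hK0 i)
    filter_upwards [this] with x hx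
    have h := hx (F x)
    simp only [Set.mem_sdiff, mem_preimage, mem_singleton_iff, true_and, not_not, mem_iUnion] at h
    obtain ⟨m, hm⟩ := h
    simp only [g, B, Finset.mem_filter, Finset.mem_univ, true_and, mem_iUnion]
    exact ⟨m, x, hm, rfl⟩

/-- The entropy of a partition. -/
def auxh {X : Type*} [MeasurableSpace X] (T : X → X) (μ : Measure X)
    (P : Finset (Set X)) : ℝ := ⨅ n : ℕ, partEntropy T μ P (n + 1) / (n + 1)

lemma aux_bdd {X : Type*} [MeasurableSpace X] (T : X → X) (μ : Measure X)
    [IsProbabilityMeasure μ] {P : Finset (Set X)} (hP : IsMeasPartition P) :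
    BddBelow (range fun n : ℕ => partEntropy T μ P (n + 1) / (n + 1)) := by
  obtain ⟨f, hf⟩ := aux_atom hP
  refine ⟨0, ?_⟩
  rintro _ ⟨n, rfl⟩
  simp only
  rw [aux_part T μ hf]
  exact div_nonneg (auxH_nonneg _ _) (by positivity)

lemma aux_main {X₁ X₂ : Type*}
    [MetricSpace X₁] [CompactSpace X₁] [MeasurableSpace X₁] [BorelSpace X₁]
    [MetricSpace X₂] [CompactSpace X₂] [MeasurableSpace X₂] [BorelSpace X₂]
    (T₁ : X₁ → X₁) (T₂ : X₂ → X₂) (hT₁ : Continuous T₁) (hT₂ : Continuous T₂)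
    (π : X₁ → X₂) (hπ : Continuous π) 
    (hsc : ∀ j x, π (T₁^[j] x) = T₂^[j] (π x)) (k : ℕ) (hk0 : 0 < k)
    (hk : ∀ y : X₂, (π ⁻¹' {y}).Finite ∧ (π ⁻¹' {y}).ncard ≤ k)
    (μ : Measure X₁) [IsProbabilityMeasure μ] (hμ : μ.map T₁ = μ)
    (hν : (μ.map π).map T₂ = μ.map π) {P : Finset (Set X₁)} (hP : IsMeasPartition P) (n : ℕ) :
    ∃ Q : Finset (Set X₂), IsMeasPartition Q ∧
      auxh T₁ μ P ≤ auxh T₂ (μ.map π) Q + Real.log k / (n + 1) := by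
  classical
  have : IsProbabilityMeasure (μ.map π) := Measure.isProbabilityMeasure_map hπ.aemeasurable
  have mT₁ := hT₁.measurable
  have mT₂ := hT₂.measurable
  have mπ := hπ.measurable
  obtain ⟨f, hf⟩ := aux_atom hP
  have hfM := aux_atomM hP hf
  have hFM := hfM.name mT₁ (n + 1)
  obtain ⟨g, hgM, hgk, hgF⟩ := aux_Q π hπ k hk μ hFM
  obtain ⟨Q, hQ, hQg⟩ := aux_mkPart hgM
  obtain ⟨q, hq⟩ := aux_atom hQ
  have hqM := aux_atomM hQ hq
  refine ⟨Q, hQ, ?_⟩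
  -- allowed names
  have hal : ∀ s : {s // s ∈ Q}, ∃ A : Finset (Fin (n+1) → {s // s ∈ P}), A.card ≤ k ∧
      ∀ y, q y = s → g y ⊆ A := by
    intro s
    by_cases hs : (s : Set X₂).Nonempty
    · obtain ⟨y, hy⟩ := hs
      refine ⟨g y, hgk y, fun z hz => ?_⟩
      have hz' : z ∈ (s : Set X₂) := by rw [← hq]; exact hz
      obtain ⟨j, hj⟩ := hQg s s.2
      rw [hj] at hy hz'
      simp only [mem_preimage, mem_singleton_iff] at hy hz'
      rw [hy, hz']
    · refine ⟨∅, by simp, fun z hz => ?_⟩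
      exact absurd ⟨z, by rw [← hq]; exact hz⟩ hs
  choose A hAk hA using hal
  have key : ∀ N : ℕ, auxH μ (auxName T₁ f ((n+1) * (N+1))) ≤
      (n+1) * auxH (μ.map π) (auxName T₂ q (N+1)) + (N+1) * Real.log k := by
    intro N
    let G : X₁ → Fin (N+1) → (Fin (n+1) → {s // s ∈ P}) := fun x l =>
      auxName T₁ f (n+1) (T₁^[(n+1) * (l : ℕ)] x)
    have hGM : auxM G := auxM.pi (f := fun (l : Fin (N+1)) x =>
      auxName T₁ f (n+1) (T₁^[(n+1) * (l : ℕ)] x)) fun l => hFM.comp (mT₁.iterate _)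
    have h1 : auxH μ (auxName T₁ f ((n+1) * (N+1))) ≤ auxH μ G := by
      refine auxH_mono μ (hfM.name mT₁ _) hGM
        (fun c i => c ⟨(i : ℕ) / (n+1), Nat.div_lt_of_lt_mul i.2⟩
          ⟨(i : ℕ) % (n+1), Nat.mod_lt _ (Nat.succ_pos n)⟩) ?_
      intro x
      funext i
      simp only [G, auxName]
      rw [← Function.iterate_add_apply, Nat.mod_add_div]
    have hqN := hqM.name mT₂ ((n+1) * (N+1))
    have h2 : auxH μ G ≤ auxH μ (fun x => auxName T₂ q ((n+1) * (N+1)) (π x)) +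
        Real.log ((k ^ (N+1) : ℕ) : ℝ) := by
      refine auxH_le μ hGM (hqN.comp mπ) (k ^ (N+1)) (pow_pos hk0 _)
        (fun c => Fintype.piFinset fun l : Fin (N+1) => A (c ⟨(n+1) * (l : ℕ),
          Nat.mul_lt_mul_of_pos_left l.2 (Nat.succ_pos n)⟩)) ?_ ?_
      · intro c
        rw [Fintype.card_piFinset]
        refine (Finset.prod_le_pow_card _ _ k fun l _ => hAk _).trans ?_
        simp
      · have : ∀ᵐ x ∂μ, ∀ l : Fin (N+1),
            auxName T₁ f (n+1) (T₁^[(n+1) * (l : ℕ)] x) ∈ g (π (T₁^[(n+1) * (l : ℕ)] x)) :=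
          ae_all_iff.2 fun l =>
            ((MeasurePreserving.mk mT₁ hμ).iterate _).quasiMeasurePreserving.ae hgF
        filter_upwards [this] with x hx
        rw [Fintype.mem_piFinset]
        intro l
        refine hA _ (π (T₁^[(n+1) * (l : ℕ)] x)) ?_ (hx l)
        simp only [auxName]
        rw [hsc]
    rw [auxH_comp μ hqN mπ] at h2
    have h3 := auxH_name_mul (μ.map π) mT₂ hν hqM n (N+1)
    have h4 : Real.log ((k ^ (N+1) : ℕ) : ℝ) = (N+1) * Real.log k := by
      push_cast
      rw [Real.log_pow]
      push_cast
      rfl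
    rw [h4] at h2
    linarith
  rw [← sub_le_iff_le_add]
  refine le_ciInf fun N => ?_
  rw [sub_le_iff_le_add, aux_part T₂ _ hq]
  refine (ciInf_le (aux_bdd T₁ μ hP) ((n+1) * (N+1) - 1)).trans ?_
  have hpos : 1 ≤ (n+1) * (N+1) := Nat.mul_pos (Nat.succ_pos _) (Nat.succ_pos _)
  have e : (n+1) * (N+1) - 1 + 1 = (n+1) * (N+1) := Nat.sub_add_cancel hpos
  have e2 : (((n+1) * (N+1) - 1 : ℕ) : ℝ) + 1 = ((n:ℝ)+1) * ((N:ℝ)+1) := by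
    exact_mod_cast e
  rw [e2, e, aux_part T₁ μ hf]
  have hn : (0:ℝ) < (n:ℝ) + 1 := by positivity
  have hN : (0:ℝ) < (N:ℝ) + 1 := by positivity
  rw [div_le_iff₀ (by positivity)]
  refine (key N).trans (le_of_eq ?_)
  field_simp

lemma aux_pull {X₁ X₂ : Type*}
    [MetricSpace X₁] [CompactSpace X₁] [MeasurableSpace X₁] [BorelSpace X₁]
    [MetricSpace X₂] [CompactSpace X₂] [MeasurableSpace X₂] [BorelSpace X₂]
    (T₁ : X₁ → X₁) (T₂ : X₂ → X₂) (hT₁ : Continuous T₁) (hT₂ : Continuous T₂)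
    (π : X₁ → X₂) (hπ : Continuous π) 
    (hsc : ∀ j x, π (T₁^[j] x) = T₂^[j] (π x))
    (μ : Measure X₁) [IsProbabilityMeasure μ] {Q : Finset (Set X₂)} (hQ : IsMeasPartition Q) :
    ∃ P : Finset (Set X₁), IsMeasPartition P ∧ auxh T₁ μ P = auxh T₂ (μ.map π) Q := by
  classical
  have : IsProbabilityMeasure (μ.map π) := Measure.isProbabilityMeasure_map hπ.aemeasurable
  have mT₁ := hT₁.measurable
  have mT₂ := hT₂.measurable
  have mπ := hπ.measurable
  obtain ⟨q, hq⟩ := aux_atom hQ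
  have hqM := aux_atomM hQ hq
  have hqπ : auxM (fun x => q (π x)) := hqM.comp mπ
  obtain ⟨P, hP, hPq⟩ := aux_mkPart hqπ
  obtain ⟨p, hp⟩ := aux_atom hP
  have hpM := aux_atomM hP hp
  refine ⟨P, hP, ?_⟩
  choose J hJ using hPq
  have hqp : ∀ x, q (π x) = J (p x) (p x).2 := by
    intro x
    have h1 : x ∈ p ⁻¹' {p x} := rfl
    rw [hp, hJ (p x) (p x).2] at h1
    exact h1
  have hpq : ∃ φ : {s // s ∈ Q} → {s // s ∈ P}, ∀ x, p x = φ (q (π x)) := by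
    have : Function.FactorsThrough p (fun x => q (π x)) := by
      intro x y hxy
      have h1 : y ∈ p ⁻¹' {p x} := by
        rw [hp, hJ (p x) (p x).2]
        change q (π y) = _
        rw [← hqp]
        exact hxy.symm
      exact h1.symm
    by_cases hne : Nonempty {s // s ∈ P}
    · obtain ⟨s0⟩ := hne
      refine ⟨Function.extend (fun x => q (π x)) p (fun _ => s0), fun x => ?_⟩
      rw [this.extend_apply]
    · obtain ⟨x0⟩ := nonempty_of_isProbabilityMeasure μ
      exact absurd ⟨p x0⟩ hne
  obtain ⟨φ, hφ⟩ := hpq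
  unfold auxh
  congr 1
  funext n
  congr 1
  rw [aux_part T₁ μ hp, aux_part T₂ _ hq, ← auxH_comp μ (hqM.name mT₂ (n+1)) mπ]
  apply le_antisymm
  · refine auxH_mono μ (hpM.name mT₁ _) ((hqM.name mT₂ (n+1)).comp mπ) (fun c i => φ (c i)) ?_
    intro x
    funext i
    simp only [auxName]
    rw [hφ, hsc]
  · refine auxH_mono μ ((hqM.name mT₂ (n+1)).comp mπ) (hpM.name mT₁ _)
      (fun c i => J (c i) (c i).2) ?_
    intro x
    funext i
    simp only [auxName]
    rw [← hsc, hqp]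

lemma aux_entropy {X₁ X₂ : Type*}
    [MetricSpace X₁] [CompactSpace X₁] [MeasurableSpace X₁] [BorelSpace X₁]
    [MetricSpace X₂] [CompactSpace X₂] [MeasurableSpace X₂] [BorelSpace X₂]
    (T₁ : X₁ → X₁) (T₂ : X₂ → X₂) (hT₁ : Continuous T₁) (hT₂ : Continuous T₂)
    (π : X₁ → X₂) (hπ : Continuous π) 
    (hcomm : π ∘ T₁ = T₂ ∘ π) (k : ℕ) (hk0 : 0 < k)
    (hk : ∀ y : X₂, (π ⁻¹' {y}).Finite ∧ (π ⁻¹' {y}).ncard ≤ k)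
    (μ : Measure X₁) [IsProbabilityMeasure μ] (hμ : μ.map T₁ = μ) :
    metricEntropy T₁ μ = metricEntropy T₂ (μ.map π) := by
  have hsc : ∀ j x, π (T₁^[j] x) = T₂^[j] (π x) := fun j x =>
    (Function.Semiconj.iterate_right (f := π) (fun x => congrFun hcomm x) j) x
  have hν : (μ.map π).map T₂ = μ.map π := by
    rw [Measure.map_map hT₂.measurable hπ.measurable, ← hcomm,
      ← Measure.map_map hπ.measurable hT₁.measurable, hμ]
  change (⨆ P : {P : Finset (Set X₁) // IsMeasPartition P}, auxh T₁ μ P) =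
    ⨆ Q : {Q : Finset (Set X₂) // IsMeasPartition Q}, auxh T₂ (μ.map π) Q
  have hne1 : Nonempty {P : Finset (Set X₁) // IsMeasPartition P} :=
    ⟨{univ}, by intro s hs; simp_all, by simp, by simp⟩
  have hne2 : Nonempty {P : Finset (Set X₂) // IsMeasPartition P} :=
    ⟨{univ}, by intro s hs; simp_all, by simp, by simp⟩
  by_cases hb : BddAbove (range fun Q : {Q : Finset (Set X₂) // IsMeasPartition Q} =>
      auxh T₂ (μ.map π) Q)
  · have hle : ∀ P : {P : Finset (Set X₁) // IsMeasPartition P}, auxh T₁ μ P ≤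
        ⨆ Q : {Q : Finset (Set X₂) // IsMeasPartition Q}, auxh T₂ (μ.map π) Q := by
      rintro ⟨P, hP⟩
      have h1 : ∀ n : ℕ, auxh T₁ μ P ≤
          (⨆ Q : {Q : Finset (Set X₂) // IsMeasPartition Q}, auxh T₂ (μ.map π) Q) +
          Real.log k * (1 / ((n:ℝ) + 1)) := by
        intro n
        obtain ⟨Q, hQ, h⟩ := aux_main T₁ T₂ hT₁ hT₂ π hπ hsc k hk0 hk μ hμ hν hP n
        have h2 := le_ciSup hb ⟨Q, hQ⟩
        simp only at h2
        rw [mul_one_div]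
        linarith
      have h2 : Tendsto (fun n : ℕ =>
          (⨆ Q : {Q : Finset (Set X₂) // IsMeasPartition Q}, auxh T₂ (μ.map π) Q) +
          Real.log k * (1 / ((n:ℝ) + 1))) atTop (𝓝
          (⨆ Q : {Q : Finset (Set X₂) // IsMeasPartition Q}, auxh T₂ (μ.map π) Q)) := by
        simpa using (tendsto_one_div_add_atTop_nhds_zero_nat.const_mul (Real.log k)).const_add
          (⨆ Q : {Q : Finset (Set X₂) // IsMeasPartition Q}, auxh T₂ (μ.map π) Q)
      exact ge_of_tendsto' h2 h1
    apply le_antisymm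
    · exact ciSup_le hle
    · refine ciSup_le ?_
      rintro ⟨Q, hQ⟩
      obtain ⟨P, hP, h⟩ := aux_pull T₁ T₂ hT₁ hT₂ π hπ hsc μ hQ
      simp only
      rw [← h]
      refine le_ciSup (f := fun P : {P : Finset (Set X₁) // IsMeasPartition P} => auxh T₁ μ P)
        ⟨⨆ Q : {Q : Finset (Set X₂) // IsMeasPartition Q}, auxh T₂ (μ.map π) Q, ?_⟩ ⟨P, hP⟩
      rintro _ ⟨P, rfl⟩
      exact hle P
  · have hb1 : ¬ BddAbove (range fun P : {P : Finset (Set X₁) // IsMeasPartition P} =>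
      auxh T₁ μ P) := by
      intro h
      apply hb
      refine h.mono ?_
      rintro _ ⟨⟨Q, hQ⟩, rfl⟩
      obtain ⟨P, hP, h⟩ := aux_pull T₁ T₂ hT₁ hT₂ π hπ hsc μ hQ
      exact ⟨⟨P, hP⟩, h⟩
    rw [Real.iSup_of_not_bddAbove hb, Real.iSup_of_not_bddAbove hb1]

/-- **Lemma 8 (Statement 11).** For a continuous factor map `π` between compact
metric dynamical systems, the pushforward on invariant probability measures is
surjective; if moreover the fibres of `π` have at most `k` elements, the metric
entropy is preserved: `h(μ,T₁) = h(π_*μ,T₂)`. -/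
theorem statement11 {X₁ X₂ : Type*}
    [MetricSpace X₁] [CompactSpace X₁] [MeasurableSpace X₁] [BorelSpace X₁]
    [MetricSpace X₂] [CompactSpace X₂] [MeasurableSpace X₂] [BorelSpace X₂]
    (T₁ : X₁ → X₁) (T₂ : X₂ → X₂) (hT₁ : Continuous T₁) (hT₂ : Continuous T₂)
    (π : X₁ → X₂) (hπ : Continuous π) (hπsurj : Function.Surjective π)
    (hcomm : π ∘ T₁ = T₂ ∘ π) :
    (∀ μ₂ : Measure X₂, IsProbabilityMeasure μ₂ → μ₂.map T₂ = μ₂ →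
      ∃ μ₁ : Measure X₁, IsProbabilityMeasure μ₁ ∧ μ₁.map T₁ = μ₁ ∧ μ₁.map π = μ₂) ∧
    ((∃ k : ℕ, 0 < k ∧ ∀ y : X₂, (π ⁻¹' {y}).Finite ∧ (π ⁻¹' {y}).ncard ≤ k) →
      ∀ μ₁ : Measure X₁, IsProbabilityMeasure μ₁ → μ₁.map T₁ = μ₁ →
        metricEntropy T₁ μ₁ = metricEntropy T₂ (μ₁.map π)) := by
  refine ⟨?_, ?_⟩
  · intro μ₂ h₂ hinv
    obtain ⟨μ, hμ⟩ := aux_lift π hπ hπsurj ⟨μ₂, h₂⟩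
    exact aux_KB T₁ T₂ hT₁ hT₂ π hπ hcomm μ₂ hinv μ (congrArg Subtype.val hμ)
  · rintro ⟨k, hk0, hk⟩ μ₁ h₁ hinv
    exact aux_entropy T₁ T₂ hT₁ hT₂ π hπ hcomm k hk0 hk μ₁ hinv
end
end

section
/- Let f: Σ → ℝ^d be continuous and α ∈ ℝ^d. The level set X_α = {ω ∈ Σ : lim_{n→∞} A_n f(ω) = α} is nonempty if and only if α ∈ L_f = {∫ f dμ : μ ∈ M(Σ,σ)}. -/
open MeasureTheory Set Filter Topology

noncomputable section

namespace LevelSetProof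

lemma shift_continuous {m : ℕ} : Continuous (shift : SymbSp m → SymbSp m) :=
  continuous_pi fun n => continuous_apply (n + 1)

lemma shift_iterate_apply {m : ℕ} (ω : SymbSp m) (t i : ℕ) : shift^[t] ω i = ω (t + i) := by
  induction t generalizing ω with
  | zero => simp
  | succ t ih =>
    rw [Function.iterate_succ_apply, ih]
    simp only [shift]
    congr 1
    omega

lemma exists_bound {m : ℕ} {E : Type*} [NormedAddCommGroup E] (f : SymbSp m → E)
    (hf : Continuous f) : ∃ M : ℝ, 0 ≤ M ∧ ∀ x, ‖f x‖ ≤ M := by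
  obtain ⟨M, hM⟩ := isCompact_univ.exists_bound_of_continuousOn (f := f) hf.continuousOn
  exact ⟨max M 0, le_max_right _ _, fun x => (hM x (mem_univ x)).trans (le_max_left _ _)⟩

lemma integrable_of_cont {m : ℕ} {E : Type*} [NormedAddCommGroup E]
    (f : SymbSp m → E) (hf : Continuous f) (μ : Measure (SymbSp m)) [IsFiniteMeasure μ] :
    Integrable f μ :=
  hf.integrable_of_hasCompactSupport (HasCompactSupport.of_compactSpace f)

/-- Uniform continuity in terms of cylinders. -/
lemma exists_cyl {m : ℕ} {E : Type*} [NormedAddCommGroup E] (f : SymbSp m → E)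
    (hf : Continuous f) (ε : ℝ) (hε : 0 < ε) :
    ∃ p : ℕ, ∀ x y : SymbSp m, (∀ i < p, x i = y i) → ‖f x - f y‖ ≤ ε := by
  letI : MetricSpace (SymbSp m) := PiNat.metricSpace
  have hu : UniformContinuous f := CompactSpace.uniformContinuous_of_continuous hf
  obtain ⟨δ, hδ, h⟩ := Metric.uniformContinuous_iff.1 hu ε hε
  obtain ⟨p, hp⟩ := exists_pow_lt_of_lt_one hδ (by norm_num : (1 / 2 : ℝ) < 1)
  refine ⟨p, fun x y hxy => ?_⟩
  have h1 : dist x y ≤ (1 / 2 : ℝ) ^ p := PiNat.mem_cylinder_iff_dist_le.1 hxy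
  have := h (h1.trans_lt hp)
  rw [dist_eq_norm] at this
  exact this.le

lemma tendsto_of_bound {E : Type*} [NormedAddCommGroup E] [NormedSpace ℝ E] (s : ℕ → E)
    (h : ∀ ε > 0, ∃ C : ℝ, ∀ N : ℕ, ‖s N‖ ≤ ε * N + C) :
    Tendsto (fun N : ℕ => (N : ℝ)⁻¹ • s N) atTop (𝓝 0) := by
  rw [Metric.tendsto_atTop]
  intro ε hε
  obtain ⟨C, hC⟩ := h (ε / 2) (by positivity)
  obtain ⟨N0, hN0⟩ := exists_nat_gt (2 * C / ε)
  refine ⟨N0 + 1, fun N hN => ?_⟩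
  have hNr : (N0 : ℝ) + 1 ≤ N := by exact_mod_cast hN
  have hpos : (0 : ℝ) < N := by
    have : (0 : ℝ) ≤ N0 := Nat.cast_nonneg _
    linarith
  rw [dist_zero_right, norm_smul, norm_inv, Real.norm_of_nonneg hpos.le, inv_mul_lt_iff₀ hpos]
  have h2 : 2 * C < ε * N := by
    rw [div_lt_iff₀ hε] at hN0
    nlinarith
  have := hC N
  linarith

/-- Greedy choice: some orbit segment has nonpositive inner product with a given vector. -/
lemma exists_inner_le {m : ℕ} {E : Type*} [NormedAddCommGroup E] [InnerProductSpace ℝ E]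
    [CompleteSpace E] (f : SymbSp m → E) (hf : Continuous f) (μ : Measure (SymbSp m))
    [IsProbabilityMeasure μ] (hμ : μ.map shift = μ) (h0 : ∫ ω, f ω ∂μ = 0) (n : ℕ) (S : E) :
    ∃ ω, inner ℝ S (∑ j ∈ Finset.range n, f (shift^[j] ω)) ≤ 0 := by
  have hc : ∀ j, Continuous fun ω : SymbSp m => f (shift^[j] ω) := fun j =>
    hf.comp (shift_continuous.iterate j)
  have hmp : MeasurePreserving (shift : SymbSp m → SymbSp m) μ μ :=
    ⟨shift_continuous.measurable, hμ⟩
  have hj : ∀ j, ∫ ω, f (shift^[j] ω) ∂μ = 0 := by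
    intro j
    have h1 := (hmp.iterate j).map_eq
    have h2 := integral_map (μ := μ) (hmp.iterate j).measurable.aemeasurable
      (f := f) (by rw [h1]; exact (integrable_of_cont f hf μ).aestronglyMeasurable)
    rw [h1] at h2
    rw [← h2, h0]
  have hg : Continuous fun ω : SymbSp m =>
      inner ℝ S (∑ j ∈ Finset.range n, f (shift^[j] ω)) :=
    continuous_const.inner (continuous_finsetSum _ fun j _ => hc j)
  obtain ⟨ω, hω⟩ := exists_le_integral (integrable_of_cont _ hg μ)
  refine ⟨ω, hω.trans_eq ?_⟩
  have h3 := (innerSL ℝ S).integral_comp_comm (μ := μ)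
    (φ := fun ω => ∑ j ∈ Finset.range n, f (shift^[j] ω))
    (integrable_of_cont _ (continuous_finsetSum _ fun j _ => hc j) μ)
  simp only [innerSL_apply_apply] at h3
  rw [h3, integral_finsetSum _ fun j _ => integrable_of_cont _ (hc j) μ]
  simp [hj]

/-- Birkhoff sums. -/
def bs {m : ℕ} {E : Type*} [AddCommMonoid E] (f : SymbSp m → E) (n : ℕ) (x : SymbSp m) : E :=
  ∑ j ∈ Finset.range n, f (shift^[j] x)

lemma norm_sum_le' {E : Type*} [NormedAddCommGroup E] (g : ℕ → E) (M : ℝ) (h : ∀ j, ‖g j‖ ≤ M)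
    (n : ℕ) : ‖∑ j ∈ Finset.range n, g j‖ ≤ n * M := by
  refine (norm_sum_le_of_le _ fun j _ => h j).trans_eq ?_
  simp

/-- the main construction -/
lemma exists_point {m : ℕ} {E : Type*} [NormedAddCommGroup E] [InnerProductSpace ℝ E]
    (f : SymbSp m → E) (hf : Continuous f)
    (hg : ∀ (n : ℕ) (S : E), ∃ ω, inner ℝ S (bs f n ω) ≤ 0) :
    ∃ ω : SymbSp m, Tendsto (fun N : ℕ => (N : ℝ)⁻¹ • bs f N ω) atTop (𝓝 0) := by
  choose w hw using hg
  obtain ⟨M, hM0, hM⟩ := exists_bound f hf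
  -- greedy sums
  let S : ℕ → E := fun k => Nat.rec 0 (fun k s => s + bs f (2 * k + 1) (w (2 * k + 1) s)) k
  let v : ℕ → SymbSp m := fun k => w (2 * k + 1) (S k)
  have hS : ∀ k, S (k + 1) = S k + bs f (2 * k + 1) (v k) := fun k => rfl
  have hSn : ∀ k : ℕ, ‖S k‖ ^ 2 ≤ 4 * M ^ 2 * (k : ℝ) ^ 3 := by
    intro k
    induction k with
    | zero => simp [S]
    | succ k ih =>
      have h1 : inner ℝ (S k) (bs f (2 * k + 1) (v k)) ≤ 0 := hw _ _
      have h2 : ‖bs f (2 * k + 1) (v k)‖ ≤ ((2 * k + 1 : ℕ) : ℝ) * M :=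
        norm_sum_le' _ M (fun j => hM _) _
      have h3 : ‖bs f (2 * k + 1) (v k)‖ ^ 2 ≤ (((2 * k + 1 : ℕ) : ℝ) * M) ^ 2 := by gcongr
      rw [hS, norm_add_sq_real]
      push_cast at h3 ⊢
      have hk : (0 : ℝ) ≤ k := Nat.cast_nonneg k
      nlinarith [mul_nonneg (sq_nonneg M) hk, sq_nonneg M]
  let ω : SymbSp m := fun t => v (Nat.sqrt t) (t - Nat.sqrt t ^ 2)
  have hω : ∀ k j, j < 2 * k + 1 → ω (k ^ 2 + j) = v k j := by
    intro k j hj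
    have : Nat.sqrt (k ^ 2 + j) = k := by
      rw [pow_two]; exact Nat.sqrt_add_eq k (by omega)
    simp only [ω, this]
    congr 1
    omega
  refine ⟨ω, tendsto_of_bound _ fun ε hε => ?_⟩
  obtain ⟨p, hp⟩ := exists_cyl f hf (ε / 3) (by positivity)
  -- comparison on blocks
  have hblock : ∀ k : ℕ, ‖(∑ j ∈ Finset.range (2 * k + 1), f (shift^[k ^ 2 + j] ω))
      - bs f (2 * k + 1) (v k)‖ ≤ (2 * k + 1) * (ε / 3) + p * (2 * M) := by
    intro k
    rw [bs, ← Finset.sum_sub_distrib]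
    have hterm : ∀ j ∈ Finset.range (2 * k + 1),
        ‖f (shift^[k ^ 2 + j] ω) - f (shift^[j] (v k))‖
          ≤ ε / 3 + if 2 * k + 1 < j + p then 2 * M else 0 := by
      intro j hj
      split_ifs with hjp
      · have := norm_sub_le (f (shift^[k ^ 2 + j] ω)) (f (shift^[j] (v k)))
        have := hM (shift^[k ^ 2 + j] ω)
        have := hM (shift^[j] (v k))
        linarith
      · rw [add_zero]
        apply hp
        intro i hi
        rw [shift_iterate_apply, shift_iterate_apply, add_assoc, hω]
        omega
    refine (norm_sum_le_of_le _ hterm).trans ?_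
    rw [Finset.sum_add_distrib, ← Finset.sum_filter, Finset.sum_const, Finset.sum_const,
      Finset.card_range, nsmul_eq_mul, nsmul_eq_mul]
    have hcard : (Finset.filter (fun j => 2 * k + 1 < j + p) (Finset.range (2 * k + 1))).card
        ≤ p := by
      calc _ ≤ (Finset.Ico (2 * k + 1 - p) (2 * k + 1)).card := by
            apply Finset.card_le_card
            intro j hj
            simp only [Finset.mem_filter, Finset.mem_range, Finset.mem_Ico] at hj ⊢
            omega
        _ ≤ p := by rw [Nat.card_Ico]; omega
    push_cast
    gcongr
  have hsq : ∀ K : ℕ, ‖bs f (K ^ 2) ω - S K‖ ≤ (ε / 3) * (K : ℝ) ^ 2 + p * (2 * M) * K := by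
    intro K
    induction K with
    | zero => simp [bs, S]
    | succ k ih =>
      have e : (k + 1) ^ 2 = k ^ 2 + (2 * k + 1) := by ring
      have h1 : bs f ((k + 1) ^ 2) ω - S (k + 1) = (bs f (k ^ 2) ω - S k) +
          ((∑ j ∈ Finset.range (2 * k + 1), f (shift^[k ^ 2 + j] ω))
            - bs f (2 * k + 1) (v k)) := by
        rw [hS, e, bs, Finset.sum_range_add, ← bs]
        abel
      rw [h1]
      refine (norm_add_le _ _).trans ((add_le_add ih (hblock k)).trans_eq ?_)
      push_cast
      ring
  -- total
  set a : ℝ := 3 * M ^ 2 / ε + p * (2 * M) + 2 * M with ha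
  refine ⟨3 * a ^ 2 / (4 * ε), fun N => ?_⟩
  set K := Nat.sqrt N with hK
  have hK1 : K ^ 2 ≤ N := Nat.sqrt_le' N
  have hK2 : N ≤ K ^ 2 + 2 * K := by
    have := Nat.sqrt_le_add N
    rw [← hK] at this
    nlinarith
  obtain ⟨r, hr⟩ := Nat.exists_eq_add_of_le hK1
  have hr2 : (r : ℝ) ≤ 2 * K := by
    have : r ≤ 2 * K := by omega
    exact_mod_cast this
  have htail : ‖∑ j ∈ Finset.range r, f (shift^[K ^ 2 + j] ω)‖ ≤ 2 * K * M :=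
    (norm_sum_le' _ M (fun j => hM _) r).trans (by gcongr)
  have hdec : bs f N ω = (bs f (K ^ 2) ω - S K) + S K +
      ∑ j ∈ Finset.range r, f (shift^[K ^ 2 + j] ω) := by
    rw [hr, bs, Finset.sum_range_add, ← bs]
    abel
  have hKr : (0 : ℝ) ≤ K := Nat.cast_nonneg K
  have hSK : ‖S K‖ ≤ (ε / 3) * (K : ℝ) ^ 2 + 3 * M ^ 2 / ε * K := by
    apply le_of_sq_le_sq _ (by positivity)
    refine (hSn K).trans ?_
    have h4 : 4 * M ^ 2 * (K : ℝ) ^ 3 = 4 * ((ε / 3) * (K : ℝ) ^ 2) * (3 * M ^ 2 / ε * K) := by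
      field_simp
    rw [h4]
    nlinarith [sq_nonneg ((ε / 3) * (K : ℝ) ^ 2 - 3 * M ^ 2 / ε * K)]
  have hfin : a * K ≤ (ε / 3) * (K : ℝ) ^ 2 + 3 * a ^ 2 / (4 * ε) := by
    have h5 : (ε / 3) * (K : ℝ) ^ 2 + 3 * a ^ 2 / (4 * ε) - a * K
        = (ε / 3) * (K - 3 * a / (2 * ε)) ^ 2 := by
      field_simp
      ring
    have : 0 ≤ (ε / 3) * (K - 3 * a / (2 * ε)) ^ 2 := by positivity
    linarith
  have hKN : (K : ℝ) ^ 2 ≤ N := by exact_mod_cast hK1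
  have hn : ‖bs f N ω‖ ≤ ‖bs f (K ^ 2) ω - S K‖ + ‖S K‖ +
      ‖∑ j ∈ Finset.range r, f (shift^[K ^ 2 + j] ω)‖ := by
    rw [hdec]
    exact (norm_add_le _ _).trans (by gcongr; exact norm_add_le _ _)
  have := hsq K
  have h6 : ε * (K : ℝ) ^ 2 ≤ ε * N := by gcongr
  have h7 : a * K = 3 * M ^ 2 / ε * K + p * (2 * M) * K + 2 * K * M := by rw [ha]; ring
  linarith

/-- Empirical measures. -/
def emp {m : ℕ} (ω : SymbSp m) (n : ℕ) : Measure (SymbSp m) :=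
  ((n : ENNReal) + 1)⁻¹ • ∑ j ∈ Finset.range (n + 1), Measure.dirac (shift^[j] ω)

lemma emp_prob {m : ℕ} (ω : SymbSp m) (n : ℕ) : IsProbabilityMeasure (emp ω n) := by
  constructor
  simp only [emp, Measure.smul_apply, Measure.finset_sum_apply, measure_univ, Finset.sum_const,
    Finset.card_range, nsmul_eq_mul, mul_one, smul_eq_mul]
  push_cast
  exact ENNReal.inv_mul_cancel (by simp) (by finiteness)

lemma emp_integral {m : ℕ} (ω : SymbSp m) (n : ℕ) (g : SymbSp m → ℝ) (hg : Continuous g) :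
    ∫ x, g x ∂(emp ω n) = birkhoff shift g (n + 1) ω := by
  rw [emp, integral_smul_measure, integral_finset_sum_measure
    (fun j _ => integrable_of_cont g hg _)]
  simp only [integral_dirac, birkhoff]
  congr 1
  simp [ENNReal.toReal_add]

lemma exists_measure {m : ℕ} (ω : SymbSp m) :
    ∃ (U : Filter ℕ) (μ : Measure (SymbSp m)), U.NeBot ∧ U ≤ atTop ∧ μ ∈ shiftInvMeasures m ∧
      ∀ g : SymbSp m → ℝ, Continuous g →
        Tendsto (fun n => birkhoff shift g (n + 1) ω) U (𝓝 (∫ x, g x ∂μ)) := by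
  let P : ℕ → ProbabilityMeasure (SymbSp m) := fun n => ⟨emp ω n, emp_prob ω n⟩
  let U : Ultrafilter ℕ := Ultrafilter.of atTop
  have hU : (U : Filter ℕ) ≤ atTop := Ultrafilter.of_le atTop
  obtain ⟨μ, -, hμ⟩ := isCompact_univ.ultrafilter_le_nhds (U.map P) (by simp)
  have hμ' : Tendsto P U (𝓝 μ) := hμ
  rw [ProbabilityMeasure.tendsto_iff_forall_integral_tendsto] at hμ'
  have key : ∀ g : SymbSp m → ℝ, Continuous g →
      Tendsto (fun n => birkhoff shift g (n + 1) ω) U (𝓝 (∫ x, g x ∂(μ : Measure _))) := by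
    intro g hg
    have := hμ' (BoundedContinuousFunction.mkOfCompact ⟨g, hg⟩)
    simp only [BoundedContinuousFunction.mkOfCompact_apply, ContinuousMap.coe_mk] at this
    refine this.congr fun n => ?_
    exact emp_integral ω n g hg
  refine ⟨U, μ, inferInstance, hU, ⟨inferInstance, ?_⟩, key⟩
  haveI : IsProbabilityMeasure ((μ : Measure (SymbSp m)).map shift) :=
    Measure.isProbabilityMeasure_map shift_continuous.measurable.aemeasurable
  apply ext_of_forall_integral_eq_of_IsFiniteMeasure
  intro g
  rw [integral_map shift_continuous.measurable.aemeasurable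
    g.continuous.aestronglyMeasurable]
  have h1 := key _ (g.continuous.comp shift_continuous)
  have h2 := key _ g.continuous
  have h3 : Tendsto (fun n => birkhoff shift (g ∘ shift) (n + 1) ω -
      birkhoff shift g (n + 1) ω) U (𝓝 0) := by
    have hb := tendsto_birkhoffAverage_apply_sub_birkhoffAverage ℝ (f := shift) (g := g) (x := ω)
      (g.isBounded_range.subset (by rintro _ ⟨n, rfl⟩; exact ⟨_, rfl⟩))
    refine ((hb.comp (tendsto_add_atTop_nat 1)).mono_left hU).congr fun n => ?_
    simp only [Function.comp_apply, birkhoff, birkhoffAverage, birkhoffSum]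
    congr 2
    refine Finset.sum_congr rfl fun j _ => ?_
    rw [← Function.iterate_succ_apply, Function.iterate_succ_apply']
  have h4 := tendsto_nhds_unique h3 (h1.sub h2)
  simp only [Function.comp_apply] at h4
  linarith

end LevelSetProof

/-- The level set `X_α` is nonempty iff `α ∈ L_f`. -/
theorem statement18 {m d : ℕ} (hm : 0 < m)
    (f : SymbSp m → EuclideanSpace ℝ (Fin d)) (hf : Continuous f)
    (α : EuclideanSpace ℝ (Fin d)) :
    (symbLevelSet f α).Nonempty ↔
      ∃ μ ∈ shiftInvMeasures m, (∫ ω, f ω ∂μ) = α := by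
  constructor
  · rintro ⟨ω, hω⟩
    obtain ⟨U, μ, hne, hU, hμ, hlim⟩ := LevelSetProof.exists_measure ω
    refine ⟨μ, hμ, ?_⟩
    haveI : IsProbabilityMeasure μ := hμ.1
    refine ext_inner_left ℝ fun v => ?_
    have h3 := (innerSL ℝ v).integral_comp_comm (μ := μ) (φ := f)
      (LevelSetProof.integrable_of_cont f hf μ)
    simp only [innerSL_apply_apply] at h3
    rw [← h3]
    have h1 := hlim (fun x => inner ℝ v (f x)) (continuous_const.inner hf)
    have h2 : Tendsto (fun n => inner ℝ v (birkhoff shift f (n + 1) ω)) U (𝓝 (inner ℝ v α)) :=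
      (tendsto_const_nhds.inner ((Tendsto.comp hω (tendsto_add_atTop_nat 1)).mono_left hU))
    refine tendsto_nhds_unique h1 (h2.congr fun n => ?_)
    simp only [birkhoff, inner_smul_right, inner_sum, smul_eq_mul]
  · rintro ⟨μ, ⟨hp, hinv⟩, hα⟩
    have hf' : Continuous fun x => f x - α := hf.sub continuous_const
    have h0 : ∫ x, (f x - α) ∂μ = 0 := by
      rw [integral_sub (LevelSetProof.integrable_of_cont f hf μ) (integrable_const α), hα]
      simp
    obtain ⟨ω, hω⟩ := LevelSetProof.exists_point (fun x => f x - α) hf'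
      (fun n S => LevelSetProof.exists_inner_le _ hf' μ hinv h0 n S)
    refine ⟨ω, ?_⟩
    have h1 := hω.add_const α
    rw [zero_add] at h1
    refine Tendsto.congr' ?_ h1
    filter_upwards [eventually_ne_atTop 0] with N hN
    have hN' : (N : ℝ) ≠ 0 := by exact_mod_cast hN
    simp only [LevelSetProof.bs, birkhoff, Finset.sum_sub_distrib, Finset.sum_const,
      Finset.card_range, smul_sub]
    rw [← Nat.cast_smul_eq_nsmul ℝ, smul_smul, inv_mul_cancel₀ hN', one_smul, sub_add_cancel]
end
end
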